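/- Let t ≥ 1 be an integer, and set μ_t(n) := √(6n)/π − t/2 + 3/π² + δ_t/4 and σ_t(n) := ((π² − 6)√(6n)/π³)^{1/2}. Then the number N_t of hooks of length t, viewed as a statistic on the self-conjugate partitions of n, is asymptotically normally distributed: for every x ∈ ℝ, lim_{n→∞} (1/sc(n)) · #{λ ∈ SC(n) : N_t(λ) ≤ μ_t(n) + x·σ_t(n)} = (1/√(2π)) ∫_{−∞}^{x} e^{−u²/2} du. -/

import Mathlib

open scoped Real Classical
open Complex Filter Asymptotics

noncomputable section

/-- The conjugate part `λ'_k`: the number of parts of `P` that are at least `k`. -/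
def colLen {n : ℕ} (P : n.Partition) (k : ℕ) : ℕ :=
  Multiset.card (P.parts.filter (fun p => k ≤ p))

/-- The part `λ_j` (the `j`-th largest part, 1-indexed), recovered by conjugating twice. -/
def rowLen {n : ℕ} (P : n.Partition) (j : ℕ) : ℕ :=
  ((Finset.Icc 1 n).filter (fun k => j ≤ colLen P k)).card

/-- The hook number `h(j,k) = (λ_j - j) + (λ'_k - k) + 1` of the cell `(j,k)` (1-indexed). -/
def hookNum {n : ℕ} (P : n.Partition) (j k : ℕ) : ℤ :=
  ((rowLen P j : ℤ) - j) + ((colLen P k : ℤ) - k) + 1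

/-- `N_t(λ)`: the number of cells of the Young diagram of `λ` with hook number `t`. -/
def Nhook {n : ℕ} (t : ℕ) (P : n.Partition) : ℕ :=
  (((Finset.Icc 1 n) ×ˢ (Finset.Icc 1 n)).filter
    (fun c => c.2 ≤ rowLen P c.1 ∧ hookNum P c.1 c.2 = (t : ℤ))).card

/-- A partition is self-conjugate if `λ_k = λ'_k` for all `k ≥ 1`. -/
def IsSelfConjugate {n : ℕ} (P : n.Partition) : Prop :=
  ∀ k, 1 ≤ k → rowLen P k = colLen P k

/-- `SC(n)`, the set of self-conjugate partitions of `n`. -/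
def SC (n : ℕ) : Finset (Nat.Partition n) :=
  Finset.univ.filter (fun P => IsSelfConjugate P)

/-- `δ_t = 1` if `t` is odd, else `0`. -/
def delta (t : ℕ) : ℝ := if Odd t then 1 else 0

/-- The region `D_θ = { r e^{iα} : r ≥ 0, |α| ≤ θ }`. -/
def Dset (θ : ℝ) : Set ℂ := {z | z = 0 ∨ |z.arg| ≤ θ}

/-- The filter of punctured neighborhoods of `0` intersected with `D_θ`. -/
def near0 (θ : ℝ) : Filter ℂ := nhdsWithin 0 (Dset θ \ {0})

/-- The dilogarithm `Li₂(X) = -∫₀¹ log(1 - Xu)/u du` (principal logarithm). -/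
def Li2 (X : ℂ) : ℂ := -∫ u in (0:ℝ)..1, Complex.log (1 - X * u) / (u : ℂ)

/-- The real dilogarithm, for real arguments `x < 1`. -/
def Li2R (x : ℝ) : ℝ := -∫ u in (0:ℝ)..1, Real.log (1 - x * u) / u

/-- The principal complex square root. -/
def csqrt (z : ℂ) : ℂ := z ^ ((1:ℂ)/2)

/-- The infinite Pochhammer symbol `(a;q)_∞ = ∏_{j ≥ 0} (1 - a q^j)`. -/
def pochInf (a q : ℂ) : ℂ := ∏' j : ℕ, (1 - a * q ^ j)

/-- The finite Pochhammer symbol `(a;q)_n = ∏_{j=0}^{n-1} (1 - a q^j)`. -/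
def pochN (a q : ℂ) (n : ℕ) : ℂ := ∏ j ∈ Finset.range n, (1 - a * q ^ j)

/-- `C_T^+ = 1 + √((1-T)/(1+T))`. -/
def Cp (T : ℝ) : ℂ := 1 + csqrt ((1 - (T:ℂ)) / (1 + (T:ℂ)))

/-- `C_T^- = 1 - √((1-T)/(1+T))`. -/
def Cm (T : ℝ) : ℂ := 1 - csqrt ((1 - (T:ℂ)) / (1 + (T:ℂ)))

/-- `H*(T;q) = (1/(2T)) [ C_T^+ (√(1-T²);-q)_∞ + C_T^- (-√(1-T²);-q)_∞ ]`. -/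
def Hstar (T : ℝ) (q : ℂ) : ℂ :=
  1 / (2 * (T:ℂ)) * (Cp T * pochInf (csqrt (1 - (T:ℂ)^2)) (-q)
    + Cm T * pochInf (-csqrt (1 - (T:ℂ)^2)) (-q))

/-- `α_T^+ = (1/(2T)) ( C_T^+ + C_T^- √((1+√(1-T²))/(1-√(1-T²))) )`. -/
def alphaP (T : ℝ) : ℂ :=
  1 / (2 * (T:ℂ)) *
    (Cp T + Cm T * csqrt ((1 + csqrt (1 - (T:ℂ)^2)) / (1 - csqrt (1 - (T:ℂ)^2))))

/-- `α_T^- = (1/(2T)) ( C_T^+ - C_T^- √((1+√(1-T²))/(1-√(1-T²))) )`. -/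
def alphaM (T : ℝ) : ℂ :=
  1 / (2 * (T:ℂ)) *
    (Cp T - Cm T * csqrt ((1 + csqrt (1 - (T:ℂ)^2)) / (1 - csqrt (1 - (T:ℂ)^2))))

/-- `b_t(T)` from Proposition: saddle-point constant. -/
def bt (t : ℕ) (T : ℝ) : ℝ :=
  if Even t then (1/2) * Real.sqrt (π^2/6 - Li2R (1 - T^2))
  else (1/2) * Real.sqrt (π^2/6 - ((t-1 : ℝ)/t) * Li2R (1 - T^2))

end

section Combinatorics

lemma colLen_antitone {n : ℕ} (P : n.Partition) : Antitone (colLen P) := by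
  intro a b hab
  refine Multiset.card_le_card (Multiset.monotone_filter_right _ fun p hp => hab.trans hp)

lemma colLen_eq_zero {n : ℕ} (P : n.Partition) {k : ℕ} (hk : n < k) : colLen P k = 0 := by
  unfold colLen
  rw [Multiset.card_eq_zero, Multiset.filter_eq_nil]
  intro p hp hkp
  have := Multiset.le_sum_of_mem hp
  rw [P.parts_sum] at this
  omega

lemma le_rowLen_iff {n : ℕ} (P : n.Partition) {j k : ℕ} (hj : 1 ≤ j) (hk : 1 ≤ k) :
    k ≤ rowLen P j ↔ j ≤ colLen P k := by
  unfold rowLen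
  constructor
  · intro h
    by_contra hc
    have : ((Finset.Icc 1 n).filter (fun k => j ≤ colLen P k)) ⊆ Finset.Icc 1 (k - 1) := by
      intro m hm
      simp only [Finset.mem_filter, Finset.mem_Icc] at hm ⊢
      refine ⟨hm.1.1, ?_⟩
      by_contra hmk
      exact hc (hm.2.trans (colLen_antitone P (by omega)))
    have := Finset.card_le_card this
    simp at this
    omega
  · intro h
    have hkn : k ≤ n := by
      by_contra hkn
      rw [colLen_eq_zero P (by omega)] at h
      omega
    have : Finset.Icc 1 k ⊆ ((Finset.Icc 1 n).filter (fun k => j ≤ colLen P k)) := by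
      intro m hm
      simp only [Finset.mem_filter, Finset.mem_Icc] at hm ⊢
      exact ⟨⟨hm.1, by omega⟩, h.trans (colLen_antitone P hm.2)⟩
    have := Finset.card_le_card this
    simpa using this

lemma rowLen_le {n : ℕ} (P : n.Partition) (j : ℕ) : rowLen P j ≤ n := by
  unfold rowLen
  exact (Finset.card_filter_le _ _).trans (by simp)

/-- The row lengths of a self-conjugate partition satisfy a symmetric relation. -/
lemma le_rowLen_comm {n : ℕ} {P : n.Partition} (hP : IsSelfConjugate P) {j k : ℕ}
    (hj : 1 ≤ j) (hk : 1 ≤ k) : k ≤ rowLen P j ↔ j ≤ rowLen P k := by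
  rw [le_rowLen_iff P hj hk, hP k hk]

lemma rowLen_antitone {n : ℕ} (P : n.Partition) : Antitone (rowLen P) := by
  intro a b hab
  refine Finset.card_le_card (Finset.monotone_filter_right _ fun k _ hk => hab.trans hk)

/-- The set of Frobenius coordinates `λ_j - j ≥ 0`. -/
noncomputable def frob {n : ℕ} (P : n.Partition) : Finset ℕ :=
  (Finset.range n).filter (fun s => ∃ j, 1 ≤ j ∧ rowLen P j = j + s)

lemma mem_frob {n : ℕ} (P : n.Partition) (s : ℕ) :
    s ∈ frob P ↔ ∃ j, 1 ≤ j ∧ rowLen P j = j + s := by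
  unfold frob
  simp only [Finset.mem_filter, Finset.mem_range, and_iff_right_iff_imp]
  rintro ⟨j, hj, h⟩
  have := rowLen_le P j
  omega

lemma notMem_frob_iff {n : ℕ} {P : n.Partition} (hP : IsSelfConjugate P) (s : ℕ) :
    s ∉ frob P ↔ ∃ k, 1 ≤ k ∧ k = rowLen P k + s + 1 := by
  rw [mem_frob]
  constructor
  · intro h
    have hex : ∃ k, rowLen P k + s < k := ⟨n + s + 1, by have := rowLen_le P (n + s + 1); omega⟩
    have hk := Nat.find_spec hex
    have hmin := fun m => Nat.find_min hex (m := m)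
    set k := Nat.find hex with hkdef
    clear_value k
    refine ⟨k, by omega, ?_⟩
    by_contra hne
    have h1 := hmin (k - 1) (by omega)
    apply h
    have h2 := le_rowLen_comm hP (j := k - 1 - s) (k := k - 1) (by omega) (by omega)
    have h3 := le_rowLen_comm hP (j := k - 1 - s) (k := k) (by omega) (by omega)
    exact ⟨k - 1 - s, by omega, by omega⟩
  · rintro ⟨k, hk, h⟩ ⟨j, hj, h'⟩
    have h3 := le_rowLen_comm hP (j := j) (k := k) (by omega) (by omega)
    omega

/-- The number of elements `s` of `S` for which `s - t` is not an element of `S`. -/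
noncomputable def asc (t : ℕ) (S : Finset ℕ) : ℕ :=
  (S.filter (fun s => ¬ (t ≤ s ∧ s - t ∈ S))).card

/-- The weight `∑ (2 s + 1)` of a set. -/
def wt (S : Finset ℕ) : ℕ := ∑ s ∈ S, (2 * s + 1)

lemma rowLen_inj_of_le {n : ℕ} (P : n.Partition) {i j : ℕ} {s : ℤ}
    (hi : (rowLen P i : ℤ) = i + s) (hj : (rowLen P j : ℤ) = j + s) : i = j := by
  rcases lt_trichotomy i j with h | h | h
  · have := rowLen_antitone P h.le
    omega
  · exact h
  · have := rowLen_antitone P h.le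
    omega

lemma Nhook_asc {n t : ℕ} (ht : 1 ≤ t) {P : n.Partition} (hP : IsSelfConjugate P) :
    Nhook t P ≤ 2 * asc t (frob P) + t ∧ 2 * asc t (frob P) ≤ Nhook t P + 2 * t := by
  set I := Finset.Icc 1 n
  set T1 := (I ×ˢ I).filter (fun c : ℕ × ℕ => (rowLen P c.1 : ℤ) - c.1 + (rowLen P c.2 - c.2) + 1 = t ∧
    c.1 ≤ rowLen P c.1 ∧ rowLen P c.2 < c.2)
  set T2 := (I ×ˢ I).filter (fun c : ℕ × ℕ => (rowLen P c.1 : ℤ) - c.1 + (rowLen P c.2 - c.2) + 1 = t ∧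
    c.2 ≤ rowLen P c.2 ∧ rowLen P c.1 < c.1)
  set T3 := (I ×ˢ I).filter (fun c : ℕ × ℕ => (rowLen P c.1 : ℤ) - c.1 + (rowLen P c.2 - c.2) + 1 = t ∧
    c.2 ≤ rowLen P c.2 ∧ c.1 ≤ rowLen P c.1)
  have hN : Nhook t P = T1.card + T2.card + T3.card := by
    have h12 : Disjoint T1 T2 := by
      rw [Finset.disjoint_left]
      intro c hc hc'
      simp only [T1, T2, Finset.mem_filter] at hc hc'
      omega
    have h123 : Disjoint (T1 ∪ T2) T3 := by
      rw [Finset.disjoint_left]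
      intro c hc hc'
      simp only [T1, T2, T3, Finset.mem_union, Finset.mem_filter] at hc hc'
      omega
    rw [← Finset.card_union_of_disjoint h12, ← Finset.card_union_of_disjoint h123]
    unfold Nhook
    congr 1
    ext c
    simp only [T1, T2, T3, Finset.mem_union, Finset.mem_filter, I, Finset.mem_product,
      Finset.mem_Icc]
    unfold hookNum
    constructor
    · rintro ⟨⟨h1, h2⟩, h3, h4⟩
      rw [← hP _ h2.1] at h4
      simp only [h1, h2, true_and, and_self]
      omega
    · intro h
      have h12 : (1 ≤ c.1 ∧ c.1 ≤ n) ∧ 1 ≤ c.2 ∧ c.2 ≤ n := by tauto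
      have := le_rowLen_comm hP h12.1.1 h12.2.1
      rw [← hP _ h12.2.1]
      refine ⟨h12, ?_⟩
      simp only [h12] at h
      omega
  have h12 : T1.card = T2.card := by
    refine Finset.card_bij' (fun c _ => (c.2, c.1)) (fun c _ => (c.2, c.1)) ?_ ?_ ?_ ?_
    · intro c hc
      simp only [T1, T2, Finset.mem_filter, Finset.mem_product] at hc ⊢
      refine ⟨⟨hc.1.2, hc.1.1⟩, ?_⟩
      omega
    · intro c hc
      simp only [T1, T2, Finset.mem_filter, Finset.mem_product] at hc ⊢
      refine ⟨⟨hc.1.2, hc.1.1⟩, ?_⟩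
      omega
    · simp
    · simp
  have h3 : T3.card ≤ t := by
    have : T3.card ≤ (Finset.range t).card := by
      refine Finset.card_le_card_of_injOn (fun c => rowLen P c.1 - c.1) ?_ ?_
      · intro c hc
        simp only [T3, Finset.coe_filter, Set.mem_ofPred_eq] at hc
        simp only [Finset.coe_range, Set.mem_Iio]
        omega
      · intro c hc c' hc' h
        simp only [T3, Finset.coe_filter, Set.mem_ofPred_eq] at hc hc' h
        have e1 : c.1 = c'.1 := rowLen_inj_of_le P (s := (rowLen P c.1 : ℤ) - c.1) (by omega) (by omega)
        have e2 : c.2 = c'.2 := rowLen_inj_of_le P (s := (rowLen P c.2 : ℤ) - c.2) (by omega) (by omega)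
        exact Prod.ext e1 e2
    simpa using this
  have h1 : T1.card = ((frob P).filter (fun s => t ≤ s ∧ s - t ∉ frob P)).card := by
    refine Finset.card_bij (fun c _ => rowLen P c.1 - c.1) ?_ ?_ ?_
    · intro c hc
      simp only [T1, Finset.mem_filter, Finset.mem_product, I, Finset.mem_Icc] at hc
      rw [Finset.mem_filter, mem_frob, notMem_frob_iff hP]
      refine ⟨⟨c.1, hc.1.1.1, by omega⟩, by omega, ⟨c.2, hc.1.2.1, ?_⟩⟩
      omega
    · intro c hc c' hc' h
      simp only [T1, Finset.mem_filter] at hc hc' h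
      have e1 : c.1 = c'.1 := rowLen_inj_of_le P (s := (rowLen P c.1 : ℤ) - c.1) (by omega) (by omega)
      have e2 : c.2 = c'.2 := rowLen_inj_of_le P (s := (rowLen P c.2 : ℤ) - c.2) (by omega) (by omega)
      exact Prod.ext e1 e2
    · intro s hs
      rw [Finset.mem_filter, mem_frob, notMem_frob_iff hP] at hs
      obtain ⟨⟨j, hj, hjs⟩, hts, k, hk, hks⟩ := hs
      have := le_rowLen_comm hP hj hk
      have := rowLen_le P j
      have := rowLen_le P 1
      have := rowLen_antitone P hk
      have := rowLen_antitone P hj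
      have := (le_rowLen_comm hP hj le_rfl).1 (by omega)
      refine ⟨(j, k), ?_, ?_⟩
      · simp only [T1, Finset.mem_filter, Finset.mem_product, I, Finset.mem_Icc]
        omega
      · change rowLen P j - j = s
        omega
  have h4 : asc t (frob P) ≤ T1.card + t ∧ T1.card ≤ asc t (frob P) := by
    rw [h1]
    unfold asc
    constructor
    · have : (frob P).filter (fun s => ¬ (t ≤ s ∧ s - t ∈ frob P)) ⊆
          (frob P).filter (fun s => t ≤ s ∧ s - t ∉ frob P) ∪ Finset.range t := by
        intro s
        simp only [Finset.mem_filter, Finset.mem_union, Finset.mem_range]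
        rintro ⟨h1, h2⟩
        by_cases h : t ≤ s
        · left; tauto
        · right; omega
      refine (Finset.card_le_card this).trans ((Finset.card_union_le _ _).trans ?_)
      simp
    · refine Finset.card_le_card (Finset.monotone_filter_right _ fun s _ => ?_)
      simp only [not_and]
      tauto
  omega

lemma card_le_frob {n : ℕ} {P : n.Partition} {j m : ℕ} (hj : 1 ≤ j) :
    j + m ≤ rowLen P j ↔ j ≤ ((frob P).filter (fun s => m ≤ s)).card := by
  have key : ((frob P).filter (fun s => m ≤ s)).card =
      ((Finset.Icc 1 n).filter (fun i => i + m ≤ rowLen P i)).card := by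
    symm
    refine Finset.card_bij (fun i _ => rowLen P i - i) ?_ ?_ ?_
    · intro i hi
      simp only [Finset.mem_filter, Finset.mem_Icc, mem_frob] at hi ⊢
      exact ⟨⟨i, by omega, by omega⟩, by omega⟩
    · intro i hi i' hi' h
      simp only [Finset.mem_filter] at hi hi' h
      exact rowLen_inj_of_le P (s := (rowLen P i : ℤ) - i) (by omega) (by omega)
    · intro s hs
      simp only [Finset.mem_filter, mem_frob] at hs
      obtain ⟨⟨i, hi, his⟩, hms⟩ := hs
      have := rowLen_le P i
      refine ⟨i, ?_, by omega⟩
      simp only [Finset.mem_filter, Finset.mem_Icc]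
      omega
  rw [key]
  constructor
  · intro h
    have : Finset.Icc 1 j ⊆ (Finset.Icc 1 n).filter (fun i => i + m ≤ rowLen P i) := by
      intro i hi
      simp only [Finset.mem_filter, Finset.mem_Icc] at hi ⊢
      have := rowLen_antitone P hi.2
      have := rowLen_le P j
      omega
    simpa using Finset.card_le_card this
  · intro h
    by_contra hc
    have : (Finset.Icc 1 n).filter (fun i => i + m ≤ rowLen P i) ⊆ Finset.Icc 1 (j - 1) := by
      intro i hi
      simp only [Finset.mem_filter, Finset.mem_Icc] at hi ⊢
      refine ⟨hi.1.1, ?_⟩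
      by_contra hij
      have := rowLen_antitone P (show j ≤ i by omega)
      omega
    have := Finset.card_le_card this
    simp at this
    omega

lemma frob_injOn (n : ℕ) : Set.InjOn (frob (n := n)) (SC n) := by
  intro P hP Q hQ h
  simp only [SC, Finset.coe_filter, Finset.mem_univ, true_and, Set.mem_ofPred_eq] at hP hQ
  have hrow : ∀ j k, 1 ≤ j → 1 ≤ k → j ≤ k → (k ≤ rowLen P j ↔ k ≤ rowLen Q j) := by
    intro j k hj hk hjk
    obtain ⟨m, rfl⟩ := Nat.exists_eq_add_of_le hjk
    rw [card_le_frob hj, card_le_frob hj, h]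
  have hrow' : ∀ j k, 1 ≤ j → 1 ≤ k → (k ≤ rowLen P j ↔ k ≤ rowLen Q j) := by
    intro j k hj hk
    rcases le_total j k with hjk | hjk
    · exact hrow j k hj hk hjk
    · rw [le_rowLen_comm hP hj hk, le_rowLen_comm hQ hj hk]
      exact hrow k j hk hj hjk
  have hcol : ∀ k, 1 ≤ k → colLen P k = colLen Q k := by
    intro k hk
    rw [← hP k hk, ← hQ k hk]
    refine eq_of_forall_le_iff fun c => ?_
    rcases Nat.eq_zero_or_pos c with rfl | hc
    · simp
    · exact hrow' k c hk hc
  have hcount : ∀ (R : n.Partition) (p : ℕ), R.parts.count p + colLen R (p + 1) = colLen R p := by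
    intro R p
    unfold colLen
    rw [Multiset.count_eq_card_filter_eq, ← Multiset.card_add]
    congr 1
    rw [Multiset.filter_add_filter]
    have e2 : R.parts.filter (fun a => p = a ∧ p + 1 ≤ a) = 0 := by
      rw [Multiset.filter_eq_nil]; intros; omega
    rw [e2, add_zero]
    refine Multiset.filter_congr fun a _ => ?_
    omega
  refine Nat.Partition.ext (Multiset.ext.2 fun p => ?_)
  rcases Nat.eq_zero_or_pos p with rfl | hp
  · rw [Multiset.count_eq_zero_of_notMem, Multiset.count_eq_zero_of_notMem]
    · exact fun h => absurd (Q.parts_pos h) (by simp)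
    · exact fun h => absurd (P.parts_pos h) (by simp)
  · have h1 := hcount P p
    have h2 := hcount Q p
    rw [hcol p hp, hcol (p + 1) (by omega)] at h1
    omega

lemma sum_colLen {n : ℕ} (P : n.Partition) : ∑ k ∈ Finset.Icc 1 n, colLen P k = n := by
  have h : ∀ m : Multiset ℕ, (∀ p ∈ m, p ≤ n) →
      ∑ k ∈ Finset.Icc 1 n, Multiset.card (m.filter (fun p => k ≤ p)) = m.sum := by
    intro m
    induction m using Multiset.induction_on with
    | empty => simp
    | cons a m ih =>
      intro hm
      have : ∀ k, Multiset.card ((a ::ₘ m).filter (fun p => k ≤ p)) =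
          (if k ≤ a then 1 else 0) + Multiset.card (m.filter (fun p => k ≤ p)) := by
        intro k
        rw [Multiset.filter_cons, Multiset.card_add]
        split_ifs <;> simp
      simp_rw [this]
      rw [Finset.sum_add_distrib, ih (fun p hp => hm p (Multiset.mem_cons_of_mem hp)),
        Multiset.sum_cons]
      congr 1
      rw [← Finset.card_filter]
      have : (Finset.Icc 1 n).filter (fun k => k ≤ a) = Finset.Icc 1 a := by
        ext k
        have := hm a (Multiset.mem_cons_self a m)
        simp only [Finset.mem_filter, Finset.mem_Icc]
        omega
      rw [this]; simp
  have := h P.parts (fun p hp => by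
    have := Multiset.le_sum_of_mem hp
    rwa [P.parts_sum] at this)
  rw [P.parts_sum] at this
  exact this

lemma wt_frob {n : ℕ} {P : n.Partition} (hP : IsSelfConjugate P) : wt (frob P) = n := by
  set C := ((Finset.Icc 1 n) ×ˢ (Finset.Icc 1 n)).filter (fun c : ℕ × ℕ => c.2 ≤ rowLen P c.1)
    with hC
  have hcard : C.card = n := by
    rw [hC, Finset.card_filter, Finset.sum_product]
    conv_rhs => rw [← sum_colLen P]
    refine Finset.sum_congr rfl fun j hj => ?_
    rw [Finset.mem_Icc] at hj
    rw [← hP j hj.1, ← Finset.card_filter]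
    have : (Finset.Icc 1 n).filter (fun k => k ≤ rowLen P j) = Finset.Icc 1 (rowLen P j) := by
      ext k
      have := rowLen_le P j
      simp only [Finset.mem_filter, Finset.mem_Icc]
      omega
    simp [this]
  have hfib := Finset.card_eq_sum_card_fiberwise (s := C) (t := Finset.Icc 1 n)
    (f := fun c => min c.1 c.2) (by
      intro c hc
      simp only [hC, Finset.coe_filter, Finset.mem_product, Finset.mem_Icc, Set.mem_ofPred_eq] at hc
      simp only [Finset.coe_Icc, Set.mem_Icc]
      omega)
  have hfiber : ∀ i ∈ Finset.Icc 1 n, (C.filter (fun c => min c.1 c.2 = i)).card =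
      if i ≤ rowLen P i then 2 * (rowLen P i - i) + 1 else 0 := by
    intro i hi
    rw [Finset.mem_Icc] at hi
    have e : C.filter (fun c => min c.1 c.2 = i) =
        (Finset.Icc i (rowLen P i)).image (fun k => (i, k)) ∪
        (Finset.Ioc i (rowLen P i)).image (fun j => (j, i)) := by
      ext ⟨j, k⟩
      simp only [hC, Finset.mem_filter, Finset.mem_product, Finset.mem_Icc, Finset.mem_union,
        Finset.mem_image, Finset.mem_Ioc, Prod.mk.injEq]
      constructor
      · rintro ⟨⟨⟨h1, h2⟩, h3⟩, h4⟩
        have := le_rowLen_comm hP h1.1 h2.1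
        rcases le_or_gt j k with hjk | hjk
        · have : j = i := by omega
          subst this
          left
          exact ⟨k, by omega, rfl, rfl⟩
        · have : k = i := by omega
          subst this
          right
          exact ⟨j, by omega, rfl, rfl⟩
      · have := rowLen_le P i
        rintro (⟨k', h, h1, h2⟩ | ⟨j', h, h1, h2⟩)
        · subst h1 h2
          omega
        · subst h1 h2
          have := le_rowLen_comm hP (j := j')  (k := i) (by omega) (by omega)
          omega
    rw [e, Finset.card_union_of_disjoint, Finset.card_image_of_injective,
      Finset.card_image_of_injective]
    · simp only [Nat.card_Icc, Nat.card_Ioc]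
      split_ifs <;> omega
    · intro a b h; simpa using h
    · intro a b h; simpa using h
    · rw [Finset.disjoint_left]
      simp only [Finset.mem_image, Finset.mem_Icc, Finset.mem_Ioc]
      rintro _ ⟨a, ha, rfl⟩ ⟨b, hb, h⟩
      simp only [Prod.mk.injEq] at h
      omega
  rw [Finset.sum_congr rfl hfiber, ← Finset.sum_filter, hcard] at hfib
  refine Eq.trans ?_ hfib.symm
  unfold wt
  symm
  refine Finset.sum_bij (fun i _ => rowLen P i - i) ?_ ?_ ?_ ?_
  · intro i hi
    simp only [Finset.mem_filter, Finset.mem_Icc, mem_frob] at hi ⊢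
    exact ⟨i, by omega, by omega⟩
  · intro i hi i' hi' h
    simp only [Finset.mem_filter] at hi hi' h
    exact rowLen_inj_of_le P (s := (rowLen P i : ℤ) - i) (by omega) (by omega)
  · intro s hs
    rw [mem_frob] at hs
    obtain ⟨i, hi, his⟩ := hs
    have := rowLen_le P i
    refine ⟨i, ?_, by omega⟩
    simp only [Finset.mem_filter, Finset.mem_Icc]
    omega
  · intros; rfl

lemma exists_frob_eq (S : Finset ℕ) :
    ∃ P : (wt S).Partition, IsSelfConjugate P ∧ frob P = S := by
  suffices h : ∃ n : ℕ, ∃ P : n.Partition, IsSelfConjugate P ∧ frob P = S by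
    obtain ⟨n, P, hP, rfl⟩ := h
    have := wt_frob hP
    generalize hm : wt (frob P) = m at this
    subst this
    exact ⟨P, hP, rfl⟩
  set c : ℕ → ℕ := fun m => (S.filter (fun s => m ≤ s)).card with hc
  have hcsucc : ∀ m, c m = c (m + 1) + if m ∈ S then 1 else 0 := by
    intro m
    have : S.filter (fun s => m ≤ s) =
        S.filter (fun s => m + 1 ≤ s) ∪ if m ∈ S then {m} else ∅ := by
      ext s
      split_ifs with hm
      · simp only [Finset.mem_filter, Finset.mem_union, Finset.mem_singleton]
        constructor
        · rintro ⟨h1, h2⟩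
          by_cases h : s = m
          · exact Or.inr h
          · exact Or.inl ⟨h1, by omega⟩
        · rintro (⟨h1, h2⟩ | rfl)
          · exact ⟨h1, by omega⟩
          · exact ⟨hm, le_rfl⟩
      · simp only [Finset.mem_filter, Finset.mem_union, Finset.notMem_empty, or_false]
        constructor
        · rintro ⟨h1, h2⟩
          have : s ≠ m := fun h => hm (h ▸ h1)
          exact ⟨h1, by omega⟩
        · rintro ⟨h1, h2⟩
          exact ⟨h1, by omega⟩
    simp only [hc]
    rw [this, Finset.card_union_of_disjoint]
    · split_ifs <;> simp
    · split_ifs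
      · rw [Finset.disjoint_singleton_right]; simp
      · simp
  have hcanti : Antitone c := antitone_nat_of_succ_le fun m => by rw [hcsucc m]; omega
  obtain ⟨B, hB⟩ : ∃ B, ∀ m, B < m → c m = 0 := by
    refine ⟨S.sup id, fun m hm => ?_⟩
    rw [hc, Finset.card_eq_zero, Finset.filter_eq_empty_iff]
    intro s hs hms
    have : s ≤ S.sup id := Finset.le_sup (f := id) hs
    omega
  set N := B + S.card with hN
  have hcS : ∀ m, c m ≤ S.card := fun m => Finset.card_filter_le _ _
  have hDbd : ∀ j k, 1 ≤ j → 1 ≤ k → min j k ≤ c (j - k + (k - j)) → k ≤ N := by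
    intro j k hj hk h
    have h1 := hcS (j - k + (k - j))
    have h2 := hB (j - k + (k - j))
    by_contra hc
    have := h2 (by omega)
    omega
  have hDcomm : ∀ j k, min j k ≤ c (j - k + (k - j)) ↔ min k j ≤ c (k - j + (j - k)) := by
    intro j k; rw [min_comm, add_comm]
  set r : ℕ → ℕ := fun j =>
    ((Finset.Icc 1 N).filter (fun k => min j k ≤ c (j - k + (k - j)))).card with hrdef
  have hDdown : ∀ j k, min j (k + 1) ≤ c (j - (k + 1) + (k + 1 - j)) →
      min j k ≤ c (j - k + (k - j)) := by
    intro j k h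
    rcases le_or_gt j k with hjk | hjk
    · refine le_trans (by omega) (h.trans (hcanti (by omega)))
    · have := hcsucc (j - (k + 1))
      have e1 : j - (k + 1) + (k + 1 - j) = j - (k + 1) := by omega
      have e2 : j - k + (k - j) = j - (k + 1) + 1 := by omega
      rw [e1] at h
      rw [e2]
      split_ifs at this <;> omega
  have hDdown' : ∀ j k m, k ≤ m → min j m ≤ c (j - m + (m - j)) →
      min j k ≤ c (j - k + (k - j)) := by
    intro j k m hkm
    induction hkm with
    | refl => exact id
    | step _ ih => exact fun h => ih (hDdown _ _ h)
  have hr : ∀ j k, 1 ≤ j → 1 ≤ k → (k ≤ r j ↔ min j k ≤ c (j - k + (k - j))) := by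
    intro j k hj hk
    constructor
    · intro h
      by_contra hcon
      have : (Finset.Icc 1 N).filter (fun k => min j k ≤ c (j - k + (k - j))) ⊆
          Finset.Icc 1 (k - 1) := by
        intro m hm
        simp only [Finset.mem_filter, Finset.mem_Icc] at hm ⊢
        refine ⟨hm.1.1, ?_⟩
        by_contra hmk
        exact hcon (hDdown' j k m (by omega) hm.2)
      have := Finset.card_le_card this
      simp only [Nat.card_Icc] at this
      simp only [hrdef] at h
      omega
    · intro h
      have hkN := hDbd j k hj hk h
      have : Finset.Icc 1 k ⊆ (Finset.Icc 1 N).filter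
          (fun k => min j k ≤ c (j - k + (k - j))) := by
        intro m hm
        simp only [Finset.mem_filter, Finset.mem_Icc] at hm ⊢
        exact ⟨⟨hm.1, by omega⟩, hDdown' j m k hm.2 h⟩
      have := Finset.card_le_card this
      rwa [Nat.card_Icc, Nat.add_sub_cancel] at this
  set P := Nat.Partition.ofMultiset (Multiset.map r (Finset.Icc 1 N).val) with hPdef
  have hcol : ∀ k, 1 ≤ k → colLen P k = r k := by
    intro k hk
    have : colLen P k = ((Finset.Icc 1 N).filter (fun j => k ≤ r j)).card := by
      unfold colLen
      simp only [hPdef, Nat.Partition.ofMultiset, Nat.Partition.ofSums]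
      rw [Multiset.filter_filter, Multiset.filter_map, Multiset.card_map, Finset.card_def,
        Finset.filter_val]
      congr 1
      refine Multiset.filter_congr fun j _ => ?_
      simp only [Function.comp]
      omega
    rw [this]
    simp only [hrdef]
    congr 1
    refine Finset.filter_congr fun j hj => ?_
    rw [Finset.mem_Icc] at hj
    rw [hDcomm k j]
    exact hr j k hj.1 hk
  have hrow : ∀ j, 1 ≤ j → rowLen P j = r j := by
    intro j hj
    refine eq_of_forall_le_iff fun k => ?_
    rcases Nat.eq_zero_or_pos k with rfl | hk
    · simp
    · rw [le_rowLen_iff P hj hk, hcol k hk, hr k j hk hj, hr j k hj hk, hDcomm]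
  refine ⟨_, P, fun k hk => by rw [hrow k hk, hcol k hk], ?_⟩
  ext s
  rw [mem_frob]
  have hjs : ∀ j, 1 ≤ j → (rowLen P j = j + s ↔ j ≤ c s ∧ c (s + 1) < j) := by
    intro j hj
    rw [hrow j hj]
    have h1 := hr j (j + s) hj (by omega)
    have h2 := hr j (j + s + 1) hj (by omega)
    rw [show j - (j + s) + (j + s - j) = s by omega] at h1
    rw [show j - (j + s + 1) + (j + s + 1 - j) = s + 1 by omega] at h2
    omega
  have := hcsucc s
  constructor
  · rintro ⟨j, hj, h⟩
    rw [hjs j hj] at h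
    by_contra hs
    rw [if_neg hs] at this
    omega
  · intro hs
    rw [if_pos hs] at this
    exact ⟨c s, by omega, (hjs _ (by omega)).2 (by omega)⟩

/-- Sums over self-conjugate partitions are sums over sets of given weight. -/
lemma sum_SC_eq {M : Type*} [AddCommMonoid M] (n : ℕ) (f : Finset ℕ → M) :
    ∑ P ∈ SC n, f (frob P) =
      ∑ S ∈ (Finset.range n).powerset.filter (fun S => wt S = n), f S := by
  refine Finset.sum_bij (fun P _ => frob P) ?_ ?_ ?_ ?_
  · intro P hP
    simp only [SC, Finset.mem_filter, Finset.mem_univ, true_and] at hP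
    simp only [Finset.mem_filter, Finset.mem_powerset]
    exact ⟨Finset.filter_subset _ _, wt_frob hP⟩
  · intro P hP Q hQ h
    exact frob_injOn n hP hQ h
  · intro S hS
    simp only [Finset.mem_filter, Finset.mem_powerset] at hS
    obtain ⟨-, rfl⟩ := hS
    obtain ⟨P, hP, h⟩ := exists_frob_eq S
    exact ⟨P, by simpa [SC] using hP, h⟩
  · intros; rfl

end Combinatorics

section Expectation

/-- The weight of the set `S` in the product Bernoulli measure on subsets of `s`. -/
def bernWt (p : ℕ → ℝ) (s S : Finset ℕ) : ℝ := ∏ k ∈ s, if k ∈ S then p k else 1 - p k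

/-- Expectation under the product Bernoulli measure on subsets of `s`. -/
def bernEx {E : Type*} [AddCommGroup E] [Module ℝ E] (p : ℕ → ℝ) (s : Finset ℕ)
    (f : Finset ℕ → E) : E := ∑ S ∈ s.powerset, bernWt p s S • f S

variable {E : Type*} [NormedAddCommGroup E] [NormedSpace ℝ E] {p : ℕ → ℝ} {s : Finset ℕ}

lemma bernWt_nonneg (hp : ∀ k, 0 ≤ p k ∧ p k ≤ 1) (s S : Finset ℕ) : 0 ≤ bernWt p s S := by
  refine Finset.prod_nonneg fun k _ => ?_
  have := hp k
  split_ifs <;> linarith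

lemma bernEx_congr {f g : Finset ℕ → E} (h : ∀ S, S ⊆ s → f S = g S) :
    bernEx p s f = bernEx p s g :=
  Finset.sum_congr rfl fun S hS => by rw [h S (Finset.mem_powerset.1 hS)]

lemma bernEx_insert {k : ℕ} (hk : k ∉ s) (f : Finset ℕ → E) :
    bernEx p (insert k s) f =
      bernEx p s (fun S => (1 - p k) • f S + p k • f (insert k S)) := by
  unfold bernEx
  rw [Finset.sum_powerset_insert hk, ← Finset.sum_add_distrib]
  refine Finset.sum_congr rfl fun S hS => ?_
  rw [Finset.mem_powerset] at hS
  have hkS : k ∉ S := fun h => hk (hS h)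
  have h1 : bernWt p (insert k s) S = (1 - p k) * bernWt p s S := by
    unfold bernWt
    rw [Finset.prod_insert hk, if_neg hkS]
  have h2 : bernWt p (insert k s) (insert k S) = p k * bernWt p s S := by
    unfold bernWt
    rw [Finset.prod_insert hk, if_pos (Finset.mem_insert_self _ _)]
    congr 1
    refine Finset.prod_congr rfl fun j hj => ?_
    have : j ≠ k := fun h => hk (h ▸ hj)
    simp [Finset.mem_insert, this]
  rw [h1, h2, smul_add, smul_smul, smul_smul, mul_comm, mul_comm (p k)]

lemma bernEx_add (f g : Finset ℕ → E) :
    bernEx p s (fun S => f S + g S) = bernEx p s f + bernEx p s g := by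
  simp [bernEx, Finset.sum_add_distrib]

lemma bernEx_sub (f g : Finset ℕ → E) :
    bernEx p s (fun S => f S - g S) = bernEx p s f - bernEx p s g := by
  simp [bernEx, Finset.sum_sub_distrib, smul_sub]

lemma bernEx_const_mul (c : ℝ) (f : Finset ℕ → ℝ) :
    bernEx p s (fun S => c * f S) = c * bernEx p s f := by
  simp only [bernEx, Finset.mul_sum, smul_eq_mul]
  exact Finset.sum_congr rfl fun _ _ => by ring

lemma bernEx_const_mul_complex (c : ℂ) (f : Finset ℕ → ℂ) :
    bernEx p s (fun S => c * f S) = c * bernEx p s f := by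
  simp only [bernEx, Finset.mul_sum, Complex.real_smul]
  exact Finset.sum_congr rfl fun _ _ => by ring

lemma bernEx_const (c : E) : bernEx p s (fun _ => c) = c := by
  induction s using Finset.induction_on with
  | empty => simp [bernEx, bernWt]
  | insert k s hk ih =>
    rw [bernEx_insert hk]
    simp only [← add_smul, sub_add_cancel, one_smul]
    exact ih

lemma bernEx_mono (hp : ∀ k, 0 ≤ p k ∧ p k ≤ 1) {f g : Finset ℕ → ℝ}
    (h : ∀ S, S ⊆ s → f S ≤ g S) : bernEx p s f ≤ bernEx p s g :=
  Finset.sum_le_sum fun S hS => mul_le_mul_of_nonneg_left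
    (h S (Finset.mem_powerset.1 hS)) (bernWt_nonneg hp _ _)

lemma norm_bernEx_le (hp : ∀ k, 0 ≤ p k ∧ p k ≤ 1) (f : Finset ℕ → E) :
    ‖bernEx p s f‖ ≤ bernEx p s (fun S => ‖f S‖) := by
  refine (norm_sum_le _ _).trans (Finset.sum_le_sum fun S _ => ?_)
  rw [norm_smul, Real.norm_of_nonneg (bernWt_nonneg hp _ _), smul_eq_mul]

lemma norm_bernEx_le_of_le (hp : ∀ k, 0 ≤ p k ∧ p k ≤ 1) {f : Finset ℕ → E} {C : ℝ}
    (h : ∀ S, S ⊆ s → ‖f S‖ ≤ C) : ‖bernEx p s f‖ ≤ C := by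
  refine (norm_bernEx_le hp f).trans ((bernEx_mono hp h).trans_eq (bernEx_const C))

lemma bernEx_abs_le_sqrt (hp : ∀ k, 0 ≤ p k ∧ p k ≤ 1) (f : Finset ℕ → ℝ) :
    bernEx p s (fun S => |f S|) ≤ √(bernEx p s (fun S => f S ^ 2)) := by
  set m := bernEx p s (fun S => |f S|) with hm
  apply Real.le_sqrt_of_sq_le
  have h0 : 0 ≤ bernEx p s (fun S => f S ^ 2 - (2 * m) * |f S| + m ^ 2) := by
    calc (0 : ℝ) = bernEx p s (fun _ => (0 : ℝ)) := (bernEx_const 0).symm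
      _ ≤ _ := bernEx_mono hp fun S _ => by
        have := sq_nonneg (|f S| - m)
        nlinarith [sq_abs (f S)]
  rw [bernEx_add, bernEx_sub, bernEx_const_mul, bernEx_const, ← hm] at h0
  nlinarith

/-- The centred indicator of `k ∈ S`. -/
def cind (p : ℕ → ℝ) (k : ℕ) (S : Finset ℕ) : ℝ := (if k ∈ S then 1 else 0) - p k

lemma cind_insert_of_ne {j k : ℕ} (h : j ≠ k) (S : Finset ℕ) :
    cind p j (insert k S) = cind p j S := by
  simp [cind, Finset.mem_insert, h]

lemma bernEx_sum_cind_sq (γ : ℕ → ℝ) (N : ℕ) :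
    bernEx p (Finset.range N) (fun S => (∑ j ∈ Finset.range N, γ j * cind p j S) ^ 2) =
      ∑ j ∈ Finset.range N, γ j ^ 2 * (p j * (1 - p j)) := by
  induction N with
  | zero => simp [bernEx]
  | succ N ih =>
    rw [Finset.sum_range_succ, ← ih, Finset.range_add_one,
      bernEx_insert Finset.notMem_range_self,
      ← bernEx_const (p := p) (s := Finset.range N) (γ N ^ 2 * (p N * (1 - p N))), ← bernEx_add]
    refine bernEx_congr fun S hS => ?_
    have hN : N ∉ S := fun h => Finset.notMem_range_self (hS h)
    rw [Finset.sum_insert Finset.notMem_range_self, Finset.sum_insert Finset.notMem_range_self]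
    have : ∑ j ∈ Finset.range N, γ j * cind p j (insert N S) =
        ∑ j ∈ Finset.range N, γ j * cind p j S :=
      Finset.sum_congr rfl fun j hj => by rw [cind_insert_of_ne (Finset.mem_range.1 hj).ne]
    rw [this]
    simp only [cind, if_neg hN, Finset.mem_insert_self, if_true, smul_eq_mul]
    ring

end Expectation

section CharacteristicFunctionBound

lemma norm_cexp_I_mul_sub_le (y : ℝ) :
    ‖cexp (y * I) - (1 + y * I - y ^ 2 / 2)‖ ≤ 4 * |y| ^ 3 := by
  rcases le_or_gt |y| 1 with h | h
  · have hn : ‖(y : ℂ) * I‖ = |y| := by simp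
    have := Complex.exp_bound (x := y * I) (by rw [hn]; exact h) (n := 3) (by norm_num)
    rw [hn] at this
    have e : ∑ m ∈ Finset.range 3, ((y : ℂ) * I) ^ m / (m.factorial : ℂ) =
        1 + y * I - y ^ 2 / 2 := by
      simp [Finset.sum_range_succ, mul_pow]
      ring
    rw [e] at this
    refine this.trans ?_
    have h3 : 0 ≤ |y| ^ 3 := by positivity
    norm_num [Nat.factorial]
    linarith
  · have h1 : ‖cexp (y * I)‖ = 1 := Complex.norm_exp_ofReal_mul_I y
    have h2 : ‖(1 + y * I - y ^ 2 / 2 : ℂ)‖ ≤ 1 + |y| + y ^ 2 / 2 := by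
      refine (norm_sub_le _ _).trans (add_le_add ((norm_add_le _ _).trans ?_) ?_)
      · simp
      · simp
    refine (norm_sub_le _ _).trans ?_
    rw [h1]
    have e : y ^ 2 = |y| ^ 2 := (sq_abs y).symm
    rw [e] at h2
    generalize |y| = a at *
    have : a ≤ a ^ 2 := by nlinarith
    have : a ^ 2 ≤ a ^ 3 := by nlinarith
    nlinarith

lemma abs_exp_neg_sub_le {s : ℝ} (hs : 0 ≤ s) : |Real.exp (-s) - (1 - s)| ≤ min s (s ^ 2) := by
  have h1 : 1 - s ≤ Real.exp (-s) := by linarith [Real.add_one_le_exp (-s)]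
  have h2 : Real.exp (-s) ≤ 1 := by simpa using hs
  rw [abs_of_nonneg (by linarith)]
  refine le_min (by linarith) ?_
  rcases le_or_gt s 1 with h | h
  · have := Real.abs_exp_sub_one_sub_id_le (x := -s) (by rw [abs_neg, abs_of_nonneg hs]; exact h)
    rw [abs_le] at this
    nlinarith
  · nlinarith

/-- The characteristic function of a centred Bernoulli variable is close to a Gaussian one. -/
lemma norm_bernoulli_charFun_sub_le {p : ℝ} (h0 : 0 ≤ p) (h1 : p ≤ 1) (x : ℝ) :
    ‖(1 - p) • cexp ((-p * x : ℝ) * I) + p • cexp (((1 - p) * x : ℝ) * I)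
      - (Real.exp (-(p * (1 - p) * x ^ 2 / 2)) : ℂ)‖ ≤ 5 * (p * (1 - p) * |x| ^ 3) := by
  set R : ℝ → ℂ := fun y => cexp (y * I) - (1 + y * I - y ^ 2 / 2) with hR
  have e : (1 - p) • cexp ((-p * x : ℝ) * I) + p • cexp (((1 - p) * x : ℝ) * I)
      - (Real.exp (-(p * (1 - p) * x ^ 2 / 2)) : ℂ) =
      ((1 - p) • R (-p * x) + p • R ((1 - p) * x)) -
        ((Real.exp (-(p * (1 - p) * x ^ 2 / 2)) - (1 - p * (1 - p) * x ^ 2 / 2) : ℝ) : ℂ) := by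
    simp only [hR, Complex.real_smul]
    push_cast
    ring
  rw [e]
  have hq : 0 ≤ p * (1 - p) := mul_nonneg h0 (by linarith)
  have hq1 : p * (1 - p) ≤ 1 := by nlinarith
  have hx : 0 ≤ |x| := abs_nonneg x
  have b1 : ‖(1 - p) • R (-p * x)‖ ≤ (1 - p) * (4 * (p ^ 3 * |x| ^ 3)) := by
    rw [norm_smul, Real.norm_of_nonneg (by linarith)]
    refine mul_le_mul_of_nonneg_left ?_ (by linarith)
    refine (norm_cexp_I_mul_sub_le _).trans_eq ?_
    rw [abs_mul, abs_neg, abs_of_nonneg h0]; ring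
  have b2 : ‖p • R ((1 - p) * x)‖ ≤ p * (4 * ((1 - p) ^ 3 * |x| ^ 3)) := by
    rw [norm_smul, Real.norm_of_nonneg h0]
    refine mul_le_mul_of_nonneg_left ?_ h0
    refine (norm_cexp_I_mul_sub_le _).trans_eq ?_
    rw [abs_mul, abs_of_nonneg (by linarith : 0 ≤ 1 - p)]; ring
  have b3 : ‖((Real.exp (-(p * (1 - p) * x ^ 2 / 2)) - (1 - p * (1 - p) * x ^ 2 / 2) : ℝ) : ℂ)‖ ≤
      p * (1 - p) * |x| ^ 3 := by
    rw [Complex.norm_real, Real.norm_eq_abs]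
    refine (abs_exp_neg_sub_le (by positivity)).trans ?_
    rw [← sq_abs x]
    generalize |x| = a at *
    generalize p * (1 - p) = q at *
    rcases le_or_gt a 1 with ha | ha
    · refine (min_le_right _ _).trans ?_
      have : a ^ 4 ≤ a ^ 3 := pow_le_pow_of_le_one hx ha (by norm_num)
      have h3 : 0 ≤ a ^ 3 := by positivity
      have : q ^ 2 ≤ q := by nlinarith
      calc (q * a ^ 2 / 2) ^ 2 = q ^ 2 * a ^ 4 / 4 := by ring
        _ ≤ q * a ^ 3 / 4 := by gcongr
        _ ≤ q * a ^ 3 := by nlinarith [mul_nonneg hq h3]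
    · refine (min_le_left _ _).trans ?_
      have : a ^ 2 ≤ a ^ 3 := by nlinarith
      nlinarith
  refine (norm_sub_le _ _).trans ((add_le_add_left (norm_add_le _ _) _).trans ?_)
  have hx3 : 0 ≤ |x| ^ 3 := by positivity
  have : p ^ 2 + (1 - p) ^ 2 ≤ 1 := by nlinarith
  have : p * (1 - p) * |x| ^ 3 * (p ^ 2 + (1 - p) ^ 2) ≤ p * (1 - p) * |x| ^ 3 * 1 := by gcongr
  nlinarith

variable {p : ℕ → ℝ} (t : ℕ) (c d : ℕ → ℝ)

/-- The predictable coefficient `c_k - d_k 1[k - t ∈ S]`. -/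
def predCoef (k : ℕ) (S : Finset ℕ) : ℝ := c k - d k * (if t ≤ k ∧ k - t ∈ S then 1 else 0)

/-- The martingale transform of the centred indicators. -/
def mart (p : ℕ → ℝ) (N : ℕ) (S : Finset ℕ) : ℝ :=
  ∑ k ∈ Finset.range N, cind p k S * predCoef t c d k S

/-- The sum of the conditional variances of the increments of `mart`. -/
def condVar (p : ℕ → ℝ) (N : ℕ) (S : Finset ℕ) : ℝ :=
  ∑ k ∈ Finset.range N, p k * (1 - p k) * predCoef t c d k S ^ 2

/-- The expectation of `condVar`. -/
def meanVar (p : ℕ → ℝ) (N : ℕ) : ℝ :=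
  ∑ k ∈ Finset.range N, p k * (1 - p k) *
    (c k ^ 2 + (d k ^ 2 - 2 * c k * d k) * (if t ≤ k then p (k - t) else 0))

variable {t c d}

lemma predCoef_insert (ht : 1 ≤ t) {k N : ℕ} (h : k ≤ N) (S : Finset ℕ) :
    predCoef t c d k (insert N S) = predCoef t c d k S := by
  have : k - t ∈ insert N S ∧ t ≤ k ↔ k - t ∈ S ∧ t ≤ k := by
    rw [Finset.mem_insert]
    constructor
    · rintro ⟨h1 | h1, h2⟩
      · omega
      · exact ⟨h1, h2⟩
    · rintro ⟨h1, h2⟩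
      exact ⟨Or.inr h1, h2⟩
  simp only [predCoef, and_comm (a := t ≤ k), this]

lemma abs_predCoef_le {K : ℕ → ℝ} (hK : ∀ k, |c k| ≤ K k ∧ |c k - d k| ≤ K k) (k : ℕ)
    (S : Finset ℕ) : |predCoef t c d k S| ≤ K k := by
  unfold predCoef
  split_ifs
  · simpa using (hK k).2
  · simpa using (hK k).1

lemma predCoef_sq_le {K : ℕ → ℝ} (hK : ∀ k, |c k| ≤ K k ∧ |c k - d k| ≤ K k) (k : ℕ)
    (S : Finset ℕ) : predCoef t c d k S ^ 2 ≤ K k ^ 2 := by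
  rw [← sq_abs]
  exact pow_le_pow_left₀ (abs_nonneg _) (abs_predCoef_le hK k S) 2

lemma condVar_le (hp : ∀ k, 0 ≤ p k ∧ p k ≤ 1) {K : ℕ → ℝ}
    (hK : ∀ k, |c k| ≤ K k ∧ |c k - d k| ≤ K k) (N : ℕ) (S : Finset ℕ) :
    condVar t c d p N S ≤ ∑ k ∈ Finset.range N, p k * (1 - p k) * K k ^ 2 := by
  refine Finset.sum_le_sum fun k _ => ?_
  have := hp k
  exact mul_le_mul_of_nonneg_left (predCoef_sq_le hK k S)
    (mul_nonneg this.1 (by linarith))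

lemma bernEx_exp_mart (ht : 1 ≤ t) (hp : ∀ k, 0 ≤ p k ∧ p k ≤ 1) {K : ℕ → ℝ}
    (hK : ∀ k, |c k| ≤ K k ∧ |c k - d k| ≤ K k) {B : ℝ} (N : ℕ)
    (hB : ∑ k ∈ Finset.range N, p k * (1 - p k) * K k ^ 2 ≤ B) :
    ‖bernEx p (Finset.range N) (fun S => cexp (mart t c d p N S * I) *
      (Real.exp (condVar t c d p N S / 2) : ℂ)) - 1‖ ≤
      Real.exp (B / 2) * ∑ k ∈ Finset.range N, 5 * (p k * (1 - p k) * K k ^ 3) := by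
  induction N with
  | zero => simp [bernEx, bernWt, mart, condVar]
  | succ N ih =>
    have hpN := hp N
    have hq : 0 ≤ p N * (1 - p N) := mul_nonneg hpN.1 (by linarith)
    have hB' : ∑ k ∈ Finset.range N, p k * (1 - p k) * K k ^ 2 ≤ B := by
      rw [Finset.sum_range_succ] at hB
      nlinarith [mul_nonneg hq (sq_nonneg (K N))]
    specialize ih hB'
    rw [Finset.sum_range_succ, mul_add]
    refine (norm_sub_le_norm_sub_add_norm_sub _ (bernEx p (Finset.range N) (fun S =>
      cexp (mart t c d p N S * I) * (Real.exp (condVar t c d p N S / 2) : ℂ))) _).trans ?_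
    rw [add_comm]
    refine add_le_add ih ?_
    rw [Finset.range_add_one, bernEx_insert Finset.notMem_range_self, ← bernEx_sub]
    refine norm_bernEx_le_of_le hp fun S hS => ?_
    have hN : N ∉ S := fun h => Finset.notMem_range_self (hS h)
    set x := predCoef t c d N S with hx
    set v := p N * (1 - p N) * x ^ 2 with hv
    have hpred : ∀ k ∈ Finset.range N, predCoef t c d k (insert N S) = predCoef t c d k S :=
      fun k hk => predCoef_insert ht (Finset.mem_range.1 hk).le S
    have hm1 : mart t c d p (N + 1) S = mart t c d p N S + (-p N * x) := by
      unfold mart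
      rw [Finset.sum_range_succ, ← hx]
      simp [cind, hN]
    have hm2 : mart t c d p (N + 1) (insert N S) = mart t c d p N S + ((1 - p N) * x) := by
      unfold mart
      rw [Finset.sum_range_succ, predCoef_insert ht le_rfl, ← hx]
      congr 1
      · refine Finset.sum_congr rfl fun k hk => ?_
        rw [hpred k hk, cind_insert_of_ne (Finset.mem_range.1 hk).ne]
      · simp [cind]
    have hv1 : condVar t c d p (N + 1) S = condVar t c d p N S + v := by
      unfold condVar
      rw [Finset.sum_range_succ, ← hx]
    have hv2 : condVar t c d p (N + 1) (insert N S) = condVar t c d p N S + v := by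
      unfold condVar
      rw [Finset.sum_range_succ, predCoef_insert ht le_rfl, ← hx]
      congr 1
      exact Finset.sum_congr rfl fun k hk => by rw [hpred k hk]
    have hvB : condVar t c d p N S + v ≤ B := by
      rw [← hv1]
      exact (condVar_le hp hK (N + 1) S).trans hB
    rw [hm1, hm2, hv1, hv2]
    have e1 : (Real.exp ((condVar t c d p N S + v) / 2) : ℂ) * (Real.exp (-(v / 2)) : ℂ) =
        (Real.exp (condVar t c d p N S / 2) : ℂ) := by
      rw [← Complex.ofReal_mul, ← Real.exp_add]
      congr 2
      ring
    have e2 : ∀ y : ℝ, cexp ((mart t c d p N S + y : ℝ) * I) =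
        cexp (mart t c d p N S * I) * cexp (y * I) := by
      intro y
      rw [← Complex.exp_add]
      push_cast
      ring_nf
    rw [e2, e2, ← e1]
    have e3 : (1 - p N) • (cexp (mart t c d p N S * I) * cexp ((-p N * x : ℝ) * I) *
          (Real.exp ((condVar t c d p N S + v) / 2) : ℂ)) +
        p N • (cexp (mart t c d p N S * I) * cexp (((1 - p N) * x : ℝ) * I) *
          (Real.exp ((condVar t c d p N S + v) / 2) : ℂ)) -
        cexp (mart t c d p N S * I) * ((Real.exp ((condVar t c d p N S + v) / 2) : ℂ) *
          (Real.exp (-(v / 2)) : ℂ)) =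
        cexp (mart t c d p N S * I) * (Real.exp ((condVar t c d p N S + v) / 2) : ℂ) *
        ((1 - p N) • cexp ((-p N * x : ℝ) * I) + p N • cexp (((1 - p N) * x : ℝ) * I)
          - (Real.exp (-(v / 2)) : ℂ)) := by
      simp only [Complex.real_smul]
      ring
    rw [e3, norm_mul, norm_mul, Complex.norm_exp_ofReal_mul_I, one_mul, Complex.norm_real,
      Real.norm_of_nonneg (Real.exp_pos _).le]
    refine mul_le_mul (Real.exp_le_exp.2 (by linarith))
      ((norm_bernoulli_charFun_sub_le hpN.1 hpN.2 x).trans ?_) (norm_nonneg _) (Real.exp_pos _).le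
    have : |x| ^ 3 ≤ K N ^ 3 := pow_le_pow_left₀ (abs_nonneg _) (abs_predCoef_le hK N S) 3
    gcongr

lemma bernEx_abs_condVar_sub_le (hp : ∀ k, 0 ≤ p k ∧ p k ≤ 1) {K : ℕ → ℝ}
    (hK : ∀ k, |c k| ≤ K k ∧ |c k - d k| ≤ K k) (N : ℕ) :
    bernEx p (Finset.range N) (fun S => |condVar t c d p N S - meanVar t c d p N|) ≤
      √(∑ k ∈ Finset.range N, (p k * (1 - p k) * K k ^ 2) ^ 2) := by
  refine (bernEx_abs_le_sqrt hp _).trans (Real.sqrt_le_sqrt ?_)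
  set β : ℕ → ℝ := fun k => p k * (1 - p k) * (d k ^ 2 - 2 * c k * d k) with hβ
  set γ : ℕ → ℝ := fun j => if j + t < N then β (j + t) else 0 with hγ
  have hβK : ∀ k, β k ^ 2 ≤ (p k * (1 - p k) * K k ^ 2) ^ 2 := by
    intro k
    have hq : 0 ≤ p k * (1 - p k) := mul_nonneg (hp k).1 (by linarith [(hp k).2])
    have h1 : c k ^ 2 ≤ K k ^ 2 := by
      rw [← sq_abs]; exact pow_le_pow_left₀ (abs_nonneg _) (hK k).1 2
    have h2 : (c k - d k) ^ 2 ≤ K k ^ 2 := by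
      rw [← sq_abs]; exact pow_le_pow_left₀ (abs_nonneg _) (hK k).2 2
    simp only [hβ]
    rw [mul_pow (p k * (1 - p k)), mul_pow (p k * (1 - p k))]
    refine mul_le_mul_of_nonneg_left ?_ (sq_nonneg _)
    rw [← sq_abs]
    refine pow_le_pow_left₀ (abs_nonneg _) ?_ 2
    rw [abs_le]
    constructor <;> nlinarith [sq_nonneg (c k), sq_nonneg (c k - d k)]
  have hsum : ∀ g : ℕ → ℝ, ∑ j ∈ Finset.range N, (if j + t < N then g (j + t) else 0) =
      ∑ k ∈ Finset.range N, if t ≤ k then g k else 0 := by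
    intro g
    rw [← Finset.sum_filter, ← Finset.sum_filter]
    refine Finset.sum_nbij' (fun j => j + t) (fun k => k - t) ?_ ?_ ?_ ?_ ?_
    · intro j hj; simp only [Finset.mem_filter, Finset.mem_range] at hj ⊢; omega
    · intro j hj; simp only [Finset.mem_filter, Finset.mem_range] at hj ⊢; omega
    · intro j hj; omega
    · intro j hj; simp only [Finset.mem_filter, Finset.mem_range] at hj; omega
    · intro j _; rfl
  have hV : ∀ S, condVar t c d p N S - meanVar t c d p N =
      ∑ j ∈ Finset.range N, γ j * cind p j S := by
    intro S
    have := hsum (fun k => β k * cind p (k - t) S)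
    have e : ∑ j ∈ Finset.range N, γ j * cind p j S =
        ∑ j ∈ Finset.range N, (if j + t < N then β (j + t) * cind p (j + t - t) S else 0) := by
      refine Finset.sum_congr rfl fun j _ => ?_
      simp only [hγ, ite_mul, zero_mul, Nat.add_sub_cancel]
    rw [e, this, condVar, meanVar, ← Finset.sum_sub_distrib]
    refine Finset.sum_congr rfl fun k _ => ?_
    simp only [predCoef, cind, hβ]
    by_cases h1 : t ≤ k <;> by_cases h2 : k - t ∈ S <;> simp only [h1, h2, and_self, if_true,
      if_false, and_false, false_and] <;> ring
  simp only [hV]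
  rw [bernEx_sum_cind_sq]
  calc ∑ j ∈ Finset.range N, γ j ^ 2 * (p j * (1 - p j))
      ≤ ∑ j ∈ Finset.range N, (if j + t < N then β (j + t) ^ 2 else 0) := by
        refine Finset.sum_le_sum fun j _ => ?_
        have hq : 0 ≤ p j * (1 - p j) := mul_nonneg (hp j).1 (by linarith [(hp j).2])
        have hq1 : p j * (1 - p j) ≤ 1 := by nlinarith [(hp j).1, (hp j).2]
        simp only [hγ]
        split_ifs
        · exact mul_le_of_le_one_right (sq_nonneg _) hq1
        · simp
    _ = ∑ k ∈ Finset.range N, if t ≤ k then β k ^ 2 else 0 := hsum (fun k => β k ^ 2)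
    _ ≤ _ := by
        refine Finset.sum_le_sum fun k _ => ?_
        split_ifs
        · exact hβK k
        · positivity

lemma norm_bernEx_exp_mart_sub_le (ht : 1 ≤ t) (hp : ∀ k, 0 ≤ p k ∧ p k ≤ 1) {K : ℕ → ℝ}
    (hK : ∀ k, |c k| ≤ K k ∧ |c k - d k| ≤ K k) {B W : ℝ} (hW : 0 ≤ W) (N : ℕ)
    (hB : ∑ k ∈ Finset.range N, p k * (1 - p k) * K k ^ 2 ≤ B) :
    ‖bernEx p (Finset.range N) (fun S => cexp (mart t c d p N S * I)) -
      (Real.exp (-W / 2) : ℂ)‖ ≤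
      Real.exp (B / 2) * (∑ k ∈ Finset.range N, 5 * (p k * (1 - p k) * K k ^ 3) +
        (√(∑ k ∈ Finset.range N, (p k * (1 - p k) * K k ^ 2) ^ 2) +
          |meanVar t c d p N - W|)) := by
  have hB0 : 0 ≤ B := le_trans (Finset.sum_nonneg fun k _ => mul_nonneg
    (mul_nonneg (hp k).1 (by linarith [(hp k).2])) (sq_nonneg _)) hB
  set G : Finset ℕ → ℂ := fun S => cexp (mart t c d p N S * I) *
      (Real.exp (condVar t c d p N S / 2) : ℂ) with hG
  have h1 := bernEx_exp_mart ht hp hK N hB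
  have h2 : ‖bernEx p (Finset.range N) (fun S => cexp (mart t c d p N S * I)
      - (Real.exp (-W / 2) : ℂ) * G S)‖ ≤ Real.exp (B / 2) *
        (√(∑ k ∈ Finset.range N, (p k * (1 - p k) * K k ^ 2) ^ 2) +
          |meanVar t c d p N - W|) := by
    refine (norm_bernEx_le hp _).trans ?_
    have hpt : ∀ S, S ⊆ Finset.range N → ‖cexp (mart t c d p N S * I)
      - (Real.exp (-W / 2) : ℂ) * G S‖ ≤ Real.exp (B / 2) *
        (|condVar t c d p N S - meanVar t c d p N| + |meanVar t c d p N - W|) := by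
      intro S _
      have hVB := (condVar_le (t := t) hp hK N S).trans hB
      set V := condVar t c d p N S
      have e : cexp (mart t c d p N S * I) - (Real.exp (-W / 2) : ℂ) * G S =
          cexp (mart t c d p N S * I) * ((1 - Real.exp ((V - W) / 2) : ℝ) : ℂ) := by
        simp only [hG]
        rw [show (V - W) / 2 = -W / 2 + V / 2 by ring, Real.exp_add]
        push_cast
        ring
      rw [e, norm_mul, Complex.norm_exp_ofReal_mul_I, one_mul, Complex.norm_real,
        Real.norm_eq_abs]
      have h3 : |V - W| ≤ |V - meanVar t c d p N| + |meanVar t c d p N - W| := abs_sub_le _ _ _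
      refine le_trans ?_ (mul_le_mul_of_nonneg_left h3 (Real.exp_pos _).le)
      set z := (V - W) / 2 with hz
      have hz2 : |V - W| = 2 * |z| := by
        rw [hz, abs_div]; norm_num; ring
      rw [hz2]
      have hzB : Real.exp z ≤ Real.exp (B / 2) := Real.exp_le_exp.2 (by rw [hz]; linarith)
      have hB1 : 1 ≤ Real.exp (B / 2) := Real.one_le_exp (by linarith)
      have ha : |1 - Real.exp z| ≤ Real.exp (B / 2) * |z| := by
        rcases le_or_gt 0 z with h0 | h0
        · have h4 := Real.add_one_le_exp (-z)
          rw [Real.exp_neg] at h4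
          have h5 : (1 - z) * Real.exp z ≤ 1 := by
            have := mul_le_mul_of_nonneg_right h4 (Real.exp_pos z).le
            rw [inv_mul_cancel₀ (Real.exp_pos z).ne'] at this
            linarith
          rw [abs_of_nonneg h0, abs_sub_comm, abs_of_nonneg (by linarith [Real.one_le_exp h0])]
          nlinarith
        · have := Real.add_one_le_exp z
          rw [abs_of_neg h0, abs_of_nonneg (by linarith [Real.exp_le_one_iff.2 h0.le])]
          nlinarith
      have : 0 ≤ Real.exp (B / 2) * |z| := by positivity
      nlinarith
    refine (bernEx_mono hp hpt).trans ?_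
    rw [bernEx_const_mul, bernEx_add, bernEx_const]
    exact mul_le_mul_of_nonneg_left (add_le_add_left (bernEx_abs_condVar_sub_le hp hK N) _)
      (Real.exp_pos _).le
  rw [bernEx_sub, bernEx_const_mul_complex] at h2
  have e : bernEx p (Finset.range N) (fun S => cexp (mart t c d p N S * I)) -
      (Real.exp (-W / 2) : ℂ) =
      (Real.exp (-W / 2) : ℂ) * (bernEx p (Finset.range N) G - 1) +
      (bernEx p (Finset.range N) (fun S => cexp (mart t c d p N S * I)) -
        (Real.exp (-W / 2) : ℂ) * bernEx p (Finset.range N) G) := by ring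
  rw [e, mul_add]
  refine (norm_add_le _ _).trans (add_le_add ?_ h2)
  rw [norm_mul, Complex.norm_real, Real.norm_of_nonneg (Real.exp_pos _).le]
  refine le_trans (mul_le_of_le_one_left (norm_nonneg _) ?_) h1
  rw [Real.exp_le_one_iff]
  linarith

end CharacteristicFunctionBound

section Domination

lemma wt_insert {k : ℕ} {S : Finset ℕ} (hk : k ∉ S) : wt (insert k S) = wt S + (2 * k + 1) := by
  rw [wt, Finset.sum_insert hk, add_comm]
  rfl

/-- The increment of `asc t` when `k` is inserted. -/
noncomputable def ascInc (t k : ℕ) (S : Finset ℕ) : ℝ :=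
  (if t ≤ k ∧ k - t ∈ S then 0 else 1) - (if k + t ∈ S then 1 else 0)

lemma asc_insert {t k : ℕ} (ht : 1 ≤ t) {S : Finset ℕ} (hk : k ∉ S) :
    (asc t (insert k S) : ℝ) = asc t S + ascInc t k S := by
  have hk' : t ≤ k ∧ k - t ∈ insert k S ↔ t ≤ k ∧ k - t ∈ S := by
    rw [Finset.mem_insert]
    constructor
    · rintro ⟨h1, h2 | h2⟩
      · omega
      · exact ⟨h1, h2⟩
    · rintro ⟨h1, h2⟩
      exact ⟨h1, Or.inr h2⟩
  have h : ∀ s ∈ S, (if ¬(t ≤ s ∧ s - t ∈ insert k S) then (1 : ℝ) else 0) =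
      (if ¬(t ≤ s ∧ s - t ∈ S) then (1 : ℝ) else 0) - (if s = k + t then 1 else 0) := by
    intro s _
    by_cases h1 : s = k + t
    · subst h1
      simp [hk]
    · have : ¬(t ≤ s ∧ s - t = k) := by omega
      by_cases h2 : t ≤ s
      · have h3 : s - t ≠ k := by omega
        simp [h1, h2, h3]
      · simp [h1, h2]
  simp only [asc, Finset.card_filter, Nat.cast_sum, Nat.cast_ite, Nat.cast_one, Nat.cast_zero]
  rw [Finset.sum_insert hk, Finset.sum_congr rfl h, Finset.sum_sub_distrib,
    Finset.sum_ite_eq' S (k + t), ascInc]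
  simp only [hk', ite_not]
  ring

lemma ascInc_insert {t k j : ℕ} (h1 : k ≠ j + t) (h2 : j ≠ k + t) (S : Finset ℕ) :
    ascInc t k (insert j S) = ascInc t k S := by
  have e1 : t ≤ k ∧ k - t ∈ insert j S ↔ t ≤ k ∧ k - t ∈ S := by
    rw [Finset.mem_insert]
    constructor
    · rintro ⟨h3, h4 | h4⟩
      · omega
      · exact ⟨h3, h4⟩
    · rintro ⟨h3, h4⟩
      exact ⟨h3, Or.inr h4⟩
  have e2 : k + t ∈ insert j S ↔ k + t ∈ S := by simp [Finset.mem_insert, h2.symm]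
  simp only [ascInc, e1, e2]

lemma ascInc_sq_le (t k : ℕ) (S : Finset ℕ) : ascInc t k S ^ 2 ≤ 1 := by
  unfold ascInc
  split_ifs <;> norm_num

/-- The character `exp(i(α asc + θ wt))`. -/
noncomputable def chi (t : ℕ) (α θ : ℝ) (S : Finset ℕ) : ℂ := cexp ((α * asc t S + θ * wt S : ℝ) * I)

lemma norm_bernEx_chi_mul_le {t : ℕ} (ht : 1 ≤ t) {p : ℕ → ℝ} (hp : ∀ k, 0 ≤ p k ∧ p k ≤ 1)
    (α θ : ℝ) {r : ℕ → ℝ}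
    (hr : ∀ k S, ‖(1 - p k : ℂ) + p k * cexp ((α * ascInc t k S + θ * (2 * k + 1) : ℝ) * I)‖ ≤ r k)
    (A B : Finset ℕ) (hA : ∀ k ∈ A, k + t ∉ A) (hAB : Disjoint A B) (G : Finset ℕ → ℂ) (g : ℝ)
    (hG : ∀ S, ‖G S‖ ≤ g) (hG' : ∀ k ∈ A, ∀ S, G (insert k S) = G S) :
    ‖bernEx p (A ∪ B) (fun S => chi t α θ S * G S)‖ ≤ g * ∏ k ∈ A, r k := by
  induction A using Finset.induction_on generalizing G g with
  | empty =>
    simp only [Finset.empty_union, Finset.prod_empty, mul_one]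
    refine norm_bernEx_le_of_le hp fun S _ => ?_
    rw [norm_mul, chi, Complex.norm_exp_ofReal_mul_I, one_mul]
    exact hG S
  | insert k A hk ih =>
    rw [Finset.disjoint_insert_left] at hAB
    have hkAB : k ∉ A ∪ B := by simp [hk, hAB.1]
    rw [Finset.insert_union, bernEx_insert hkAB, Finset.prod_insert hk, ← mul_assoc]
    have key := ih (fun j hj h => hA j (Finset.mem_insert_of_mem hj) (Finset.mem_insert_of_mem h))
      hAB.2 (fun S => G S *
        ((1 - p k : ℂ) + p k * cexp ((α * ascInc t k S + θ * (2 * k + 1) : ℝ) * I))) (g * r k)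
      (fun S => by
        rw [norm_mul]
        exact mul_le_mul (hG S) (hr k S) (norm_nonneg _) ((norm_nonneg _).trans (hG S)))
      (fun j hj S => by
        have h1 : k ≠ j + t := fun h =>
          hA j (Finset.mem_insert_of_mem hj) (h ▸ Finset.mem_insert_self _ _)
        have h2 : j ≠ k + t := fun h =>
          hA k (Finset.mem_insert_self _ _) (h ▸ Finset.mem_insert_of_mem hj)
        rw [hG' j (Finset.mem_insert_of_mem hj), ascInc_insert h1 h2])
    convert key using 2
    refine bernEx_congr fun S hS => ?_
    have hkS : k ∉ S := fun h => hkAB (hS h)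
    have e : chi t α θ (insert k S) =
        chi t α θ S * cexp ((α * ascInc t k S + θ * (2 * k + 1) : ℝ) * I) := by
      rw [chi, chi, ← Complex.exp_add, asc_insert ht hkS, wt_insert hkS]
      push_cast
      ring_nf
    rw [hG' k (Finset.mem_insert_self _ _), e, Complex.real_smul, Complex.real_smul]
    push_cast
    ring

lemma half_one_sub_cos_le (x y : ℝ) :
    (1 - Real.cos x) / 2 - (1 - Real.cos y) ≤ 1 - Real.cos (x + y) := by
  have h1 : ∀ z, 1 - Real.cos z = 2 * Real.sin (z / 2) ^ 2 := by
    intro z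
    have := Real.cos_two_mul (z / 2)
    rw [show 2 * (z / 2) = z by ring] at this
    nlinarith [Real.sin_sq_add_cos_sq (z / 2)]
  rw [h1, h1, h1]
  have h2 : Real.sin (x / 2) = Real.sin ((x + y) / 2) * Real.cos (y / 2) -
      Real.cos ((x + y) / 2) * Real.sin (y / 2) := by
    rw [← Real.sin_sub]; ring_nf
  have h3 := Real.sin_sq_add_cos_sq (y / 2)
  have h4 := Real.sin_sq_add_cos_sq ((x + y) / 2)
  rw [h2]
  generalize Real.sin ((x + y) / 2) = a at *
  generalize Real.cos ((x + y) / 2) = b at *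
  generalize Real.sin (y / 2) = c at *
  generalize Real.cos (y / 2) = d at *
  have h5 : a ^ 2 * d ^ 2 ≤ a ^ 2 := by nlinarith [mul_nonneg (sq_nonneg a) (sq_nonneg c)]
  have h6 : b ^ 2 * c ^ 2 ≤ c ^ 2 := by nlinarith [mul_nonneg (sq_nonneg a) (sq_nonneg c)]
  nlinarith [sq_nonneg (a * d + b * c)]

lemma norm_bernoulli_le {p : ℝ} (φ : ℝ) :
    ‖(1 - p : ℂ) + p * cexp (φ * I)‖ ≤ Real.exp (-(p * (1 - p) * (1 - Real.cos φ))) := by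
  have h1 : ‖(1 - p : ℂ) + p * cexp (φ * I)‖ ^ 2 = 1 - 2 * (p * (1 - p) * (1 - Real.cos φ)) := by
    have e : (1 - p : ℂ) + p * cexp (φ * I) =
        ((1 - p + p * Real.cos φ : ℝ) : ℂ) + ((p * Real.sin φ : ℝ) : ℂ) * I := by
      rw [Complex.exp_mul_I]; push_cast; ring
    rw [e, ← Complex.normSq_eq_norm_sq, Complex.normSq_add_mul_I]
    linear_combination p ^ 2 * Real.sin_sq_add_cos_sq φ
  refine abs_le_of_sq_le_sq' ?_ (Real.exp_pos _).le |>.2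
  rw [h1, ← Real.exp_nat_mul]
  have := Real.add_one_le_exp ((2 : ℕ) * -(p * (1 - p) * (1 - Real.cos φ)))
  push_cast at this ⊢
  linarith

/-- The exponent governing the decay in the frequency `θ`. -/
noncomputable def cosDefect (L : ℕ) (θ : ℝ) : ℝ := ∑ k ∈ Finset.range L, (1 - Real.cos ((2 * k + 1) * θ))

lemma norm_bernEx_chi_le {t : ℕ} (ht : 1 ≤ t) {p : ℕ → ℝ} (hp : ∀ k, 0 ≤ p k ∧ p k ≤ 1)
    (α θ : ℝ) {L N : ℕ} (hL : L ≤ N) {c : ℝ} (hc0 : 0 ≤ c) (hc : ∀ k < L, c ≤ p k * (1 - p k)) :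
    ‖bernEx p (Finset.range N) (chi t α θ)‖ ≤
      Real.exp (α ^ 2 * L / 8 - c / 4 * cosDefect L θ) := by
  set r : ℕ → ℝ := fun k => Real.exp (p k * (1 - p k) *
    (α ^ 2 / 2 - (1 - Real.cos ((2 * k + 1) * θ)) / 2)) with hr
  have hrb : ∀ k S, ‖(1 - p k : ℂ) + p k *
      cexp ((α * ascInc t k S + θ * (2 * k + 1) : ℝ) * I)‖ ≤ r k := by
    intro k S
    refine (norm_bernoulli_le _).trans (Real.exp_le_exp.2 ?_)
    have h1 := half_one_sub_cos_le (θ * (2 * k + 1)) (α * ascInc t k S)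
    rw [add_comm (θ * _), mul_comm θ] at h1
    have h2 := Real.one_sub_sq_div_two_le_cos (x := α * ascInc t k S)
    have h3 := mul_le_mul_of_nonneg_left (ascInc_sq_le t k S) (sq_nonneg α)
    have h4 : 0 ≤ p k * (1 - p k) := mul_nonneg (hp k).1 (by linarith [(hp k).2])
    rw [← mul_neg]
    refine mul_le_mul_of_nonneg_left ?_ h4
    rw [mul_comm θ]
    nlinarith
  have key : ∀ i : ℕ, ‖bernEx p (Finset.range N) (chi t α θ)‖ ≤ Real.exp (α ^ 2 * L / 8 -
      c / 2 * ∑ k ∈ (Finset.range L).filter (fun k => k / t % 2 = i),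
        (1 - Real.cos ((2 * k + 1) * θ))) := by
    intro i
    set A := (Finset.range L).filter (fun k => k / t % 2 = i) with hA
    have hAN : A ⊆ Finset.range N :=
      (Finset.filter_subset _ _).trans (Finset.range_subset_range.2 hL)
    have h := norm_bernEx_chi_mul_le ht hp α θ hrb A (Finset.range N \ A)
      (fun k hk h => by
        simp only [hA, Finset.mem_filter, Nat.add_div_right k (by omega : 0 < t)] at hk h
        omega) Finset.disjoint_sdiff (fun _ => 1) 1 (fun _ => by simp) (fun _ _ _ => rfl)
    simp only [mul_one, one_mul, Finset.union_sdiff_of_subset hAN] at h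
    refine h.trans ?_
    rw [hr, ← Real.exp_sum]
    refine Real.exp_le_exp.2 ?_
    have h5 : ∀ k ∈ A, p k * (1 - p k) * (α ^ 2 / 2 - (1 - Real.cos ((2 * k + 1) * θ)) / 2) ≤
        α ^ 2 / 8 - c / 2 * (1 - Real.cos ((2 * k + 1) * θ)) := by
      intro k hk
      simp only [hA, Finset.mem_filter, Finset.mem_range] at hk
      have h6 := hc k hk.1
      have h7 : p k * (1 - p k) ≤ 1 / 4 := by nlinarith [sq_nonneg (p k - 1 / 2)]
      have h8 := Real.cos_le_one ((2 * k + 1) * θ)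
      have h9 := mul_le_mul_of_nonneg_right h7 (sq_nonneg α)
      have h10 := mul_le_mul_of_nonneg_right h6 (sub_nonneg.2 h8)
      nlinarith
    refine (Finset.sum_le_sum h5).trans ?_
    rw [Finset.sum_sub_distrib, ← Finset.mul_sum, Finset.sum_const, nsmul_eq_mul]
    have h11 : (A.card : ℝ) ≤ L := by
      exact_mod_cast (Finset.card_filter_le _ _).trans_eq (Finset.card_range L)
    nlinarith [mul_le_mul_of_nonneg_left h11 (sq_nonneg α)]
  have hsplit : cosDefect L θ = ∑ k ∈ (Finset.range L).filter (fun k => k / t % 2 = 0),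
        (1 - Real.cos ((2 * k + 1) * θ)) + ∑ k ∈ (Finset.range L).filter (fun k => k / t % 2 = 1),
        (1 - Real.cos ((2 * k + 1) * θ)) := by
    rw [cosDefect, ← Finset.sum_filter_add_sum_filter_not _ (fun k => k / t % 2 = 0)]
    congr 2
    ext k
    simp
  have k0 := key 0
  have k1 := key 1
  generalize (∑ k ∈ (Finset.range L).filter (fun k => k / t % 2 = 0),
        (1 - Real.cos ((2 * k + 1) * θ))) = s0 at *
  generalize (∑ k ∈ (Finset.range L).filter (fun k => k / t % 2 = 1),
        (1 - Real.cos ((2 * k + 1) * θ))) = s1 at *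
  rw [hsplit]
  rcases le_total s0 s1 with h | h
  · exact k1.trans (Real.exp_le_exp.2 (by nlinarith))
  · exact k0.trans (Real.exp_le_exp.2 (by nlinarith))

lemma two_mul_sin_mul_sum_cos (L : ℕ) (θ : ℝ) :
    2 * Real.sin θ * ∑ k ∈ Finset.range L, Real.cos ((2 * k + 1) * θ) = Real.sin (2 * L * θ) := by
  induction L with
  | zero => simp
  | succ L ih =>
    rw [Finset.sum_range_succ, mul_add, ih]
    have h1 := Real.sin_add ((2 * L + 1) * θ) θ
    have h2 := Real.sin_sub ((2 * L + 1) * θ) θ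
    rw [show (2 * L + 1) * θ + θ = 2 * ((L + 1 : ℕ) : ℝ) * θ by push_cast; ring] at h1
    rw [show (2 * L + 1) * θ - θ = 2 * L * θ by ring] at h2
    rw [h1, h2]
    ring

lemma cosDefect_neg (L : ℕ) (θ : ℝ) : cosDefect L (-θ) = cosDefect L θ := by
  simp [cosDefect]

lemma le_cosDefect {L : ℕ} (hL : 1 ≤ L) {θ : ℝ} (hθ : |θ| ≤ π) :
    (L : ℝ) / 2 ≤ cosDefect L θ ∨ 2 / π ^ 2 * (θ ^ 2 * L ^ 3) ≤ cosDefect L θ := by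
  wlog h0 : 0 ≤ θ generalizing θ
  · have := this (θ := -θ) (by rwa [abs_neg]) (by linarith)
    rwa [cosDefect_neg, neg_sq] at this
  rw [abs_of_nonneg h0] at hθ
  have hL0 : (1 : ℝ) ≤ L := by exact_mod_cast hL
  have hs0 : 0 ≤ Real.sin θ := Real.sin_nonneg_of_nonneg_of_le_pi h0 hθ
  have hsum : ∀ φ, cosDefect L φ = L - ∑ k ∈ Finset.range L, Real.cos ((2 * k + 1) * φ) := by
    intro φ
    simp [cosDefect, Finset.sum_sub_distrib]
  have hpos : ∀ φ, 0 ≤ φ → φ ≤ π / 2 → L * Real.sin φ < 1 → 2 * L * φ ≤ π := by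
    intro φ h1 h2 h3
    have h4 := Real.mul_le_sin h1 h2
    have h5 : L * (2 / π * φ) ≤ 1 := (mul_le_mul_of_nonneg_left h4 (by linarith)).trans h3.le
    have : L * (2 / π * φ) = 2 * L * φ / π := by ring
    rw [this, div_le_one Real.pi_pos] at h5
    exact h5
  rcases le_or_gt 1 (L * Real.sin θ) with h1 | h1
  · left
    have h2 := two_mul_sin_mul_sum_cos L θ
    have h3 := Real.sin_le_one (2 * L * θ)
    rw [hsum]
    set C := ∑ k ∈ Finset.range L, Real.cos ((2 * k + 1) * θ)
    by_contra! hC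
    have hC' : (L : ℝ) / 2 < C := by linarith
    have hs : 0 < Real.sin θ := by nlinarith
    nlinarith [mul_lt_mul_of_pos_left hC' hs]
  · rcases le_or_gt θ (π / 2) with h2 | h2
    · right
      have h3 := hpos θ h0 h2 h1
      have h4 : ∀ k ∈ Finset.range L, 2 / π ^ 2 * θ ^ 2 * (2 * k + 1) ^ 2 ≤
          1 - Real.cos ((2 * k + 1) * θ) := by
        intro k hk
        have hk' : (k : ℝ) + 1 ≤ L := by exact_mod_cast Finset.mem_range.1 hk
        have := Real.cos_le_one_sub_mul_cos_sq (x := (2 * k + 1) * θ) (by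
          rw [abs_of_nonneg (by positivity)]
          nlinarith)
        nlinarith
      refine le_trans ?_ (Finset.sum_le_sum h4)
      rw [← Finset.mul_sum, mul_assoc (2 / π ^ 2) (θ ^ 2)]
      refine mul_le_mul_of_nonneg_left (mul_le_mul_of_nonneg_left ?_ (sq_nonneg θ)) (by positivity)
      clear * -
      induction L with
      | zero => simp
      | succ L ih =>
        rw [Finset.sum_range_succ]
        push_cast
        nlinarith [(Nat.cast_nonneg L : (0 : ℝ) ≤ L)]
    · left
      have h3 : 0 ≤ π - θ := by linarith
      have h4 := hpos (π - θ) h3 (by linarith) (by rwa [Real.sin_pi_sub])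
      have h5 := two_mul_sin_mul_sum_cos L (π - θ)
      have h6 : 0 ≤ Real.sin (2 * L * (π - θ)) :=
        Real.sin_nonneg_of_nonneg_of_le_pi (by positivity) h4
      have h7 : ∑ k ∈ Finset.range L, Real.cos ((2 * k + 1) * θ) =
          - ∑ k ∈ Finset.range L, Real.cos ((2 * k + 1) * (π - θ)) := by
        rw [← Finset.sum_neg_distrib]
        refine Finset.sum_congr rfl fun k _ => ?_
        rw [show (2 * k + 1) * (π - θ) = π - (2 * k + 1) * θ + k * (2 * π) by ring,
          Real.cos_add_nat_mul_two_pi, Real.cos_pi_sub, neg_neg]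
      rw [hsum, h7]
      rw [Real.sin_pi_sub] at h5
      rcases hs0.eq_or_lt with h8 | h8
      · have : θ = π := by
          rcases h3.eq_or_lt with h9 | h9
          · linarith
          · exact absurd h8 (Real.sin_pos_of_pos_of_lt_pi (by linarith [Real.pi_pos])
              (by linarith)).ne
        simp [this]
        linarith
      · have : 0 ≤ ∑ k ∈ Finset.range L, Real.cos ((2 * k + 1) * (π - θ)) := by
          by_contra! hneg
          nlinarith [mul_neg_of_pos_of_neg h8 hneg]
        linarith

end Domination

section RiemannSum

/-- The Fermi function `1 / (1 + e^y)`. -/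
noncomputable def fermi (y : ℝ) : ℝ := 1 / (1 + Real.exp y)

lemma fermi_pos (y : ℝ) : 0 < fermi y := by unfold fermi; positivity

lemma fermi_lt_one (y : ℝ) : fermi y < 1 := by
  unfold fermi
  rw [div_lt_one (by positivity)]
  linarith [Real.exp_pos y]

lemma fermi_le_exp (y : ℝ) : fermi y ≤ Real.exp (-y) := by
  rw [fermi, Real.exp_neg, ← one_div]
  exact one_div_le_one_div_of_le (Real.exp_pos y) (by linarith)

lemma hasDerivAt_fermi (y : ℝ) : HasDerivAt fermi (-(fermi y * (1 - fermi y))) y := by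
  have h : HasDerivAt (fun y => 1 + Real.exp y) (Real.exp y) y :=
    (Real.hasDerivAt_exp y).const_add 1
  have h0 : (1 + Real.exp y) ≠ 0 := by positivity
  have := h.inv h0
  have e : fermi = (fun y => 1 + Real.exp y)⁻¹ := by
    funext z; simp [fermi]
  rw [e]
  refine this.congr_deriv ?_
  simp only [Pi.inv_apply]
  field_simp
  ring

lemma continuous_fermi : Continuous fermi :=
  continuous_iff_continuousAt.2 fun y => (hasDerivAt_fermi y).continuousAt

lemma fermi_zero : fermi 0 = 1 / 2 := by norm_num [fermi]

lemma abs_fermi_sub_le (x y : ℝ) : |fermi x - fermi y| ≤ |x - y| := by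
  have := Convex.norm_image_sub_le_of_norm_hasDerivWithin_le (f := fermi)
    (f' := fun y => -(fermi y * (1 - fermi y))) (C := 1) (s := Set.univ) (x := y) (y := x)
    (fun z _ => (hasDerivAt_fermi z).hasDerivWithinAt) (fun z _ => by
      have h1 := fermi_pos z
      have h2 := fermi_lt_one z
      rw [Real.norm_eq_abs, abs_neg, abs_of_nonneg (mul_nonneg h1.le (by linarith))]
      nlinarith) convex_univ trivial trivial
  simpa using this

lemma one_add_pow_mul_fermi_le {y : ℝ} (hy : 0 ≤ y) {j : ℕ} (hj : j ≤ 3) :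
    (1 + y) ^ j * fermi y ≤ 96 * Real.exp (-y / 2) := by
  have h1 : (1 + y) ^ j ≤ (1 + y) ^ 3 := pow_le_pow_right₀ (by linarith) hj
  have h2 : (1 + y) ^ 3 ≤ 96 * Real.exp (y / 2) := by
    have h3 := Real.pow_div_factorial_le_exp ((1 + y) / 2) (by linarith) 3
    rw [show (1 + y) / 2 = 1 / 2 + y / 2 by ring, Real.exp_add] at h3
    have h4 : Real.exp (1 / 2) ≤ 2 := by
      have h5 : Real.exp (1 / 2) ^ 2 ≤ 4 := by
        rw [← Real.exp_nat_mul]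
        norm_num
        linarith [Real.exp_one_lt_d9]
      nlinarith [Real.exp_pos (1 / 2)]
    have h6 := mul_le_mul_of_nonneg_right h4 (Real.exp_pos (y / 2)).le
    norm_num [Nat.factorial] at h3
    nlinarith
  calc (1 + y) ^ j * fermi y ≤ (96 * Real.exp (y / 2)) * Real.exp (-y) :=
        mul_le_mul (h1.trans h2) (fermi_le_exp y) (fermi_pos y).le (by positivity)
    _ = 96 * Real.exp (-y / 2) := by
        rw [mul_assoc, ← Real.exp_add]; ring_nf

lemma sum_exp_neg_le {β : ℝ} (hβ : 0 < β) (n : ℕ) :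
    ∑ k ∈ Finset.range n, Real.exp (-(β * (2 * k + 1)) / 2) ≤ 1 / β := by
  have h1 : β * Real.exp (-β / 2) ≤ 1 - Real.exp (-β) := by
    have h2 := Real.self_le_sinh_iff.2 (by linarith : 0 ≤ β / 2)
    rw [Real.sinh_eq] at h2
    have h3 := mul_le_mul_of_nonneg_right h2 (Real.exp_pos (-β / 2)).le
    have h4 : Real.exp (β / 2) * Real.exp (-β / 2) = 1 := by rw [← Real.exp_add]; simp [neg_div]
    have h5 : Real.exp (-(β / 2)) * Real.exp (-β / 2) = Real.exp (-β) := by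
      rw [← Real.exp_add]; ring_nf
    nlinarith
  have h2 : ∀ n : ℕ, β * ∑ k ∈ Finset.range n, Real.exp (-(β * (2 * k + 1)) / 2) ≤
      1 - Real.exp (-β * n) := by
    intro n
    induction n with
    | zero => simp
    | succ n ih =>
      rw [Finset.sum_range_succ, mul_add]
      have e1 : Real.exp (-(β * (2 * n + 1)) / 2) = Real.exp (-β * n) * Real.exp (-β / 2) := by
        rw [← Real.exp_add]; ring_nf
      have e2 : Real.exp (-β * (n + 1 : ℕ)) = Real.exp (-β * n) * Real.exp (-β) := by
        rw [← Real.exp_add]; push_cast; ring_nf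
      rw [e1, e2]
      nlinarith [mul_le_mul_of_nonneg_left h1 (Real.exp_pos (-β * n)).le]
  rw [le_div_iff₀ hβ, mul_comm]
  linarith [h2 n, Real.exp_pos (-β * n)]

lemma abs_sub_le_of_deriv_le_exp {H h : ℝ → ℝ} {C Hi : ℝ} (hC : 0 ≤ C)
    (hH : ∀ y, HasDerivAt H (h y) y) (hb : ∀ y, 0 ≤ y → |h y| ≤ C * Real.exp (-y / 2))
    (hHi : Tendsto H atTop (nhds Hi)) {Y : ℝ} (hY : 0 ≤ Y) :
    |Hi - H Y| ≤ 2 * C * Real.exp (-Y / 2) := by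
  have h1 : ∀ s : ℝ, |s| ≤ 1 → ∀ Z, Y ≤ Z →
      s * H Z + 2 * C * Real.exp (-Z / 2) ≤ s * H Y + 2 * C * Real.exp (-Y / 2) := by
    intro s hs Z hZ
    have hd : ∀ y, HasDerivAt (fun y => s * H y + 2 * C * Real.exp (-y / 2))
        (s * h y - C * Real.exp (-y / 2)) y := by
      intro y
      have e1 : HasDerivAt (fun y : ℝ => -y / 2) (-1 / 2) y :=
        ((hasDerivAt_id y).neg).div_const 2
      have := ((hH y).const_mul s).add ((e1.exp).const_mul (2 * C))
      exact this.congr_deriv (by ring)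
    have ha : AntitoneOn (fun y => s * H y + 2 * C * Real.exp (-y / 2)) (Set.Ici Y) :=
      antitoneOn_of_deriv_nonpos (convex_Ici Y)
        (fun y _ => (hd y).continuousAt.continuousWithinAt)
        (fun y _ => (hd y).differentiableAt.differentiableWithinAt) (fun y hy => by
          rw [interior_Ici, Set.mem_Ioi] at hy
          rw [(hd y).deriv]
          have h2 := hb y (by linarith)
          have h3 : s * h y ≤ |h y| := by
            refine (le_abs_self _).trans ?_
            rw [abs_mul]
            exact mul_le_of_le_one_left (abs_nonneg _) hs
          linarith)
    exact ha (Set.mem_Ici.2 le_rfl) (Set.mem_Ici.2 hZ) hZ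
  have h2 : ∀ s : ℝ, |s| ≤ 1 → s * Hi ≤ s * H Y + 2 * C * Real.exp (-Y / 2) := by
    intro s hs
    refine le_of_tendsto (hHi.const_mul s) ?_
    filter_upwards [eventually_ge_atTop Y] with Z hZ
    have := h1 s hs Z hZ
    have : 0 ≤ 2 * C * Real.exp (-Z / 2) := by positivity
    linarith
  rw [abs_le]
  have h3 := h2 1 (by simp)
  have h4 := h2 (-1) (by simp)
  constructor <;> linarith

lemma abs_riemann_sum_sub_le {H h h' : ℝ → ℝ} {C Hi : ℝ} (hC : 0 ≤ C)
    (hH : ∀ y, HasDerivAt H (h y) y) (hh : ∀ y, HasDerivAt h (h' y) y)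
    (hb : ∀ y, 0 ≤ y → |h y| ≤ C * Real.exp (-y / 2))
    (hb' : ∀ y, 0 ≤ y → |h' y| ≤ C * Real.exp (-y / 2))
    (hHi : Tendsto H atTop (nhds Hi)) {β : ℝ} (hβ : 0 < β) (hβ1 : β ≤ 1) (n : ℕ) :
    |2 * β * ∑ k ∈ Finset.range n, h (β * (2 * k + 1)) - (Hi - H 0)| ≤
      8 * C * β + 2 * C * Real.exp (-(β * n)) := by
  have step : ∀ k : ℕ, |2 * β * h (β * (2 * k + 1)) - (H (2 * β * (k + 1 : ℕ)) - H (2 * β * k))| ≤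
      8 * C * β ^ 2 * Real.exp (-(β * (2 * k + 1)) / 2) := by
    intro k
    set a := 2 * β * (k : ℝ) with ha
    set b := 2 * β * ((k + 1 : ℕ) : ℝ) with hb0
    have hab : b = a + 2 * β := by rw [ha, hb0]; push_cast; ring
    have hlt : a < b := by linarith
    have ha0 : 0 ≤ a := by positivity
    obtain ⟨ξ, hξ, hξe⟩ := exists_hasDerivAt_eq_slope H h hlt
      (fun y _ => (hH y).continuousAt.continuousWithinAt) (fun y _ => hH y)
    have hm : β * (2 * k + 1) = a + β := by rw [ha]; ring
    have e : H b - H a = 2 * β * h ξ := by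
      rw [hξe, show b - a = 2 * β by linarith]; field_simp
    have hB : ∀ z ∈ Set.Icc a b, ‖h' z‖ ≤ C * (2 * Real.exp (-(a + β) / 2)) := by
      intro z hz
      refine (hb' z (ha0.trans hz.1)).trans (mul_le_mul_of_nonneg_left ?_ hC)
      have h4 : Real.exp (β / 2) ≤ 2 := by
        have h6 : Real.exp (β / 2) ≤ Real.exp (1 / 2) := Real.exp_le_exp.2 (by linarith)
        have h5 : Real.exp (1 / 2) ^ 2 ≤ 4 := by
          rw [← Real.exp_nat_mul]
          norm_num
          linarith [Real.exp_one_lt_d9]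
        nlinarith [Real.exp_pos (1 / 2)]
      calc Real.exp (-z / 2) ≤ Real.exp (β / 2 + -(a + β) / 2) :=
            Real.exp_le_exp.2 (by linarith [hz.1])
        _ = Real.exp (β / 2) * Real.exp (-(a + β) / 2) := Real.exp_add _ _
        _ ≤ _ := mul_le_mul_of_nonneg_right h4 (Real.exp_pos _).le
    have hmv := Convex.norm_image_sub_le_of_norm_hasDerivWithin_le
      (fun z _ => (hh z).hasDerivWithinAt) hB (convex_Icc a b)
      (Set.Ioo_subset_Icc_self hξ) (⟨by linarith, by linarith⟩ : a + β ∈ Set.Icc a b)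
    rw [e, hm, ← mul_sub, abs_mul, abs_of_pos (by linarith : 0 < 2 * β)]
    have h7 : ‖a + β - ξ‖ ≤ 2 * β := by
      rw [Real.norm_eq_abs, abs_le]
      constructor <;> linarith [hξ.1, hξ.2]
    have h8 : 0 ≤ C * (2 * Real.exp (-(a + β) / 2)) := by positivity
    rw [Real.norm_eq_abs] at hmv
    have h9 := hmv.trans (mul_le_mul_of_nonneg_left h7 h8)
    nlinarith [mul_le_mul_of_nonneg_left h9 (by linarith : 0 ≤ 2 * β)]
  have htel : H (2 * β * n) - H 0 =
      ∑ k ∈ Finset.range n, (H (2 * β * (k + 1 : ℕ)) - H (2 * β * k)) := by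
    rw [Finset.sum_range_sub (fun k : ℕ => H (2 * β * k))]
    simp
  have h1 : |2 * β * ∑ k ∈ Finset.range n, h (β * (2 * k + 1)) - (H (2 * β * n) - H 0)| ≤
      8 * C * β := by
    rw [htel, Finset.mul_sum, ← Finset.sum_sub_distrib]
    refine (Finset.abs_sum_le_sum_abs _ _).trans ((Finset.sum_le_sum fun k _ => step k).trans ?_)
    rw [← Finset.mul_sum]
    refine (mul_le_mul_of_nonneg_left (sum_exp_neg_le hβ n) (by positivity)).trans_eq ?_
    field_simp
  have h2 := abs_sub_le_of_deriv_le_exp hC hH hb hHi (Y := 2 * β * n) (by positivity)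
  rw [show -(2 * β * n) / 2 = -(β * n) by ring] at h2
  rw [abs_le] at h1 h2 ⊢
  constructor <;> linarith [h1.1, h1.2, h2.1, h2.2]

end RiemannSum

section FermiIntegral

open MeasureTheory

lemma hasSum_alternating_zeta_two :
    HasSum (fun m : ℕ => (-1 : ℝ) ^ m * (1 / ((m : ℝ) + 1) ^ 2)) (π ^ 2 / 12) := by
  have h0 := hasSum_zeta_two
  have he : HasSum (fun k : ℕ => 1 / ((2 * k : ℕ) : ℝ) ^ 2) (π ^ 2 / 24) := by
    have := h0.mul_left (1 / 4)
    rw [show π ^ 2 / 24 = 1 / 4 * (π ^ 2 / 6) by ring]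
    refine this.congr_fun fun k => ?_
    push_cast
    rw [mul_pow, one_div, mul_inv]
    norm_num
  have ho : HasSum (fun k : ℕ => 1 / ((2 * k + 1 : ℕ) : ℝ) ^ 2) (π ^ 2 / 8) := by
    have hs : Summable (fun k : ℕ => 1 / ((2 * k + 1 : ℕ) : ℝ) ^ 2) :=
      h0.summable.comp_injective (i := fun k => 2 * k + 1) (fun a b h => by
        simp only at h; omega)
    have := (he.even_add_odd (f := fun n : ℕ => 1 / (n : ℝ) ^ 2) hs.hasSum).unique h0
    have e : ∑' k : ℕ, 1 / ((2 * k + 1 : ℕ) : ℝ) ^ 2 = π ^ 2 / 8 := by linarith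
    exact e ▸ hs.hasSum
  have ha : HasSum (fun n : ℕ => (-1 : ℝ) ^ (n + 1) * (1 / (n : ℝ) ^ 2)) (π ^ 2 / 12) := by
    have h1 : HasSum (fun k : ℕ => (-1 : ℝ) ^ (2 * k + 1) * (1 / ((2 * k : ℕ) : ℝ) ^ 2))
        (-(π ^ 2 / 24)) := by
      simpa [pow_succ, pow_mul] using he.neg
    have h2 : HasSum (fun k : ℕ => (-1 : ℝ) ^ (2 * k + 1 + 1) * (1 / ((2 * k + 1 : ℕ) : ℝ) ^ 2))
        (π ^ 2 / 8) := by
      simpa [pow_succ, pow_mul] using ho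
    have := h1.even_add_odd (f := fun n : ℕ => (-1 : ℝ) ^ (n + 1) * (1 / (n : ℝ) ^ 2)) h2
    rwa [show -(π ^ 2 / 24) + π ^ 2 / 8 = π ^ 2 / 12 by ring] at this
  have := (hasSum_nat_add_iff' 1).2 ha
  simpa [pow_succ] using this

lemma integrableOn_mul_exp_neg {r : ℝ} (hr : 0 < r) :
    IntegrableOn (fun u : ℝ => u * Real.exp (-(r * u))) (Set.Ioi 0) := by
  have := integrableOn_rpow_mul_exp_neg_mul_rpow (p := 1) (s := 1) (b := r) (by norm_num)
    (by norm_num) hr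
  simpa using this

lemma integral_mul_exp_neg {r : ℝ} (hr : 0 < r) :
    ∫ u in Set.Ioi (0 : ℝ), u * Real.exp (-(r * u)) = 1 / r ^ 2 := by
  have := Real.integral_rpow_mul_exp_neg_mul_Ioi (a := 2) (by norm_num) hr
  norm_num at this
  simpa using this

lemma hasSum_mul_fermi {u : ℝ} (hu : 0 < u) :
    HasSum (fun m : ℕ => (-1 : ℝ) ^ m * (u * Real.exp (-(((m : ℝ) + 1) * u)))) (u * fermi u) := by
  have h1 : |-Real.exp (-u)| < 1 := by
    rw [abs_neg, abs_of_pos (Real.exp_pos _), Real.exp_lt_one_iff]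
    linarith
  have := (hasSum_geometric_of_abs_lt_one h1).mul_left (u * Real.exp (-u))
  have e : u * fermi u = u * Real.exp (-u) * (1 - -Real.exp (-u))⁻¹ := by
    have := Real.exp_pos u
    simp only [fermi, sub_neg_eq_add, Real.exp_neg]
    field_simp
    ring
  rw [e]
  refine this.congr_fun fun m => ?_
  rw [show -(((m : ℝ) + 1) * u) = m * (-u) + -u by ring, Real.exp_add, Real.exp_nat_mul,
    neg_pow (Real.exp (-u))]
  ring

lemma continuous_mul_fermi : Continuous fun u => u * fermi u :=
  continuous_id.mul continuous_fermi

lemma integrableOn_mul_fermi : IntegrableOn (fun u => u * fermi u) (Set.Ioi 0) := by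
  refine (integrableOn_mul_exp_neg one_pos).mono'
    continuous_mul_fermi.aestronglyMeasurable.restrict ?_
  filter_upwards [ae_restrict_mem measurableSet_Ioi] with u hu
  have hu : 0 < u := hu
  rw [Real.norm_of_nonneg (mul_nonneg hu.le (fermi_pos u).le), one_mul]
  exact mul_le_mul_of_nonneg_left (fermi_le_exp u) hu.le

lemma integral_mul_fermi : ∫ u in Set.Ioi (0 : ℝ), u * fermi u = π ^ 2 / 12 := by
  have hr : ∀ m : ℕ, 0 < (m : ℝ) + 1 := fun m => by positivity
  set F : ℕ → ℝ → ℝ := fun m u => (-1 : ℝ) ^ m * (u * Real.exp (-(((m : ℝ) + 1) * u))) with hF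
  have hint : ∀ m, Integrable (F m) (volume.restrict (Set.Ioi 0)) := fun m =>
    (integrableOn_mul_exp_neg (hr m)).const_mul _
  have hnorm : ∀ m, ∫ u in Set.Ioi (0 : ℝ), ‖F m u‖ = 1 / ((m : ℝ) + 1) ^ 2 := by
    intro m
    rw [← integral_mul_exp_neg (hr m)]
    refine setIntegral_congr_fun measurableSet_Ioi fun u hu => ?_
    have hu : 0 < u := hu
    simp only [hF]
    rw [norm_mul, norm_pow, norm_neg, norm_one, one_pow, one_mul,
      Real.norm_of_nonneg (by positivity)]
  have hsum : Summable fun m => ∫ u in Set.Ioi (0 : ℝ), ‖F m u‖ := by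
    simp only [hnorm]
    have := hasSum_alternating_zeta_two.summable.norm
    simpa using this
  have key := hasSum_integral_of_summable_integral_norm hint hsum
  have e1 : ∫ u in Set.Ioi (0 : ℝ), ∑' m, F m u = ∫ u in Set.Ioi (0 : ℝ), u * fermi u :=
    setIntegral_congr_fun measurableSet_Ioi fun u hu => (hasSum_mul_fermi hu).tsum_eq
  rw [e1] at key
  refine key.unique (hasSum_alternating_zeta_two.congr_fun fun m => ?_)
  rw [← integral_mul_exp_neg (hr m)]
  exact integral_const_mul _ _

lemma tendsto_integral_mul_fermi :
    Tendsto (fun y => ∫ u in (0 : ℝ)..y, u * fermi u) atTop (nhds (π ^ 2 / 12)) := by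
  rw [← integral_mul_fermi]
  exact intervalIntegral_tendsto_integral_Ioi 0 integrableOn_mul_fermi tendsto_id

lemma hasDerivAt_integral_mul_fermi (y : ℝ) :
    HasDerivAt (fun y => ∫ u in (0 : ℝ)..y, u * fermi u) (y * fermi y) y :=
  intervalIntegral.integral_hasDerivAt_right (continuous_mul_fermi.intervalIntegrable _ _)
    (continuous_mul_fermi.stronglyMeasurableAtFilter _ _) continuous_mul_fermi.continuousAt

end FermiIntegral

section FermiSums

lemma tendsto_pow_mul_fermi {j : ℕ} (hj : j ≤ 3) :
    Tendsto (fun y => y ^ j * fermi y) atTop (nhds 0) := by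
  have h1 : Tendsto (fun y : ℝ => 96 * Real.exp (-y / 2)) atTop (nhds 0) := by
    have : Tendsto (fun y : ℝ => Real.exp (-(y / 2))) atTop (nhds 0) :=
      Real.tendsto_exp_neg_atTop_nhds_zero.comp (tendsto_id.atTop_div_const (by norm_num))
    simpa [neg_div] using this.const_mul 96
  refine squeeze_zero' ?_ ?_ h1
  · filter_upwards [eventually_ge_atTop 0] with y hy
    exact mul_nonneg (pow_nonneg hy j) (fermi_pos y).le
  · filter_upwards [eventually_ge_atTop 0] with y hy
    refine le_trans ?_ (one_add_pow_mul_fermi_le hy hj)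
    exact mul_le_mul_of_nonneg_right (pow_le_pow_left₀ hy (by linarith) j) (fermi_pos y).le

/-- Discrepancy allowed between a Riemann sum and the corresponding integral. -/
noncomputable def riemannErr (β : ℝ) (n : ℕ) : ℝ :=
  8 * (40 * 96) * β + 2 * (40 * 96) * Real.exp (-(β * n))

lemma abs_le_of_abs_le_pow_mul_fermi {f : ℝ → ℝ} {j : ℕ} (hj : j ≤ 3) {y : ℝ} (hy : 0 ≤ y)
    (h : |f y| ≤ 40 * ((1 + y) ^ j * fermi y)) : |f y| ≤ 40 * 96 * Real.exp (-y / 2) := by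
  have := one_add_pow_mul_fermi_le hy hj
  linarith

lemma abs_sum_mul_fermi_sub_le {β : ℝ} (hβ : 0 < β) (hβ1 : β ≤ 1)
    (n : ℕ) :
    |2 * β * ∑ k ∈ Finset.range n, (β * (2 * k + 1)) * fermi (β * (2 * k + 1)) - π ^ 2 / 12| ≤
      riemannErr β n := by
  have hd : ∀ y, HasDerivAt (fun y => y * fermi y)
      (1 * fermi y + y * (-(fermi y * (1 - fermi y)))) y := fun y =>
    (hasDerivAt_id y).mul (hasDerivAt_fermi y)
  have := abs_riemann_sum_sub_le (C := 40 * 96) (by norm_num) hasDerivAt_integral_mul_fermi hd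
    (fun y hy => abs_le_of_abs_le_pow_mul_fermi (f := fun y => y * fermi y) (j := 1)
      (by norm_num) hy (by
      have h1 := fermi_pos y
      rw [abs_of_nonneg (mul_nonneg hy h1.le)]
      nlinarith [mul_nonneg hy h1.le]))
    (fun y hy => abs_le_of_abs_le_pow_mul_fermi (j := 1)
      (f := fun y => 1 * fermi y + y * (-(fermi y * (1 - fermi y)))) (by norm_num) hy (by
      have h1 := fermi_pos y
      have h2 := fermi_lt_one y
      have h3 := mul_nonneg hy h1.le
      have h4 := mul_nonneg h3 (sub_nonneg.2 h2.le)
      have h5 := mul_nonneg h3 h1.le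
      rw [abs_le]
      constructor <;> nlinarith))
    tendsto_integral_mul_fermi hβ hβ1 n
  simpa [riemannErr] using this

lemma abs_sum_fermi_one_sub_le {β : ℝ} (hβ : 0 < β) (hβ1 : β ≤ 1)
    (n : ℕ) :
    |2 * β * ∑ k ∈ Finset.range n, fermi (β * (2 * k + 1)) * (1 - fermi (β * (2 * k + 1))) -
      1 / 2| ≤ riemannErr β n := by
  have hd : ∀ y, HasDerivAt (fun y => fermi y * (1 - fermi y))
      (-(fermi y * (1 - fermi y)) * (1 - 2 * fermi y)) y := fun y =>
    ((hasDerivAt_fermi y).mul ((hasDerivAt_fermi y).const_sub 1)).congr_deriv (by ring)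
  have hl : Tendsto (fun y => -fermi y) atTop (nhds 0) := by
    simpa using (tendsto_pow_mul_fermi (j := 0) (by norm_num)).neg
  have := abs_riemann_sum_sub_le (C := 40 * 96) (by norm_num) (H := fun y => -fermi y)
    (fun y => (hasDerivAt_fermi y).neg.congr_deriv (neg_neg _)) hd
    (fun y hy => abs_le_of_abs_le_pow_mul_fermi (j := 0)
      (f := fun y => fermi y * (1 - fermi y)) (by norm_num) hy (by
      have h1 := fermi_pos y
      have h2 := fermi_lt_one y
      rw [abs_of_nonneg (mul_nonneg h1.le (by linarith))]
      nlinarith))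
    (fun y hy => abs_le_of_abs_le_pow_mul_fermi (j := 0)
      (f := fun y => -(fermi y * (1 - fermi y)) * (1 - 2 * fermi y)) (by norm_num) hy (by
      have h1 := fermi_pos y
      have h2 := fermi_lt_one y
      rw [abs_mul, abs_neg, abs_of_nonneg (mul_nonneg h1.le (by linarith)), pow_zero, one_mul]
      have h3 : |1 - 2 * fermi y| ≤ 1 := abs_le.2 ⟨by linarith, by linarith⟩
      have h4 : fermi y * (1 - fermi y) ≤ fermi y := by nlinarith
      nlinarith [mul_le_mul h4 h3 (abs_nonneg _) h1.le]))
    hl hβ hβ1 n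
  rw [fermi_zero] at this
  simpa [riemannErr] using this

lemma abs_sum_fermi_var_sub_le {β : ℝ} (hβ : 0 < β) (hβ1 : β ≤ 1)
    (n : ℕ) :
    |2 * β * ∑ k ∈ Finset.range n, fermi (β * (2 * k + 1)) * (1 - fermi (β * (2 * k + 1))) *
      (1 - 3 * fermi (β * (2 * k + 1)) + 3 * fermi (β * (2 * k + 1)) ^ 2) -
      1 / 4| ≤ riemannErr β n := by
  have hd : ∀ y, HasDerivAt (fun y => fermi y * (1 - fermi y) * (1 - 3 * fermi y + 3 * fermi y ^ 2))
      (-(fermi y * (1 - fermi y)) * (1 - 8 * fermi y + 18 * fermi y ^ 2 - 12 * fermi y ^ 3)) y := by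
    intro y
    have h := hasDerivAt_fermi y
    exact ((h.mul (h.const_sub 1)).mul (((h.const_mul 3).const_sub 1).add
      ((h.pow 2).const_mul 3))).congr_deriv (by simp; ring)
  have hH : ∀ y, HasDerivAt (fun y => -fermi y + 3 / 2 * fermi y ^ 2 - fermi y ^ 3)
      (fermi y * (1 - fermi y) * (1 - 3 * fermi y + 3 * fermi y ^ 2)) y := by
    intro y
    have h := hasDerivAt_fermi y
    exact ((h.neg.add ((h.pow 2).const_mul (3 / 2))).sub (h.pow 3)).congr_deriv (by simp; ring)
  have hl : Tendsto (fun y => -fermi y + 3 / 2 * fermi y ^ 2 - fermi y ^ 3) atTop (nhds 0) := by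
    have h0 : Tendsto fermi atTop (nhds 0) := by
      simpa using (tendsto_pow_mul_fermi (j := 0) (by norm_num))
    simpa using (h0.neg.add ((h0.pow 2).const_mul (3 / 2))).sub (h0.pow 3)
  have := abs_riemann_sum_sub_le (C := 40 * 96) (by norm_num) hH hd
    (fun y hy => abs_le_of_abs_le_pow_mul_fermi (j := 0)
      (f := fun y => fermi y * (1 - fermi y) * (1 - 3 * fermi y + 3 * fermi y ^ 2))
      (by norm_num) hy (by
      have h1 := fermi_pos y
      have h2 := fermi_lt_one y
      have h3 : |1 - 3 * fermi y + 3 * fermi y ^ 2| ≤ 1 := abs_le.2 ⟨by nlinarith, by nlinarith⟩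
      rw [abs_mul, abs_of_nonneg (mul_nonneg h1.le (by linarith)), pow_zero, one_mul]
      have h4 : fermi y * (1 - fermi y) ≤ fermi y := by nlinarith
      nlinarith [mul_le_mul h4 h3 (abs_nonneg _) h1.le]))
    (fun y hy => abs_le_of_abs_le_pow_mul_fermi (j := 0)
      (f := fun y => -(fermi y * (1 - fermi y)) *
        (1 - 8 * fermi y + 18 * fermi y ^ 2 - 12 * fermi y ^ 3)) (by norm_num) hy (by
      have h1 := fermi_pos y
      have h2 := fermi_lt_one y
      have h5 : fermi y ^ 2 ≤ 1 := by nlinarith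
      have h6 : fermi y ^ 3 ≤ 1 := by nlinarith [sq_nonneg (fermi y)]
      have h7 : 0 ≤ fermi y ^ 2 := by positivity
      have h8 : 0 ≤ fermi y ^ 3 := by positivity
      have h3 : |1 - 8 * fermi y + 18 * fermi y ^ 2 - 12 * fermi y ^ 3| ≤ 40 :=
        abs_le.2 ⟨by linarith, by linarith⟩
      rw [abs_mul, abs_neg, abs_of_nonneg (mul_nonneg h1.le (by linarith)), pow_zero, one_mul]
      have h4 : fermi y * (1 - fermi y) ≤ fermi y := by nlinarith
      nlinarith [mul_le_mul h4 h3 (abs_nonneg _) h1.le]))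
    hl hβ hβ1 n
  rw [fermi_zero] at this
  rw [riemannErr]
  norm_num at this ⊢
  exact this

lemma abs_sum_mul_fermi_cov_sub_le {β : ℝ} (hβ : 0 < β) (hβ1 : β ≤ 1)
    (n : ℕ) :
    |2 * β * ∑ k ∈ Finset.range n, (β * (2 * k + 1)) * (fermi (β * (2 * k + 1)) *
      (1 - fermi (β * (2 * k + 1))) * (1 - 2 * fermi (β * (2 * k + 1)))) - 1 / 2| ≤
      riemannErr β n := by
  have hg : ∀ y, HasDerivAt (fun y => fermi y * (1 - fermi y) * (1 - 2 * fermi y))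
      (-(fermi y * (1 - fermi y)) * (1 - 6 * fermi y + 6 * fermi y ^ 2)) y := by
    intro y
    have h := hasDerivAt_fermi y
    exact ((h.mul (h.const_sub 1)).mul ((h.const_mul 2).const_sub 1)).congr_deriv (by simp; ring)
  have hd : ∀ y, HasDerivAt (fun y => y * (fermi y * (1 - fermi y) * (1 - 2 * fermi y)))
      (1 * (fermi y * (1 - fermi y) * (1 - 2 * fermi y)) +
        y * (-(fermi y * (1 - fermi y)) * (1 - 6 * fermi y + 6 * fermi y ^ 2))) y := fun y =>
    (hasDerivAt_id y).mul (hg y)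
  have hH : ∀ y, HasDerivAt (fun y => -(y * (fermi y * (1 - fermi y))) - fermi y)
      (y * (fermi y * (1 - fermi y) * (1 - 2 * fermi y))) y := by
    intro y
    have h := hasDerivAt_fermi y
    exact (((hasDerivAt_id y).mul (h.mul (h.const_sub 1))).neg.sub h).congr_deriv (by simp; ring)
  have hl : Tendsto (fun y => -(y * (fermi y * (1 - fermi y))) - fermi y) atTop (nhds 0) := by
    have h0 : Tendsto fermi atTop (nhds 0) := by
      simpa using (tendsto_pow_mul_fermi (j := 0) (by norm_num))
    have h1 : Tendsto (fun y => y * fermi y) atTop (nhds 0) := by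
      simpa using (tendsto_pow_mul_fermi (j := 1) (by norm_num))
    have := (h1.mul (h0.const_sub 1)).neg.sub h0
    simpa [mul_assoc] using this
  have hb : ∀ y, |fermi y * (1 - fermi y) * (1 - 2 * fermi y)| ≤ fermi y ∧
      |-(fermi y * (1 - fermi y)) * (1 - 6 * fermi y + 6 * fermi y ^ 2)| ≤ fermi y := by
    intro y
    have h1 := fermi_pos y
    have h2 := fermi_lt_one y
    have h4 : fermi y * (1 - fermi y) ≤ fermi y := by nlinarith
    have h3 : |1 - 2 * fermi y| ≤ 1 := abs_le.2 ⟨by linarith, by linarith⟩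
    have h5 : |1 - 6 * fermi y + 6 * fermi y ^ 2| ≤ 1 :=
      abs_le.2 ⟨by nlinarith [sq_nonneg (2 * fermi y - 1)], by nlinarith⟩
    rw [abs_mul, abs_mul (-_), abs_neg, abs_of_nonneg (mul_nonneg h1.le (by linarith))]
    exact ⟨by nlinarith [mul_le_mul h4 h3 (abs_nonneg _) h1.le],
      by nlinarith [mul_le_mul h4 h5 (abs_nonneg _) h1.le]⟩
  have := abs_riemann_sum_sub_le (C := 40 * 96) (by norm_num) hH hd
    (fun y hy => abs_le_of_abs_le_pow_mul_fermi (j := 1)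
      (f := fun y => y * (fermi y * (1 - fermi y) * (1 - 2 * fermi y))) (by norm_num) hy (by
      have h1 := fermi_pos y
      rw [abs_mul, abs_of_nonneg hy]
      nlinarith [mul_le_mul_of_nonneg_left (hb y).1 hy, mul_nonneg hy h1.le]))
    (fun y hy => abs_le_of_abs_le_pow_mul_fermi (j := 1)
      (f := fun y => 1 * (fermi y * (1 - fermi y) * (1 - 2 * fermi y)) +
        y * (-(fermi y * (1 - fermi y)) * (1 - 6 * fermi y + 6 * fermi y ^ 2)))
      (by norm_num) hy (by
      have h1 := fermi_pos y
      refine (abs_add_le _ _).trans ?_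
      rw [one_mul, abs_mul y, abs_of_nonneg hy]
      nlinarith [mul_le_mul_of_nonneg_left (hb y).2 hy, mul_nonneg hy h1.le, (hb y).1]))
    hl hβ hβ1 n
  rw [fermi_zero] at this
  rw [riemannErr]
  norm_num at this ⊢
  exact this

lemma abs_sum_sq_mul_fermi_sub_le {β : ℝ} (hβ : 0 < β) (hβ1 : β ≤ 1)
    (n : ℕ) :
    |2 * β * ∑ k ∈ Finset.range n, (β * (2 * k + 1)) ^ 2 * (fermi (β * (2 * k + 1)) *
      (1 - fermi (β * (2 * k + 1)))) - π ^ 2 / 6| ≤ riemannErr β n := by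
  have hg : ∀ y, HasDerivAt (fun y => fermi y * (1 - fermi y))
      (-(fermi y * (1 - fermi y)) * (1 - 2 * fermi y)) y := fun y =>
    ((hasDerivAt_fermi y).mul ((hasDerivAt_fermi y).const_sub 1)).congr_deriv (by ring)
  have hd : ∀ y, HasDerivAt (fun y => y ^ 2 * (fermi y * (1 - fermi y)))
      (2 * y * (fermi y * (1 - fermi y)) +
        y ^ 2 * (-(fermi y * (1 - fermi y)) * (1 - 2 * fermi y))) y := fun y =>
    (((hasDerivAt_id y).pow 2).mul (hg y)).congr_deriv (by simp)
  have hH : ∀ y, HasDerivAt (fun y => -(y ^ 2 * fermi y) + 2 * ∫ u in (0 : ℝ)..y, u * fermi u)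
      (y ^ 2 * (fermi y * (1 - fermi y))) y := fun y =>
    ((((hasDerivAt_id y).pow 2).mul (hasDerivAt_fermi y)).neg.add
      ((hasDerivAt_integral_mul_fermi y).const_mul 2)).congr_deriv (by simp; ring)
  have hl : Tendsto (fun y => -(y ^ 2 * fermi y) + 2 * ∫ u in (0 : ℝ)..y, u * fermi u) atTop
      (nhds (π ^ 2 / 6)) := by
    have := (tendsto_pow_mul_fermi (j := 2) (by norm_num)).neg.add
      (tendsto_integral_mul_fermi.const_mul 2)
    convert this using 2
    ring
  have hb : ∀ y, |fermi y * (1 - fermi y)| ≤ fermi y ∧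
      |-(fermi y * (1 - fermi y)) * (1 - 2 * fermi y)| ≤ fermi y := by
    intro y
    have h1 := fermi_pos y
    have h2 := fermi_lt_one y
    have h4 : fermi y * (1 - fermi y) ≤ fermi y := by nlinarith
    have h3 : |1 - 2 * fermi y| ≤ 1 := abs_le.2 ⟨by linarith, by linarith⟩
    rw [abs_mul (-_), abs_neg, abs_of_nonneg (mul_nonneg h1.le (by linarith))]
    exact ⟨h4, by nlinarith [mul_le_mul h4 h3 (abs_nonneg _) h1.le]⟩
  have := abs_riemann_sum_sub_le (C := 40 * 96) (by norm_num) hH hd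
    (fun y hy => abs_le_of_abs_le_pow_mul_fermi (j := 2)
      (f := fun y => y ^ 2 * (fermi y * (1 - fermi y))) (by norm_num) hy (by
      have h1 := fermi_pos y
      rw [abs_mul, abs_of_nonneg (sq_nonneg y)]
      nlinarith [mul_le_mul_of_nonneg_left (hb y).1 (sq_nonneg y), mul_nonneg hy h1.le,
        mul_nonneg (sq_nonneg y) h1.le]))
    (fun y hy => abs_le_of_abs_le_pow_mul_fermi (j := 2)
      (f := fun y => 2 * y * (fermi y * (1 - fermi y)) +
        y ^ 2 * (-(fermi y * (1 - fermi y)) * (1 - 2 * fermi y))) (by norm_num) hy (by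
      have h1 := fermi_pos y
      refine (abs_add_le _ _).trans ?_
      rw [abs_mul (2 * y), abs_of_nonneg (by linarith : 0 ≤ 2 * y), abs_mul (y ^ 2),
        abs_of_nonneg (sq_nonneg y)]
      nlinarith [mul_le_mul_of_nonneg_left (hb y).2 (sq_nonneg y), mul_nonneg hy h1.le,
        mul_nonneg (sq_nonneg y) h1.le, mul_le_mul_of_nonneg_left (hb y).1 hy]))
    hl hβ hβ1 n
  simpa [riemannErr] using this

end FermiSums

section Decomposition

lemma sum_range_ite_add_lt (g : ℕ → ℝ) (t N : ℕ) :
    ∑ j ∈ Finset.range N, (if j + t < N then g (j + t) else 0) =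
      ∑ k ∈ Finset.range N, if t ≤ k then g k else 0 := by
  rw [← Finset.sum_filter, ← Finset.sum_filter]
  refine Finset.sum_nbij' (fun j => j + t) (fun k => k - t) ?_ ?_ ?_ ?_ ?_
  · intro j hj; simp only [Finset.mem_filter, Finset.mem_range] at hj ⊢; omega
  · intro j hj; simp only [Finset.mem_filter, Finset.mem_range] at hj ⊢; omega
  · intro j hj; omega
  · intro j hj; simp only [Finset.mem_filter, Finset.mem_range] at hj; omega
  · intro j _; rfl

/-- The mean of `asc t` under the product Bernoulli measure on subsets of `range N`. -/
noncomputable def ascMean (t : ℕ) (p : ℕ → ℝ) (N : ℕ) : ℝ :=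
  ∑ k ∈ Finset.range N, p k * (1 - if t ≤ k then p (k - t) else 0)

lemma sum_cind_mul (p w : ℕ → ℝ) {N : ℕ} {S : Finset ℕ} (hS : S ⊆ Finset.range N) :
    ∑ k ∈ Finset.range N, cind p k S * w k = ∑ k ∈ S, w k - ∑ k ∈ Finset.range N, w k * p k := by
  have : ∑ k ∈ S, w k = ∑ k ∈ Finset.range N, if k ∈ S then w k else 0 := by
    rw [← Finset.sum_filter, Finset.filter_mem_eq_inter, Finset.inter_eq_right.2 hS]
  rw [this, ← Finset.sum_sub_distrib]
  refine Finset.sum_congr rfl fun k _ => ?_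
  unfold cind
  split_ifs <;> ring

lemma asc_sub_ascMean_eq (t : ℕ) (p : ℕ → ℝ) {N : ℕ} {S : Finset ℕ} (hS : S ⊆ Finset.range N) :
    (asc t S : ℝ) - ascMean t p N =
      ∑ k ∈ Finset.range N, cind p k S *
        (1 - (if t ≤ k ∧ k - t ∈ S then 1 else 0) - p (k + t)) +
      ∑ k ∈ Finset.range N, if k + t < N then 0 else p (k + t) * cind p k S := by
  have h1 : (asc t S : ℝ) = ∑ k ∈ Finset.range N, (if k ∈ S then 1 else 0) *
      (1 - (if t ≤ k ∧ k - t ∈ S then (1 : ℝ) else 0)) := by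
    simp only [asc, Finset.card_filter, Nat.cast_sum, Nat.cast_ite, Nat.cast_one, Nat.cast_zero]
    have : ∀ w : ℕ → ℝ, ∑ k ∈ S, w k = ∑ k ∈ Finset.range N, if k ∈ S then w k else 0 := by
      intro w
      rw [← Finset.sum_filter, Finset.filter_mem_eq_inter, Finset.inter_eq_right.2 hS]
    rw [this]
    refine Finset.sum_congr rfl fun k _ => ?_
    split_ifs <;> simp_all
  have h2 := sum_range_ite_add_lt (fun k => p k * cind p (k - t) S) t N
  simp only [Nat.add_sub_cancel] at h2
  have h3 : (asc t S : ℝ) - ascMean t p N = ∑ k ∈ Finset.range N, cind p k S *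
        (1 - (if t ≤ k ∧ k - t ∈ S then 1 else 0)) -
      ∑ k ∈ Finset.range N, (if t ≤ k then p k * cind p (k - t) S else 0) := by
    rw [h1, ascMean, ← Finset.sum_sub_distrib, ← Finset.sum_sub_distrib]
    refine Finset.sum_congr rfl fun k _ => ?_
    simp only [cind]
    by_cases h1 : t ≤ k <;> by_cases h2 : k - t ∈ S <;> by_cases h3 : k ∈ S <;>
      simp only [h1, h2, h3, and_self, if_true, if_false, and_false, false_and] <;> ring
  rw [h3, ← h2, ← Finset.sum_sub_distrib, ← Finset.sum_add_distrib]
  refine Finset.sum_congr rfl fun k _ => ?_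
  split_ifs <;> ring

lemma abs_cind_le_one {p : ℕ → ℝ} (hp : ∀ k, 0 ≤ p k ∧ p k ≤ 1) (k : ℕ) (S : Finset ℕ) :
    |cind p k S| ≤ 1 := by
  have := hp k
  unfold cind
  rw [abs_le]
  split_ifs <;> constructor <;> linarith

lemma abs_sum_boundary_le {p : ℕ → ℝ} (hp : ∀ k, 0 ≤ p k ∧ p k ≤ 1) (t N : ℕ) (S : Finset ℕ) :
    |∑ k ∈ Finset.range N, if k + t < N then 0 else p (k + t) * cind p k S| ≤ t := by
  have h : ∀ k ∈ Finset.range N, |if k + t < N then 0 else p (k + t) * cind p k S| ≤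
      if N - t ≤ k then 1 else 0 := by
    intro k _
    by_cases h1 : k + t < N
    · rw [if_pos h1, if_neg (by omega)]
      simp
    · rw [if_neg h1, if_pos (by omega), abs_mul, abs_of_nonneg (hp _).1]
      exact mul_le_one₀ (hp _).2 (abs_nonneg _) (abs_cind_le_one hp k S)
  refine (Finset.abs_sum_le_sum_abs _ _).trans ((Finset.sum_le_sum h).trans ?_)
  rw [← Finset.sum_filter, Finset.sum_const, nsmul_eq_mul, mul_one]
  have : (Finset.range N).filter (fun k => N - t ≤ k) = Finset.Ico (N - t) N := by
    ext k; simp [and_comm]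
  rw [this, Nat.card_Ico]
  exact_mod_cast (by omega : N - (N - t) ≤ t)

lemma norm_cexp_I_sub_le (x y : ℝ) : ‖cexp (x * I) - cexp (y * I)‖ ≤ |x - y| := by
  have h := Complex.norm_exp_ofReal_mul_I y
  have e : cexp (x * I) - cexp (y * I) = cexp (y * I) * (cexp (I * (x - y : ℝ)) - 1) := by
    rw [mul_sub, ← Complex.exp_add, mul_one]
    push_cast
    ring_nf
  rw [e, norm_mul, h, one_mul]
  exact Real.norm_exp_I_mul_ofReal_sub_one_le

/-- Centred characters are close to exponentials of the martingale transform. -/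
lemma norm_chi_sub_mart_le {p : ℕ → ℝ} (hp : ∀ k, 0 ≤ p k ∧ p k ≤ 1) (t : ℕ) (u v : ℝ) {N : ℕ}
    {S : Finset ℕ} (hS : S ⊆ Finset.range N) (m : ℝ) :
    ‖chi t u v S * cexp ((-(u * ascMean t p N + v * m) : ℝ) * I) -
      cexp (mart t (fun k => u * (1 - p (k + t)) + v * (2 * k + 1)) (fun _ => u) p N S * I)‖ ≤
      |u| * t + |v| * |∑ k ∈ Finset.range N, (2 * (k : ℝ) + 1) * p k - m| := by
  rw [chi, ← Complex.exp_add, ← add_mul, ← Complex.ofReal_add]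
  refine (norm_cexp_I_sub_le _ _).trans ?_
  set bd := ∑ k ∈ Finset.range N, if k + t < N then 0 else p (k + t) * cind p k S with hbd
  have h1 := asc_sub_ascMean_eq t p hS
  have h2 := sum_cind_mul p (fun k => 2 * (k : ℝ) + 1) hS
  have h3 : (wt S : ℝ) = ∑ k ∈ S, (2 * (k : ℝ) + 1) := by
    rw [wt]; push_cast; rfl
  have h4 : mart t (fun k => u * (1 - p (k + t)) + v * (2 * k + 1)) (fun _ => u) p N S =
      u * ∑ k ∈ Finset.range N, cind p k S *
        (1 - (if t ≤ k ∧ k - t ∈ S then 1 else 0) - p (k + t)) +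
      v * ∑ k ∈ Finset.range N, cind p k S * (2 * (k : ℝ) + 1) := by
    rw [mart, Finset.mul_sum, Finset.mul_sum, ← Finset.sum_add_distrib]
    refine Finset.sum_congr rfl fun k _ => ?_
    rw [predCoef]
    ring
  have e : u * asc t S + v * wt S + -(u * ascMean t p N + v * m) -
      mart t (fun k => u * (1 - p (k + t)) + v * (2 * k + 1)) (fun _ => u) p N S =
      u * bd + v * (∑ k ∈ Finset.range N, (2 * (k : ℝ) + 1) * p k - m) := by
    rw [h4, h2, h3]
    linear_combination u * h1
  rw [e]
  refine (abs_add_le _ _).trans ?_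
  rw [abs_mul, abs_mul]
  exact add_le_add (mul_le_mul_of_nonneg_left (abs_sum_boundary_le hp t N S) (abs_nonneg _)) le_rfl

end Decomposition

section GaussianLimit

/-- The Boltzmann probability of the part `2k+1` at inverse temperature `β`. -/
noncomputable def boltz (β : ℝ) (k : ℕ) : ℝ := fermi (β * (2 * k + 1))

lemma boltz_mem (β : ℝ) (k : ℕ) : 0 ≤ boltz β k ∧ boltz β k ≤ 1 :=
  ⟨(fermi_pos _).le, (fermi_lt_one _).le⟩

lemma boltz_var_mul_pow_le {β M : ℝ} (hβ : 0 < β) (hM : 0 ≤ M) {j : ℕ} (hj : j ≤ 3) (k : ℕ) :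
    boltz β k * (1 - boltz β k) * (M * (1 + β * (2 * k + 1))) ^ j ≤
      M ^ j * (96 * Real.exp (-(β * (2 * k + 1)) / 2)) := by
  have hy : 0 ≤ β * (2 * k + 1) := by positivity
  have h1 := one_add_pow_mul_fermi_le hy hj
  have h2 := boltz_mem β k
  have h3 : boltz β k * (1 - boltz β k) ≤ boltz β k := by nlinarith
  calc boltz β k * (1 - boltz β k) * (M * (1 + β * (2 * k + 1))) ^ j
      ≤ boltz β k * (M * (1 + β * (2 * k + 1))) ^ j := by gcongr
    _ = M ^ j * ((1 + β * (2 * k + 1)) ^ j * boltz β k) := by rw [mul_pow]; ring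
    _ ≤ _ := by unfold boltz; gcongr

lemma sum_boltz_var_mul_pow_le {β M : ℝ} (hβ : 0 < β) (hM : 0 ≤ M) {j : ℕ} (hj : j ≤ 3) (n : ℕ) :
    ∑ k ∈ Finset.range n, boltz β k * (1 - boltz β k) * (M * (1 + β * (2 * k + 1))) ^ j ≤
      M ^ j * (96 / β) := by
  refine (Finset.sum_le_sum fun k _ => boltz_var_mul_pow_le hβ hM hj k).trans ?_
  rw [← Finset.mul_sum, ← Finset.mul_sum, div_eq_mul_one_div 96 β]
  have := sum_exp_neg_le hβ n
  gcongr

lemma boltz_var_mul_sq_le {β M : ℝ} (hβ : 0 < β) (hM : 0 ≤ M) (k : ℕ) :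
    boltz β k * (1 - boltz β k) * (M * (1 + β * (2 * k + 1))) ^ 2 ≤ M ^ 2 * 96 := by
  refine (boltz_var_mul_pow_le hβ hM (by norm_num) k).trans ?_
  have : Real.exp (-(β * (2 * k + 1)) / 2) ≤ 1 := by
    rw [Real.exp_le_one_iff]
    have : 0 ≤ β * (2 * k + 1) := by positivity
    linarith
  nlinarith [sq_nonneg M]

lemma sum_sq_boltz_var_mul_sq_le {β M : ℝ} (hβ : 0 < β) (hM : 0 ≤ M) (n : ℕ) :
    ∑ k ∈ Finset.range n, (boltz β k * (1 - boltz β k) * (M * (1 + β * (2 * k + 1))) ^ 2) ^ 2 ≤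
      M ^ 2 * 96 * (M ^ 2 * (96 / β)) := by
  have h := sum_boltz_var_mul_pow_le hβ hM (j := 2) (by norm_num) n
  refine le_trans (Finset.sum_le_sum fun k _ => ?_)
    ((Finset.mul_sum _ _ _).symm.le.trans (mul_le_mul_of_nonneg_left h (by positivity)))
  have h1 := boltz_var_mul_sq_le hβ hM k
  have h2 := boltz_mem β k
  rw [sq (boltz β k * _ * _)]
  refine mul_le_mul_of_nonneg_right h1 ?_
  exact mul_nonneg (mul_nonneg h2.1 (by linarith)) (sq_nonneg _)

lemma abs_boltz_add_sub_le {β : ℝ} (hβ : 0 < β) (k t : ℕ) :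
    |boltz β (k + t) - boltz β k| ≤ 2 * t * β := by
  refine (abs_fermi_sub_le _ _).trans_eq ?_
  rw [← abs_of_nonneg (by positivity : 0 ≤ 2 * t * β)]
  congr 1
  push_cast
  ring

lemma abs_perturbation_le {p e c c₀ u K η ι : ℝ} (hc : |c| ≤ K) (hc₀ : |c₀| ≤ K) (hu : |u| ≤ K)
    (hcc : |c - c₀| ≤ K * η) (he0 : 0 ≤ e) (he1 : e ≤ 1) (hep : |e - p| ≤ η + ι) :
    |(c - c₀) * (c + c₀) + u * (u - 2 * c₀) * (e - p) - (2 * u * e) * (c - c₀)| ≤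
      K ^ 2 * (7 * η + 3 * ι) := by
  have hK : 0 ≤ K := (abs_nonneg _).trans hc
  have h1 : |(c - c₀) * (c + c₀)| ≤ K * η * (2 * K) := by
    rw [abs_mul]
    gcongr
    · exact (abs_nonneg _).trans hcc
    · exact (abs_add_le _ _).trans (by linarith)
  have h2 : |u * (u - 2 * c₀) * (e - p)| ≤ K * (3 * K) * (η + ι) := by
    have : |u - 2 * c₀| ≤ 3 * K := by
      refine (abs_sub _ _).trans ?_
      rw [abs_mul, abs_two]
      linarith
    rw [abs_mul, abs_mul]
    gcongr
  have h3 : |(2 * u * e) * (c - c₀)| ≤ 2 * K * 1 * (K * η) := by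
    rw [abs_mul, abs_mul, abs_mul, abs_two, abs_of_nonneg he0]
    gcongr
  refine (abs_sub _ _).trans ((add_le_add (abs_add_le _ _) le_rfl).trans ?_)
  linarith

/-- The mean variance up to the shift by `t` in the argument of `boltz`. -/
lemma abs_meanVar_sub_le {β ε D a b' : ℝ} (hβ : 0 < β) (hε : 0 ≤ ε) (hD : |a| + |b'| ≤ D)
    (t n : ℕ) :
    |meanVar t (fun k => a * ε * (1 - boltz β (k + t)) + b' * ε * (β * (2 * k + 1)))
        (fun _ => a * ε) (boltz β) n -
      ε ^ 2 * (a ^ 2 * (∑ k ∈ Finset.range n, boltz β k * (1 - boltz β k) *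
          (1 - 3 * boltz β k + 3 * boltz β k ^ 2)) +
        2 * a * b' * (∑ k ∈ Finset.range n, (β * (2 * k + 1)) *
          (boltz β k * (1 - boltz β k) * (1 - 2 * boltz β k))) +
        b' ^ 2 * ∑ k ∈ Finset.range n, (β * (2 * k + 1)) ^ 2 *
          (boltz β k * (1 - boltz β k)))| ≤
      14 * t * β * ((ε * D) ^ 2 * (96 / β)) + 3 * (t * ((ε * D) ^ 2 * 96)) := by
  have hD0 : 0 ≤ D := (by positivity : 0 ≤ |a| + |b'|).trans hD
  have hM : 0 ≤ ε * D := mul_nonneg hε hD0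
  set K : ℕ → ℝ := fun k => ε * D * (1 + β * (2 * k + 1)) with hK
  set V : ℕ → ℝ := fun k => boltz β k * (1 - boltz β k) * K k ^ 2 with hV
  have hV0 : ∀ k, 0 ≤ V k := fun k => by
    have := boltz_mem β k
    exact mul_nonneg (mul_nonneg this.1 (by linarith)) (sq_nonneg _)
  rw [meanVar, Finset.mul_sum, Finset.mul_sum, Finset.mul_sum, ← Finset.sum_add_distrib,
    ← Finset.sum_add_distrib, Finset.mul_sum, ← Finset.sum_sub_distrib]
  have key : ∀ k ∈ Finset.range n, |boltz β k * (1 - boltz β k) *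
      ((a * ε * (1 - boltz β (k + t)) + b' * ε * (β * (2 * k + 1))) ^ 2 +
        ((a * ε) ^ 2 - 2 * (a * ε * (1 - boltz β (k + t)) + b' * ε * (β * (2 * k + 1))) *
          (a * ε)) * (if t ≤ k then boltz β (k - t) else 0)) -
      ε ^ 2 * (a ^ 2 * (boltz β k * (1 - boltz β k) *
          (1 - 3 * boltz β k + 3 * boltz β k ^ 2)) +
        2 * a * b' * ((β * (2 * k + 1)) *
          (boltz β k * (1 - boltz β k) * (1 - 2 * boltz β k))) +
        b' ^ 2 * ((β * (2 * k + 1)) ^ 2 *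
          (boltz β k * (1 - boltz β k))))| ≤
      14 * t * β * V k + 3 * (if k < t then V k else 0) := by
    intro k _
    set p := boltz β k with hp
    set q := boltz β (k + t) with hq
    set e := (if t ≤ k then boltz β (k - t) else 0) with he
    set y := β * (2 * (k : ℝ) + 1) with hy
    have hy0 : 0 ≤ y := by positivity
    obtain ⟨hp0, hp1⟩ := boltz_mem β k
    obtain ⟨hq0, hq1⟩ := boltz_mem β (k + t)
    rw [← hp] at hp0 hp1
    rw [← hq] at hq0 hq1
    have he01 : 0 ≤ e ∧ e ≤ 1 := by
      rw [he]; split_ifs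
      · exact boltz_mem β _
      · norm_num
    have hqp : |q - p| ≤ 2 * t * β := abs_boltz_add_sub_le hβ k t
    have htβ : 0 ≤ t * β := by positivity
    have hep : |e - p| ≤ 2 * t * β + (if k < t then 1 else 0) := by
      rw [he]
      by_cases h : t ≤ k
      · rw [if_pos h, if_neg (by omega), add_zero, abs_sub_comm]
        have := abs_boltz_add_sub_le hβ (k - t) t
        rwa [Nat.sub_add_cancel h] at this
      · rw [if_neg h, if_pos (by omega), zero_sub, abs_neg, abs_of_nonneg hp0]
        nlinarith
    set c := a * ε * (1 - q) + b' * ε * y with hc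
    set c0 := a * ε * (1 - p) + b' * ε * y with hc0
    have hKb : ∀ r, 0 ≤ r → r ≤ 1 → |a * ε * (1 - r) + b' * ε * y| ≤ K k := by
      intro r h0 h1
      refine (abs_add_le _ _).trans ?_
      rw [abs_mul, abs_mul, abs_mul, abs_mul, abs_of_nonneg hε, abs_of_nonneg hy0,
        abs_of_nonneg (by linarith : 0 ≤ 1 - r)]
      have h2 : |a| * ε * (1 - r) ≤ |a| * ε * (1 + y) := by gcongr; linarith
      have h3 : |b'| * ε * y ≤ |b'| * ε * (1 + y) := by gcongr; linarith
      calc |a| * ε * (1 - r) + |b'| * ε * y ≤ (|a| + |b'|) * (ε * (1 + y)) := by linarith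
        _ ≤ D * (ε * (1 + y)) := by gcongr
        _ = K k := by rw [hK]; ring
    have hcK : |c| ≤ K k := hKb q hq0 hq1
    have hc0K : |c0| ≤ K k := hKb p hp0 hp1
    have hK0 : 0 ≤ K k := (abs_nonneg _).trans hcK
    have huK : |a * ε| ≤ K k := by
      rw [abs_mul, abs_of_nonneg hε]
      have : |a| ≤ D := by linarith [abs_nonneg b']
      calc |a| * ε ≤ D * ε := by gcongr
        _ ≤ ε * D * (1 + y) := by nlinarith [mul_nonneg hM hy0]
    have hcc : |c - c0| ≤ K k * (2 * t * β) := by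
      have : c - c0 = -(a * ε * (q - p)) := by rw [hc, hc0]; ring
      rw [this, abs_neg, abs_mul]
      gcongr
    have hV' : V k = p * (1 - p) * K k ^ 2 := rfl
    have hpp : 0 ≤ p * (1 - p) := mul_nonneg hp0 (by linarith)
    have eq : p * (1 - p) * (c ^ 2 + ((a * ε) ^ 2 - 2 * c * (a * ε)) * e) -
      ε ^ 2 * (a ^ 2 * (p * (1 - p) * (1 - 3 * p + 3 * p ^ 2)) +
        2 * a * b' * (y * (p * (1 - p) * (1 - 2 * p))) + b' ^ 2 * (y ^ 2 * (p * (1 - p)))) =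
      p * (1 - p) * ((c - c0) * (c + c0) + (a * ε) * (a * ε - 2 * c0) * (e - p) -
        (2 * (a * ε) * e) * (c - c0)) := by
      rw [hc0]; ring
    rw [eq, abs_mul, abs_of_nonneg hpp]
    have h4 := abs_perturbation_le hcK hc0K huK hcc he01.1 he01.2 hep
    refine (mul_le_mul_of_nonneg_left h4 hpp).trans_eq ?_
    rw [hV']
    split_ifs <;> ring
  refine (Finset.abs_sum_le_sum_abs _ _).trans ((Finset.sum_le_sum key).trans ?_)
  rw [Finset.sum_add_distrib, ← Finset.mul_sum, ← Finset.mul_sum]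
  have s1 : ∑ k ∈ Finset.range n, V k ≤ (ε * D) ^ 2 * (96 / β) :=
    sum_boltz_var_mul_pow_le hβ hM (by norm_num) n
  have s2 : ∑ k ∈ Finset.range n, (if k < t then V k else 0) ≤ t * ((ε * D) ^ 2 * 96) := by
    rw [← Finset.sum_filter]
    have hs : (Finset.range n).filter (fun k => k < t) ⊆ Finset.range t := by
      intro k; simp
    refine (Finset.sum_le_sum_of_subset_of_nonneg hs fun k _ _ => hV0 k).trans ?_
    refine (Finset.sum_le_sum fun k _ => boltz_var_mul_sq_le hβ hM k).trans_eq ?_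
    simp
  gcongr

end GaussianLimit

section Scaling

/-- The constant `π / √24`. -/
noncomputable def kap : ℝ := π / Real.sqrt 24

/-- The scale `n ^ (-1/4)`. -/
noncomputable def scale (n : ℕ) : ℝ := (Real.sqrt (Real.sqrt n))⁻¹

/-- The saddle point `π / √(24 n)`. -/
noncomputable def bet (n : ℕ) : ℝ := kap * scale n ^ 2

lemma kap_pos : 0 < kap := by unfold kap; positivity

lemma kap_sq : kap ^ 2 = π ^ 2 / 24 := by
  rw [kap, div_pow, Real.sq_sqrt (by norm_num)]

lemma kap_le_one : kap ≤ 1 := by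
  have h := kap_sq
  have := Real.pi_lt_d2
  nlinarith [kap_pos, Real.pi_pos]

lemma scale_pos {n : ℕ} (hn : 1 ≤ n) : 0 < scale n := by
  have : (0 : ℝ) < n := by exact_mod_cast hn
  unfold scale; positivity

lemma scale_nonneg (n : ℕ) : 0 ≤ scale n := by unfold scale; positivity

lemma scale_sq (n : ℕ) : scale n ^ 2 = (Real.sqrt n)⁻¹ := by
  rw [scale, inv_pow, Real.sq_sqrt (Real.sqrt_nonneg _)]

lemma scale_pow_four (n : ℕ) : scale n ^ 4 = (n : ℝ)⁻¹ := by
  rw [show scale n ^ 4 = (scale n ^ 2) ^ 2 by ring, scale_sq, inv_pow,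
    Real.sq_sqrt (Nat.cast_nonneg n)]

lemma scale_pow_four_mul {n : ℕ} (hn : 1 ≤ n) : scale n ^ 4 * n = 1 := by
  rw [scale_pow_four, inv_mul_cancel₀]
  positivity

lemma scale_le_one {n : ℕ} (hn : 1 ≤ n) : scale n ≤ 1 := by
  have : (1 : ℝ) ≤ n := by exact_mod_cast hn
  exact inv_le_one_of_one_le₀ (Real.one_le_sqrt.2 (Real.one_le_sqrt.2 this))

lemma tendsto_scale : Tendsto scale atTop (nhds 0) :=
  tendsto_inv_atTop_zero.comp (Real.tendsto_sqrt_atTop.comp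
    (Real.tendsto_sqrt_atTop.comp tendsto_natCast_atTop_atTop))

lemma tendsto_const_mul_scale (C : ℝ) : Tendsto (fun n => C * scale n) atTop (nhds 0) := by
  simpa using tendsto_scale.const_mul C

lemma bet_pos {n : ℕ} (hn : 1 ≤ n) : 0 < bet n :=
  mul_pos kap_pos (pow_pos (scale_pos hn) 2)

lemma bet_le_one {n : ℕ} (hn : 1 ≤ n) : bet n ≤ 1 :=
  mul_le_one₀ kap_le_one (by positivity) (pow_le_one₀ (scale_nonneg n) (scale_le_one hn))

/-- The constant in the estimate of `riemannErr` at the saddle point. -/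
noncomputable def riemannConst : ℝ := 8 * (40 * 96) * kap + 2 * (40 * 96) / kap

lemma riemannErr_le {n : ℕ} (hn : 1 ≤ n) : riemannErr (bet n) n ≤ riemannConst * scale n ^ 2 := by
  have hs := scale_pos hn
  have hk := kap_pos
  have h4 := scale_pow_four_mul hn
  have h1 : bet n * n = kap / scale n ^ 2 := by
    rw [bet, eq_div_iff (by positivity)]
    linear_combination kap * h4
  have h2 : Real.exp (-(bet n * n)) ≤ scale n ^ 2 / kap := by
    rw [h1, Real.exp_neg]
    refine inv_le_of_inv_le₀ (by positivity) ?_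
    rw [inv_div]
    linarith [Real.add_one_le_exp (kap / scale n ^ 2)]
  rw [riemannErr, riemannConst, bet] at *
  calc _ ≤ 8 * (40 * 96) * (kap * scale n ^ 2) + 2 * (40 * 96) * (scale n ^ 2 / kap) := by gcongr
    _ = _ := by ring

lemma tendsto_of_abs_sub_le_riemannErr {f : ℕ → ℝ} {l : ℝ}
    (h : ∀ n, 1 ≤ n → |f n - l| ≤ riemannErr (bet n) n) : Tendsto f atTop (nhds l) := by
  rw [tendsto_iff_norm_sub_tendsto_zero]
  have h0 : Tendsto (fun n => riemannConst * scale n ^ 2) atTop (nhds 0) := by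
    simpa using (tendsto_scale.pow 2).const_mul riemannConst
  refine squeeze_zero' (Eventually.of_forall fun _ => norm_nonneg _) ?_ h0
  filter_upwards [eventually_ge_atTop 1] with n hn
  exact (h n hn).trans (riemannErr_le hn)

/-- The limiting quadratic form. -/
noncomputable def limVar (a b : ℝ) : ℝ :=
  a ^ 2 / (8 * kap) + a * b / (2 * kap ^ 2) + b ^ 2 * π ^ 2 / (12 * kap ^ 3)

lemma abs_sum_mul_boltz_sub_le {n : ℕ} (hn : 1 ≤ n) :
    |∑ k ∈ Finset.range n, (2 * (k : ℝ) + 1) * boltz (bet n) k - n| ≤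
      riemannConst / (2 * kap ^ 2) / scale n ^ 2 := by
  have hb := bet_pos hn
  have hs := scale_pos hn
  have hk := kap_pos
  have h := (abs_sum_mul_fermi_sub_le hb (bet_le_one hn) n).trans (riemannErr_le hn)
  have e : 2 * bet n * ∑ k ∈ Finset.range n, bet n * (2 * (k : ℝ) + 1) *
      fermi (bet n * (2 * k + 1)) - π ^ 2 / 12 =
      2 * bet n ^ 2 * (∑ k ∈ Finset.range n, (2 * (k : ℝ) + 1) * boltz (bet n) k - n) := by
    have h1 : 2 * bet n ^ 2 * n = π ^ 2 / 12 := by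
      rw [bet]
      linear_combination 2 * kap ^ 2 * scale_pow_four_mul hn + 2 * kap_sq
    have h2 : ∑ k ∈ Finset.range n, bet n * (2 * (k : ℝ) + 1) * fermi (bet n * (2 * k + 1)) =
        bet n * ∑ k ∈ Finset.range n, (2 * (k : ℝ) + 1) * boltz (bet n) k := by
      rw [Finset.mul_sum]
      exact Finset.sum_congr rfl fun k _ => by rw [boltz]; ring
    rw [h2, mul_sub, h1]
    ring
  rw [e, abs_mul, abs_of_nonneg (by positivity), ← le_div_iff₀' (by positivity)] at h
  refine h.trans_eq ?_
  rw [bet]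
  field_simp

lemma tendsto_meanVar (t : ℕ) (a b : ℝ) :
    Tendsto (fun n => meanVar t
      (fun k => a * scale n * (1 - boltz (bet n) (k + t)) + b * scale n ^ 3 * (2 * k + 1))
      (fun _ => a * scale n) (boltz (bet n)) n) atTop (nhds (limVar a b)) := by
  have hk := kap_pos
  set D := |a| + |b / kap| with hD
  have l1 := tendsto_of_abs_sub_le_riemannErr fun n hn =>
    abs_sum_fermi_var_sub_le (bet_pos hn) (bet_le_one hn) n
  have l2 := tendsto_of_abs_sub_le_riemannErr fun n hn =>
    abs_sum_mul_fermi_cov_sub_le (bet_pos hn) (bet_le_one hn) n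
  have l3 := tendsto_of_abs_sub_le_riemannErr fun n hn =>
    abs_sum_sq_mul_fermi_sub_le (bet_pos hn) (bet_le_one hn) n
  have l := (((l1.const_mul (a ^ 2)).add (l2.const_mul (2 * a * (b / kap)))).add
    (l3.const_mul ((b / kap) ^ 2))).const_mul (1 / (2 * kap))
  have hl : 1 / (2 * kap) * (a ^ 2 * (1 / 4) + 2 * a * (b / kap) * (1 / 2) +
      (b / kap) ^ 2 * (π ^ 2 / 6)) = limVar a b := by
    rw [limVar]; field_simp; ring
  rw [hl] at l
  have hz : Tendsto (fun n => (14 * t * (D ^ 2 * 96) + 3 * (t * (D ^ 2 * 96))) * scale n ^ 2) atTop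
      (nhds 0) := by
    simpa using (tendsto_scale.pow 2).const_mul (14 * t * (D ^ 2 * 96) + 3 * (t * (D ^ 2 * 96)))
  refine tendsto_of_tendsto_of_dist l ?_
  refine squeeze_zero' (Eventually.of_forall fun _ => dist_nonneg) ?_ hz
  filter_upwards [eventually_ge_atTop 1] with n hn
  have hb := bet_pos hn
  have hs := scale_pos hn
  have h := abs_meanVar_sub_le (D := D) (a := a) (b' := b / kap) hb hs.le le_rfl t n
  have hc : (fun k : ℕ => a * scale n * (1 - boltz (bet n) (k + t)) +
      b * scale n ^ 3 * (2 * k + 1)) = (fun k : ℕ => a * scale n * (1 - boltz (bet n) (k + t)) +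
      b / kap * scale n * (bet n * (2 * k + 1))) := by
    funext k
    rw [bet]
    field_simp
  rw [hc, dist_comm, Real.dist_eq]
  refine le_trans (le_of_eq ?_) (h.trans (le_of_eq ?_))
  · congr 2
    have : scale n ^ 2 = bet n / kap := by rw [bet]; field_simp
    rw [this]
    simp only [boltz]
    ring
  · field_simp

lemma tendsto_bernEx_mart {t : ℕ} (ht : 1 ≤ t) (a b : ℝ) :
    Tendsto (fun n => bernEx (boltz (bet n)) (Finset.range n) (fun S => cexp (mart t
      (fun k => a * scale n * (1 - boltz (bet n) (k + t)) + b * scale n ^ 3 * (2 * k + 1))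
      (fun _ => a * scale n) (boltz (bet n)) n S * I))) atTop
      (nhds (Real.exp (-limVar a b / 2) : ℂ)) := by
  have hk := kap_pos
  set D := |a| + |b / kap| with hD
  have hmv := tendsto_meanVar t a b
  set W := limVar a b with hW
  have hD0 : 0 ≤ D := by positivity
  have hW0 : 0 ≤ W := by
    have h6 : 6 ≤ π ^ 2 := by nlinarith [Real.pi_gt_three]
    have : W = ((b + 3 * kap * a / π ^ 2) ^ 2 * π ^ 2 / (12 * kap ^ 3)) +
        a ^ 2 / (8 * kap) * (1 - 6 / π ^ 2) := by
      rw [hW, limVar]; field_simp; ring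
    rw [this]
    have : 0 ≤ 1 - 6 / π ^ 2 := by
      rw [sub_nonneg, div_le_one (by positivity)]; exact h6
    positivity
  set c : ℕ → ℕ → ℝ := fun n k =>
    a * scale n * (1 - boltz (bet n) (k + t)) + b * scale n ^ 3 * (2 * k + 1) with hc
  set B : ℝ := D ^ 2 * (96 / kap) with hB
  have hbd : Tendsto (fun n => Real.exp (B / 2) * (5 * (D ^ 3 * (96 / kap)) * scale n +
      (Real.sqrt (D ^ 2 * 96 * (D ^ 2 * (96 / kap))) * scale n +
        |meanVar t (c n) (fun _ => a * scale n) (boltz (bet n)) n - W|))) atTop (nhds 0) := by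
    have h1 := tendsto_const_mul_scale (5 * (D ^ 3 * (96 / kap)))
    have h2 := tendsto_const_mul_scale (Real.sqrt (D ^ 2 * 96 * (D ^ 2 * (96 / kap))))
    have h3 : Tendsto (fun n => |meanVar t (c n) (fun _ => a * scale n) (boltz (bet n)) n - W|)
        atTop (nhds 0) := by
      simpa using (hmv.sub_const W).abs
    simpa using (h1.add (h2.add h3)).const_mul (Real.exp (B / 2))
  rw [tendsto_iff_norm_sub_tendsto_zero]
  refine squeeze_zero' (Eventually.of_forall fun _ => norm_nonneg _) ?_ hbd
  filter_upwards [eventually_ge_atTop 1] with n hn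
  have hb := bet_pos hn
  have hs := scale_pos hn
  have hM : 0 ≤ scale n * D := by positivity
  have hK : ∀ k, |c n k| ≤ scale n * D * (1 + bet n * (2 * k + 1)) ∧
      |c n k - a * scale n| ≤ scale n * D * (1 + bet n * (2 * k + 1)) := by
    intro k
    obtain ⟨hq0, hq1⟩ := boltz_mem (bet n) (k + t)
    have hy : 0 ≤ bet n * (2 * k + 1) := by positivity
    have hv : b * scale n ^ 3 * (2 * k + 1) = b / kap * scale n * (bet n * (2 * k + 1)) := by
      rw [bet]; field_simp
    have key : ∀ r, |r| ≤ 1 → |a * scale n * r + b / kap * scale n * (bet n * (2 * k + 1))| ≤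
        scale n * D * (1 + bet n * (2 * k + 1)) := by
      intro r hr
      refine (abs_add_le _ _).trans ?_
      rw [abs_mul, abs_mul, abs_mul, abs_mul, abs_of_nonneg hs.le, abs_of_nonneg hy]
      have h1 : |a| * scale n * |r| ≤ |a| * scale n * (1 + bet n * (2 * k + 1)) := by
        gcongr; linarith
      have h2 : |b / kap| * scale n * (bet n * (2 * k + 1)) ≤
          |b / kap| * scale n * (1 + bet n * (2 * k + 1)) := by
        gcongr; linarith
      rw [hD]
      linarith
    simp only [hc, hv]
    refine ⟨key _ ?_, ?_⟩
    · rw [abs_le]; constructor <;> linarith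
    · have := key (-boltz (bet n) (k + t)) (by rw [abs_neg, abs_of_nonneg hq0]; exact hq1)
      refine le_trans (le_of_eq ?_) this
      congr 1
      ring
  have hsb : scale n ^ 2 * (96 / bet n) = 96 / kap := by rw [bet]; field_simp
  have hB' : ∑ k ∈ Finset.range n, boltz (bet n) k * (1 - boltz (bet n) k) *
      (scale n * D * (1 + bet n * (2 * k + 1))) ^ 2 ≤ B := by
    refine (sum_boltz_var_mul_pow_le hb hM (by norm_num) n).trans_eq ?_
    rw [hB, ← hsb]; ring
  refine (norm_bernEx_exp_mart_sub_le ht (boltz_mem (bet n)) hK hW0 n hB').trans ?_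
  have s3 := sum_boltz_var_mul_pow_le hb hM (j := 3) le_rfl n
  have s4 := sum_sq_boltz_var_mul_sq_le hb hM n
  have e3 : (scale n * D) ^ 3 * (96 / bet n) = D ^ 3 * (96 / kap) * scale n := by
    rw [← hsb]; ring
  have e4 : (scale n * D) ^ 2 * 96 * ((scale n * D) ^ 2 * (96 / bet n)) =
      (D ^ 2 * 96 * (D ^ 2 * (96 / kap))) * scale n ^ 2 := by
    rw [← hsb]; ring
  rw [e3] at s3
  rw [e4] at s4
  have s4' := Real.sqrt_le_sqrt s4
  rw [Real.sqrt_mul (by positivity), Real.sqrt_sq hs.le] at s4'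
  rw [← Finset.mul_sum]
  refine mul_le_mul_of_nonneg_left (add_le_add ?_ (add_le_add s4' le_rfl)) (Real.exp_pos _).le
  linarith

/-- Joint characteristic function of `asc t` and `wt` under the Boltzmann measure. -/
lemma tendsto_bernEx_chi {t : ℕ} (ht : 1 ≤ t) (a b : ℝ) :
    Tendsto (fun n => bernEx (boltz (bet n)) (Finset.range n)
        (chi t (a * scale n) (b * scale n ^ 3)) *
      cexp ((-(a * scale n * ascMean t (boltz (bet n)) n + b * scale n ^ 3 * n) : ℝ) * I)) atTop
      (nhds (Real.exp (-limVar a b / 2) : ℂ)) := by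
  refine tendsto_of_tendsto_of_dist (tendsto_bernEx_mart ht a b) ?_
  refine squeeze_zero' (Eventually.of_forall fun _ => dist_nonneg) ?_
    (tendsto_const_mul_scale (|a| * t + |b| * (riemannConst / (2 * kap ^ 2))))
  filter_upwards [eventually_ge_atTop 1] with n hn
  have hs := scale_pos hn
  rw [dist_comm, dist_eq_norm, mul_comm, ← bernEx_const_mul_complex, ← bernEx_sub]
  refine norm_bernEx_le_of_le (boltz_mem _) fun S hS => ?_
  rw [mul_comm]
  refine (norm_chi_sub_mart_le (boltz_mem _) t _ _ hS n).trans ?_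
  have h := abs_sum_mul_boltz_sub_le hn
  rw [abs_mul, abs_mul, abs_of_nonneg hs.le, abs_of_nonneg (by positivity : 0 ≤ scale n ^ 3)]
  calc _ ≤ |a| * scale n * t + |b| * scale n ^ 3 *
        (riemannConst / (2 * kap ^ 2) / scale n ^ 2) := by gcongr
    _ = _ := by field_simp

end Scaling

section LocalLimit

open MeasureTheory

lemma fermi_anti {x y : ℝ} (h : x ≤ y) : fermi y ≤ fermi x := by
  unfold fermi
  gcongr

lemma sqrt_div_two_le {n : ℕ} (hn : 1 ≤ n) : Real.sqrt n / 2 ≤ Nat.sqrt n := by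
  have h1 : (1 : ℝ) ≤ Nat.sqrt n := by exact_mod_cast Nat.sqrt_pos.2 hn
  have h2 : Real.sqrt n ≤ Nat.sqrt n + 1 := Real.real_sqrt_le_nat_sqrt_succ
  linarith

lemma le_boltz_var {n k : ℕ} (hn : 1 ≤ n) (hk : k < Nat.sqrt n) :
    fermi 2 / 2 ≤ boltz (bet n) k * (1 - boltz (bet n) k) := by
  have hb := bet_pos hn
  have hy0 : 0 ≤ bet n * (2 * k + 1) := by positivity
  have hy2 : bet n * (2 * k + 1) ≤ 2 := by
    have h1 : (2 * k + 1 : ℝ) ≤ 2 * Nat.sqrt n := by exact_mod_cast (by omega)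
    have h2 : (Nat.sqrt n : ℝ) ≤ Real.sqrt n := Real.nat_sqrt_le_real_sqrt
    have h3 : 0 < Real.sqrt n := Real.sqrt_pos.2 (by exact_mod_cast hn)
    calc bet n * (2 * k + 1) ≤ bet n * (2 * Real.sqrt n) := by gcongr; linarith
      _ = 2 * kap := by rw [bet, scale_sq]; field_simp
      _ ≤ 2 := by linarith [kap_le_one]
  have h1 := fermi_anti hy2
  have h2 := fermi_anti hy0
  rw [fermi_zero] at h2
  have h3 := fermi_pos 2
  unfold boltz
  nlinarith

lemma exp_neg_le_two_div {x m : ℝ} (hm : 0 ≤ m) (h : m ≤ x ∨ (0 ≤ x ∧ m ≤ x ^ 3 / 6)) :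
    Real.exp (-x) ≤ 2 / (1 + m) := by
  rw [Real.exp_neg, ← one_div, div_le_div_iff₀ (Real.exp_pos _) (by linarith)]
  rcases h with h | ⟨h0, h⟩
  · linarith [Real.add_one_le_exp x]
  · have := Real.pow_div_factorial_le_exp x h0 3
    norm_num [Nat.factorial] at this
    linarith [Real.one_le_exp h0]

/-- Integrable domination of the rescaled characteristic function. -/
lemma norm_bernEx_chi_scale_le {t : ℕ} (ht : 1 ≤ t) (a : ℝ) : ∃ C : ℝ, ∀ n, 1 ≤ n → ∀ b : ℝ,
    |b * scale n ^ 3| ≤ π →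
    ‖bernEx (boltz (bet n)) (Finset.range n) (chi t (a * scale n) (b * scale n ^ 3))‖ ≤
      C * (1 + b ^ 2)⁻¹ := by
  set c := fermi 2 / 2 with hc
  have hc0 : 0 < c := by have := fermi_pos 2; positivity
  have hc1 : c ≤ 1 := by have := fermi_lt_one 2; rw [hc]; linarith
  set m := c ^ 3 / (24576 * π ^ 2) with hm
  have hπ := Real.pi_gt_three
  have hm0 : 0 < m := by positivity
  have hm1 : m ≤ 1 := by
    rw [hm, div_le_one (by positivity)]
    have : c ^ 3 ≤ 1 := pow_le_one₀ hc0.le hc1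
    nlinarith
  refine ⟨Real.exp (a ^ 2 / 8) * (2 / m), fun n hn b hb => ?_⟩
  have hs := scale_pos hn
  set L := Nat.sqrt n with hL
  have hL1 : 1 ≤ L := Nat.sqrt_pos.2 hn
  have hLr : (L : ℝ) * scale n ^ 2 ≤ 1 := by
    have h2 : (L : ℝ) ≤ Real.sqrt n := Real.nat_sqrt_le_real_sqrt
    have h3 : 0 < Real.sqrt n := Real.sqrt_pos.2 (by exact_mod_cast hn)
    rw [scale_sq, ← div_eq_mul_inv, div_le_one h3]
    exact h2
  have hLl : 1 / 2 ≤ (L : ℝ) * scale n ^ 2 := by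
    have h2 := sqrt_div_two_le hn
    have h3 : 0 < Real.sqrt n := Real.sqrt_pos.2 (by exact_mod_cast hn)
    rw [scale_sq, ← div_eq_mul_inv, le_div_iff₀ h3]
    linarith
  have hL8 : 1 ≤ 8 * ((L : ℝ) ^ 3 * scale n ^ 6) := by
    have : (1 / 2 : ℝ) ^ 3 ≤ (L * scale n ^ 2) ^ 3 := by gcongr
    have e : (L * scale n ^ 2 : ℝ) ^ 3 = L ^ 3 * scale n ^ 6 := by ring
    rw [e] at this
    linarith
  have h := norm_bernEx_chi_le ht (boltz_mem (bet n)) (a * scale n) (b * scale n ^ 3)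
    (Nat.sqrt_le_self n) hc0.le (fun k hk => le_boltz_var hn hk)
  rw [← hL] at h
  refine h.trans ?_
  have h1 : (a * scale n) ^ 2 * L / 8 ≤ a ^ 2 / 8 := by
    have : (a * scale n) ^ 2 * L = a ^ 2 * (L * scale n ^ 2) := by ring
    rw [this]
    nlinarith [sq_nonneg a]
  have h2 : Real.exp (-(c / 4 * cosDefect L (b * scale n ^ 3))) ≤ 2 / (1 + m * b ^ 2) := by
    refine exp_neg_le_two_div (by positivity) ?_
    rcases le_cosDefect hL1 hb with hd | hd
    · refine Or.inr ?_
      have hx : c * L / 8 ≤ c / 4 * cosDefect L (b * scale n ^ 3) := by nlinarith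
      have hx0 : 0 ≤ c * L / 8 := by positivity
      refine ⟨hx0.trans hx, ?_⟩
      have hb2 : b ^ 2 * scale n ^ 6 ≤ π ^ 2 := by
        have : (b * scale n ^ 3) ^ 2 ≤ π ^ 2 := sq_le_sq' (abs_le.1 hb).1 (abs_le.1 hb).2
        linarith [this, (by ring : (b * scale n ^ 3) ^ 2 = b ^ 2 * scale n ^ 6)]
      have hb3 : b ^ 2 ≤ 8 * π ^ 2 * L ^ 3 := by
        calc b ^ 2 = b ^ 2 * 1 := by ring
          _ ≤ b ^ 2 * (8 * ((L : ℝ) ^ 3 * scale n ^ 6)) := by gcongr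
          _ = (b ^ 2 * scale n ^ 6) * (8 * L ^ 3) := by ring
          _ ≤ π ^ 2 * (8 * L ^ 3) := by gcongr
          _ = _ := by ring
      calc m * b ^ 2 ≤ m * (8 * π ^ 2 * L ^ 3) := by gcongr
        _ = (c * L / 8) ^ 3 / 6 := by rw [hm]; field_simp; ring
        _ ≤ _ := by gcongr
    · refine Or.inl ?_
      have hb3 : b ^ 2 / (4 * π ^ 2) ≤ cosDefect L (b * scale n ^ 3) := by
        refine le_trans ?_ hd
        calc b ^ 2 / (4 * π ^ 2) = b ^ 2 / (4 * π ^ 2) * 1 := by ring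
          _ ≤ b ^ 2 / (4 * π ^ 2) * (8 * ((L : ℝ) ^ 3 * scale n ^ 6)) := by gcongr
          _ = _ := by field_simp; ring
      have hmm : m ≤ c / (16 * π ^ 2) := by
        rw [hm, div_le_div_iff₀ (by positivity) (by positivity)]
        have : c ^ 3 ≤ c := by nlinarith [mul_pos hc0 hc0]
        have h9 : 0 < π ^ 2 := by positivity
        have h10 : c ^ 3 * (16 * π ^ 2) ≤ c * (16 * π ^ 2) := by gcongr
        have h11 : 0 < c * π ^ 2 := by positivity
        nlinarith
      calc m * b ^ 2 ≤ c / (16 * π ^ 2) * b ^ 2 := by gcongr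
        _ = c / 4 * (b ^ 2 / (4 * π ^ 2)) := by field_simp; ring
        _ ≤ _ := by gcongr
  have h3 : 2 / (1 + m * b ^ 2) ≤ 2 / m * (1 + b ^ 2)⁻¹ := by
    rw [← div_eq_mul_inv, div_div]
    gcongr
    nlinarith [sq_nonneg b]
  calc _ = Real.exp ((a * scale n) ^ 2 * L / 8) *
        Real.exp (-(c / 4 * cosDefect L (b * scale n ^ 3))) := by rw [← Real.exp_add]; ring_nf
    _ ≤ Real.exp (a ^ 2 / 8) * (2 / m * (1 + b ^ 2)⁻¹) := by
        gcongr
        exact h2.trans h3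
    _ = _ := by ring

end LocalLimit

section FourierInversion

open MeasureTheory

lemma integral_cexp_int_mul_I (m : ℤ) :
    ∫ θ in (-π)..π, cexp ((θ * m : ℝ) * I) = if m = 0 then (2 * π : ℂ) else 0 := by
  split_ifs with h
  · subst h
    simp
    ring
  · have h0 : (m * I : ℂ) ≠ 0 := mul_ne_zero (by exact_mod_cast h) I_ne_zero
    have e : ∀ θ : ℝ, cexp ((θ * m : ℝ) * I) = cexp ((m * I) * θ) := by
      intro θ; push_cast; ring_nf
    simp_rw [e]
    rw [integral_exp_mul_complex h0, div_eq_zero_iff, sub_eq_zero]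
    left
    rw [Complex.exp_eq_exp_iff_exists_int]
    exact ⟨m, by push_cast; ring⟩

/-- Fourier inversion on a rescaled period. -/
lemma integral_indicator_cexp {s : ℝ} (hs : 0 < s) (m : ℤ) :
    ∫ b, Set.indicator {b : ℝ | |b * s| ≤ π} (fun b => cexp ((b * s * m : ℝ) * I)) b =
      if m = 0 then (2 * π / s : ℂ) else 0 := by
  have hset : {b : ℝ | |b * s| ≤ π} = Set.Icc (-π / s) (π / s) := by
    ext b
    rw [Set.mem_ofPred_eq, abs_le, Set.mem_Icc, div_le_iff₀ hs, le_div_iff₀ hs]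
  have hle : -π / s ≤ π / s := by gcongr; linarith [Real.pi_pos]
  rw [hset, integral_indicator measurableSet_Icc, integral_Icc_eq_integral_Ioc,
    ← intervalIntegral.integral_of_le hle,
    intervalIntegral.integral_comp_mul_right (fun θ : ℝ => cexp ((θ * m : ℝ) * I)) hs.ne',
    div_mul_cancel₀ _ hs.ne', div_mul_cancel₀ _ hs.ne', integral_cexp_int_mul_I]
  split_ifs
  · rw [Complex.real_smul]; push_cast; ring
  · simp

lemma integrable_indicator_cexp {s : ℝ} (hs : 0 < s) (m : ℝ) :
    Integrable (Set.indicator {b : ℝ | |b * s| ≤ π} (fun b => cexp ((b * s * m : ℝ) * I))) := by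
  have hset : {b : ℝ | |b * s| ≤ π} = Set.Icc (-π / s) (π / s) := by
    ext b
    rw [Set.mem_ofPred_eq, abs_le, Set.mem_Icc, div_le_iff₀ hs, le_div_iff₀ hs]
  rw [hset, integrable_indicator_iff measurableSet_Icc]
  exact (by fun_prop : Continuous fun b : ℝ => cexp ((b * s * m : ℝ) * I)).integrableOn_Icc

/-- On the level sets of `wt` the Boltzmann weight is constant. -/
lemma bernWt_boltz (β : ℝ) {n : ℕ} {S : Finset ℕ} (hS : S ⊆ Finset.range n) :
    bernWt (boltz β) (Finset.range n) S =
      (∏ k ∈ Finset.range n, (1 - boltz β k)) * Real.exp (-(β * wt S)) := by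
  have h : ∀ k, (if k ∈ S then boltz β k else 1 - boltz β k) =
      (1 - boltz β k) * (if k ∈ S then Real.exp (-(β * (2 * k + 1))) else 1) := by
    intro k
    split_ifs
    · rw [boltz, fermi, Real.exp_neg]
      have := Real.exp_pos (β * (2 * k + 1))
      field_simp
      ring
    · ring
  rw [bernWt, Finset.prod_congr rfl fun k _ => h k, Finset.prod_mul_distrib, ← Finset.prod_filter,
    Finset.filter_mem_eq_inter, Finset.inter_eq_right.2 hS, ← Real.exp_sum, wt]
  congr 2
  push_cast
  rw [Finset.mul_sum, Finset.sum_neg_distrib]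

/-- The partial characteristic function of `asc t` over self-conjugate partitions of `n`. -/
noncomputable def ascSum (t n : ℕ) (α : ℝ) : ℂ :=
  ∑ P ∈ SC n, cexp ((α * asc t (frob P) : ℝ) * I)

lemma ascSum_zero (t n : ℕ) : ascSum t n 0 = (SC n).card := by
  simp [ascSum]

/-- The rescaled characteristic function cut off to one period in the variable dual to `wt`. -/
noncomputable def cutChar (t n : ℕ) (a b : ℝ) : ℂ :=
  Set.indicator {b : ℝ | |b * scale n ^ 3| ≤ π} (fun b =>
    bernEx (boltz (bet n)) (Finset.range n) (chi t (a * scale n) (b * scale n ^ 3)) *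
      cexp ((-(a * scale n * ascMean t (boltz (bet n)) n + b * scale n ^ 3 * n) : ℝ) * I)) b

/-- The probability weight common to all configurations of size `n`, up to the period length. -/
noncomputable def levelWt (n : ℕ) : ℝ :=
  2 * π / scale n ^ 3 * ((∏ k ∈ Finset.range n, (1 - boltz (bet n) k)) *
    Real.exp (-(bet n * n)))

lemma levelWt_pos {n : ℕ} (hn : 1 ≤ n) : 0 < levelWt n := by
  have hs := scale_pos hn
  have : 0 < ∏ k ∈ Finset.range n, (1 - boltz (bet n) k) :=
    Finset.prod_pos fun k _ => by have := fermi_lt_one (bet n * (2 * k + 1)); unfold boltz; linarith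
  unfold levelWt
  positivity

lemma cutChar_eq (t n : ℕ) (a b : ℝ) :
    cutChar t n a b = ∑ S ∈ (Finset.range n).powerset,
      (bernWt (boltz (bet n)) (Finset.range n) S *
        cexp ((a * scale n * asc t S - a * scale n * ascMean t (boltz (bet n)) n : ℝ) * I)) *
      Set.indicator {b : ℝ | |b * scale n ^ 3| ≤ π}
        (fun b => cexp ((b * scale n ^ 3 * ((wt S : ℤ) - n : ℤ) : ℝ) * I)) b := by
  unfold cutChar
  by_cases hb : b ∈ {b : ℝ | |b * scale n ^ 3| ≤ π}
  · simp only [Set.indicator_of_mem hb]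
    rw [bernEx, Finset.sum_mul]
    refine Finset.sum_congr rfl fun S _ => ?_
    rw [chi, Complex.real_smul, mul_assoc, mul_assoc (bernWt _ _ S : ℂ), ← Complex.exp_add,
      ← Complex.exp_add]
    congr 2
    push_cast
    ring
  · simp only [Set.indicator_of_notMem hb, mul_zero, Finset.sum_const_zero]

lemma integral_cutChar (t : ℕ) {n : ℕ} (hn : 1 ≤ n) (a : ℝ) :
    ∫ b, cutChar t n a b = levelWt n *
      (cexp ((-(a * scale n * ascMean t (boltz (bet n)) n) : ℝ) * I) *
        ascSum t n (a * scale n)) := by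
  have hs := pow_pos (scale_pos hn) 3
  simp_rw [cutChar_eq]
  rw [integral_finsetSum _ fun S _ => (integrable_indicator_cexp hs _).const_mul _]
  simp_rw [integral_const_mul, integral_indicator_cexp hs]
  have h0 : ∀ S : Finset ℕ, (wt S : ℤ) - n = 0 ↔ wt S = n := by
    intro S; omega
  simp_rw [h0, mul_ite, mul_zero]
  rw [← Finset.sum_filter, ascSum,
    sum_SC_eq n (fun S => cexp ((a * scale n * asc t S : ℝ) * I)), Finset.mul_sum, Finset.mul_sum]
  refine Finset.sum_congr rfl fun S hS => ?_
  rw [Finset.mem_filter, Finset.mem_powerset] at hS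
  rw [bernWt_boltz _ hS.1, hS.2, ← Complex.exp_add, levelWt]
  have e : ((a * scale n * asc t S - a * scale n * ascMean t (boltz (bet n)) n : ℝ) * I : ℂ) =
      (-(a * scale n * ascMean t (boltz (bet n)) n) : ℝ) * I + (a * scale n * asc t S : ℝ) * I := by
    push_cast; ring
  rw [e]
  push_cast
  ring

lemma integrable_cutChar (t : ℕ) {n : ℕ} (hn : 1 ≤ n) (a : ℝ) :
    Integrable (cutChar t n a) := by
  have hs := pow_pos (scale_pos hn) 3
  have : cutChar t n a = fun b => ∑ S ∈ (Finset.range n).powerset,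
      (bernWt (boltz (bet n)) (Finset.range n) S *
        cexp ((a * scale n * asc t S - a * scale n * ascMean t (boltz (bet n)) n : ℝ) * I)) *
      Set.indicator {b : ℝ | |b * scale n ^ 3| ≤ π}
        (fun b => cexp ((b * scale n ^ 3 * ((wt S : ℤ) - n : ℤ) : ℝ) * I)) b :=
    funext fun b => cutChar_eq t n a b
  rw [this]
  exact integrable_finsetSum _ fun S _ => (integrable_indicator_cexp hs _).const_mul _

/-- The limiting variance of `asc t` on the scale `n ^ (1/4)`. -/
noncomputable def ascVar : ℝ := 1 / (8 * kap) * (1 - 6 / π ^ 2)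

lemma limVar_eq (a b : ℝ) : limVar a b =
    π ^ 2 / (12 * kap ^ 3) * (b + 3 * kap * a / π ^ 2) ^ 2 + ascVar * a ^ 2 := by
  have := kap_pos
  rw [limVar, ascVar]
  field_simp
  ring

lemma integral_exp_limVar (a : ℝ) :
    ∫ b, (Real.exp (-limVar a b / 2) : ℂ) =
      (Real.exp (-(ascVar * a ^ 2) / 2) *
        Real.sqrt (π / (π ^ 2 / (24 * kap ^ 3))) : ℝ) := by
  rw [integral_complex_ofReal, ← integral_gaussian,
    ← integral_add_right_eq_self (fun b : ℝ => Real.exp (-(π ^ 2 / (24 * kap ^ 3)) * b ^ 2))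
      (3 * kap * a / π ^ 2), ← integral_const_mul]
  congr 1
  refine integral_congr_ae (Eventually.of_forall fun b => ?_)
  simp only
  rw [← Real.exp_add, limVar_eq]
  congr 1
  have := kap_pos
  field_simp
  ring

lemma tendsto_integral_cutChar {t : ℕ} (ht : 1 ≤ t) (a : ℝ) :
    Tendsto (fun n => ∫ b, cutChar t n a b) atTop
      (nhds (∫ b, (Real.exp (-limVar a b / 2) : ℂ))) := by
  obtain ⟨C, hC⟩ := norm_bernEx_chi_scale_le ht a
  have hC0 : 0 ≤ C := by
    have := (norm_nonneg _).trans (hC 1 le_rfl 0 (by simpa using Real.pi_pos.le))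
    simpa using this
  refine tendsto_integral_filter_of_dominated_convergence (fun b => C * (1 + b ^ 2)⁻¹) ?_ ?_
    (integrable_inv_one_add_sq.const_mul C) ?_
  · filter_upwards [eventually_ge_atTop 1] with n hn
    exact (integrable_cutChar t hn a).aestronglyMeasurable
  · filter_upwards [eventually_ge_atTop 1] with n hn
    refine Eventually.of_forall fun b => ?_
    unfold cutChar
    rw [Set.indicator_apply]
    split_ifs with hb
    · rw [norm_mul, Complex.norm_exp_ofReal_mul_I, mul_one]
      exact hC n hn b hb
    · rw [norm_zero]; positivity
  · refine Eventually.of_forall fun b => (tendsto_bernEx_chi ht a b).congr' ?_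
    have h0 : Tendsto (fun n => |b * scale n ^ 3|) atTop (nhds 0) := by
      simpa using ((tendsto_scale.pow 3).const_mul b).abs
    filter_upwards [h0.eventually_le_const Real.pi_pos] with n hn
    rw [cutChar, Set.indicator_of_mem (by exact hn)]

/-- Central limit theorem for `asc t` in terms of characteristic functions. -/
lemma tendsto_ascSum_div {t : ℕ} (ht : 1 ≤ t) (a : ℝ) :
    Tendsto (fun n => cexp ((-(a * scale n * ascMean t (boltz (bet n)) n) : ℝ) * I) *
      ascSum t n (a * scale n) / (SC n).card) atTop
      (nhds (Real.exp (-(ascVar * a ^ 2) / 2) : ℂ)) := by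
  have hk := kap_pos
  have h0 := tendsto_integral_cutChar ht 0
  have ha := tendsto_integral_cutChar ht a
  rw [integral_exp_limVar] at h0 ha
  have hr : Real.sqrt (π / (π ^ 2 / (24 * kap ^ 3))) ≠ 0 := by positivity
  have hne : ((Real.exp (-(ascVar * 0 ^ 2) / 2) *
      Real.sqrt (π / (π ^ 2 / (24 * kap ^ 3))) : ℝ) : ℂ) ≠ 0 := by
    rw [Complex.ofReal_ne_zero]; positivity
  have h := ha.div h0 hne
  have hl : ((Real.exp (-(ascVar * a ^ 2) / 2) *
      Real.sqrt (π / (π ^ 2 / (24 * kap ^ 3))) : ℝ) : ℂ) /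
      ((Real.exp (-(ascVar * 0 ^ 2) / 2) * Real.sqrt (π / (π ^ 2 / (24 * kap ^ 3))) : ℝ) : ℂ) =
      (Real.exp (-(ascVar * a ^ 2) / 2) : ℂ) := by
    rw [← Complex.ofReal_div, mul_div_mul_right _ _ hr]
    norm_num
  rw [hl] at h
  refine h.congr' ?_
  filter_upwards [eventually_ge_atTop 1] with n hn
  have hw : (levelWt n : ℂ) ≠ 0 := by exact_mod_cast (levelWt_pos hn).ne'
  simp only [Pi.div_apply]
  rw [integral_cutChar t hn, integral_cutChar t hn]
  simp only [zero_mul, neg_zero, Complex.ofReal_zero, Complex.exp_zero, one_mul, ascSum_zero]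
  rw [mul_div_mul_left _ _ hw]

lemma eventually_SC_nonempty : ∀ᶠ n in atTop, (SC n).Nonempty := by
  have h := tendsto_ascSum_div le_rfl 0
  have hne : (Real.exp (-(ascVar * 0 ^ 2) / 2) : ℂ) ≠ 0 := by
    exact_mod_cast (Real.exp_pos _).ne'
  filter_upwards [h.eventually_ne hne] with n hn
  rw [Finset.nonempty_iff_ne_empty]
  rintro h0
  simp [h0] at hn

end FourierInversion

section Convergence

open MeasureTheory ProbabilityTheory

/-- The empirical distribution of the values of `U` on the finite set `s`. -/
noncomputable def empirical {ι : Type*} (s : Finset ι) (U : ι → ℝ) : Measure ℝ :=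
  (s.card : ENNReal)⁻¹ • ∑ i ∈ s, Measure.dirac (U i)

lemma isProbabilityMeasure_empirical {ι : Type*} {s : Finset ι} (hs : s.Nonempty) (U : ι → ℝ) :
    IsProbabilityMeasure (empirical s U) := by
  constructor
  simp only [empirical, Measure.smul_apply, Measure.finsetSum_apply, measure_univ, smul_eq_mul,
    Finset.sum_const, nsmul_eq_mul, mul_one]
  exact ENNReal.inv_mul_cancel (by exact_mod_cast hs.card_pos.ne') (ENNReal.natCast_ne_top _)

lemma charFun_empirical {ι : Type*} (s : Finset ι) (U : ι → ℝ) (a : ℝ) :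
    charFun (empirical s U) a = (∑ i ∈ s, cexp ((a * U i : ℝ) * I)) / s.card := by
  rw [charFun_apply_real, empirical, integral_smul_measure,
    integral_finsetSum_measure fun i _ => integrable_dirac (by simp)]
  simp only [integral_dirac, ENNReal.toReal_inv, ENNReal.toReal_natCast, Complex.real_smul]
  push_cast
  rw [div_eq_inv_mul]

lemma empirical_real_Iic {ι : Type*} (s : Finset ι) (U : ι → ℝ) (x : ℝ) :
    ((empirical s U) (Set.Iic x)).toReal = ((s.filter fun i => U i ≤ x).card : ℝ) / s.card := by
  simp only [empirical, Measure.smul_apply, Measure.finsetSum_apply, smul_eq_mul,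
    Measure.dirac_apply' _ measurableSet_Iic, ENNReal.toReal_mul, ENNReal.toReal_inv,
    ENNReal.toReal_natCast]
  rw [div_eq_inv_mul, Finset.card_filter]
  congr 1
  have : ∑ i ∈ s, (Set.Iic x).indicator (1 : ℝ → ENNReal) (U i) =
      ((∑ i ∈ s, if U i ≤ x then 1 else 0 : ℕ) : ENNReal) := by
    push_cast
    refine Finset.sum_congr rfl fun i _ => ?_
    simp [Set.indicator_apply]
  rw [this, ENNReal.toReal_natCast]

lemma gaussianReal_real_Iic (x : ℝ) : (gaussianReal 0 1 (Set.Iic x)).toReal =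
    (1 / Real.sqrt (2 * π)) * ∫ u in Set.Iic x, Real.exp (-u ^ 2 / 2) := by
  rw [gaussianReal_apply_eq_integral _ one_ne_zero, ENNReal.toReal_ofReal
    (integral_nonneg fun _ => gaussianPDFReal_nonneg _ _ _), ← integral_const_mul]
  refine integral_congr_ae (Eventually.of_forall fun u => ?_)
  simp [gaussianPDFReal_def]

/-- Convergence of characteristic functions to that of the standard Gaussian implies convergence
of distribution functions, for uniform distributions on finite sets. -/
lemma tendsto_card_filter_le_div {ι : ℕ → Type*} (s : ∀ n, Finset (ι n)) (U : ∀ n, ι n → ℝ)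
    (hs : ∀ᶠ n in atTop, (s n).Nonempty)
    (h : ∀ a : ℝ, Tendsto (fun n => (∑ i ∈ s n, cexp ((a * U n i : ℝ) * I)) / (s n).card) atTop
      (nhds (Real.exp (-a ^ 2 / 2) : ℂ))) (x : ℝ) :
    Tendsto (fun n => (((s n).filter fun i => U n i ≤ x).card : ℝ) / (s n).card) atTop
      (nhds ((1 / Real.sqrt (2 * π)) * ∫ u in Set.Iic x, Real.exp (-u ^ 2 / 2))) := by
  set ν : ℕ → ProbabilityMeasure ℝ := fun n =>
    if hn : (s n).Nonempty then ⟨empirical (s n) (U n), isProbabilityMeasure_empirical hn _⟩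
    else ⟨Measure.dirac 0, inferInstance⟩ with hν
  have hνe : ∀ᶠ n in atTop, (ν n : Measure ℝ) = empirical (s n) (U n) := by
    filter_upwards [hs] with n hn
    have : ν n = ⟨empirical (s n) (U n), isProbabilityMeasure_empirical hn _⟩ := dif_pos hn
    rw [this]
    rfl
  set g : ProbabilityMeasure ℝ := ⟨gaussianReal 0 1, inferInstance⟩ with hg
  have hlim : Tendsto ν atTop (nhds g) := by
    refine ProbabilityMeasure.tendsto_of_tendsto_charFun fun a => ?_
    have hc : charFun (g : Measure ℝ) a = (Real.exp (-a ^ 2 / 2) : ℂ) := by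
      refine (charFun_gaussianReal a).trans ?_
      push_cast
      congr 1
      simp
      ring
    rw [hc]
    refine (h a).congr' ?_
    filter_upwards [hνe] with n hn
    rw [hn, charFun_empirical]
  have hfr : (g : Measure ℝ) (frontier (Set.Iic x)) = 0 := by
    rw [frontier_Iic]
    exact (nullSingletonClass_gaussianReal one_ne_zero).measure_singleton x
  have h1 := ProbabilityMeasure.tendsto_measure_of_null_frontier_of_tendsto' hlim hfr
  have h2 := (ENNReal.tendsto_toReal (measure_ne_top _ _)).comp h1
  rw [← gaussianReal_real_Iic]
  refine h2.congr' ?_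
  filter_upwards [hνe] with n hn
  rw [Function.comp_apply, hn, empirical_real_Iic]

end Convergence

section Hooks

lemma ascVar_pos : 0 < ascVar := by
  have := kap_pos
  have h6 : 6 < π ^ 2 := by nlinarith [Real.pi_gt_three]
  have : 0 < 1 - 6 / π ^ 2 := by
    rw [sub_pos, div_lt_one (by positivity)]; exact h6
  unfold ascVar
  positivity

lemma sum_boltz_le {β : ℝ} (hβ : 0 < β) (n : ℕ) : ∑ k ∈ Finset.range n, boltz β k ≤ 96 / β := by
  have : ∀ k ∈ Finset.range n, boltz β k ≤ 96 * Real.exp (-(β * (2 * k + 1)) / 2) := fun k _ => by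
    simpa [boltz] using one_add_pow_mul_fermi_le (y := β * (2 * k + 1)) (by positivity)
      (j := 0) (by norm_num)
  refine (Finset.sum_le_sum this).trans ?_
  rw [← Finset.mul_sum, div_eq_mul_one_div 96 β]
  have := sum_exp_neg_le hβ n
  gcongr

lemma abs_ascMean_sub_le {β : ℝ} (hβ : 0 < β) (t n : ℕ) :
    |ascMean t (boltz β) n - ∑ k ∈ Finset.range n, boltz β k * (1 - boltz β k)| ≤
      2 * t * 96 + t := by
  rw [ascMean, ← Finset.sum_sub_distrib]
  have key : ∀ k ∈ Finset.range n, |boltz β k * (1 - if t ≤ k then boltz β (k - t) else 0) -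
      boltz β k * (1 - boltz β k)| ≤ 2 * t * β * boltz β k + if k < t then 1 else 0 := by
    intro k _
    obtain ⟨h0, h1⟩ := boltz_mem β k
    have e : boltz β k * (1 - if t ≤ k then boltz β (k - t) else 0) -
      boltz β k * (1 - boltz β k) =
      boltz β k * (boltz β k - if t ≤ k then boltz β (k - t) else 0) := by ring
    rw [e, abs_mul, abs_of_nonneg h0]
    by_cases h : t ≤ k
    · rw [if_pos h, if_neg (by omega), add_zero]
      have := abs_boltz_add_sub_le hβ (k - t) t
      rw [Nat.sub_add_cancel h] at this
      nlinarith
    · rw [if_neg h, if_pos (by omega), sub_zero, abs_of_nonneg h0]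
      have : 0 ≤ 2 * t * β * boltz β k := by positivity
      nlinarith
  refine (Finset.abs_sum_le_sum_abs _ _).trans ((Finset.sum_le_sum key).trans ?_)
  rw [Finset.sum_add_distrib, ← Finset.mul_sum]
  have h1 : 2 * t * β * ∑ k ∈ Finset.range n, boltz β k ≤ 2 * t * β * (96 / β) := by
    have := sum_boltz_le hβ n
    gcongr
  have h2 : 2 * t * β * (96 / β) = 2 * t * 96 := by field_simp
  have h3 : ∑ k ∈ Finset.range n, (if k < t then (1 : ℝ) else 0) ≤ t := by
    rw [← Finset.sum_filter, Finset.sum_const, nsmul_eq_mul, mul_one]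
    have hs : (Finset.range n).filter (fun k => k < t) ⊆ Finset.range t := by intro k; simp
    exact_mod_cast (Finset.card_le_card hs).trans_eq (Finset.card_range t)
  linarith

lemma sqrt_six_mul_div_pi {n : ℕ} (hn : 1 ≤ n) : Real.sqrt (6 * n) / π = 1 / (2 * bet n) := by
  have h3 : 0 < Real.sqrt n := Real.sqrt_pos.2 (by exact_mod_cast hn)
  have h24 : Real.sqrt 24 = 2 * Real.sqrt 6 := by
    rw [show (24 : ℝ) = 2 ^ 2 * 6 by norm_num, Real.sqrt_mul (by norm_num),
      Real.sqrt_sq (by norm_num)]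
  have h6 : 0 < Real.sqrt 6 := by positivity
  rw [Real.sqrt_mul (by norm_num), bet, scale_sq, kap, h24]
  field_simp

lemma hook_sd_eq {n : ℕ} (hn : 1 ≤ n) :
    Real.sqrt ((π ^ 2 - 6) * Real.sqrt (6 * n) / π ^ 3) =
      2 * Real.sqrt ascVar / scale n := by
  have hs := scale_pos hn
  have hk := kap_pos
  have h : (π ^ 2 - 6) * Real.sqrt (6 * n) / π ^ 3 = 2 ^ 2 * (ascVar / scale n ^ 2) := by
    have h1 : (π ^ 2 - 6) * Real.sqrt (6 * n) / π ^ 3 =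
        (π ^ 2 - 6) / π ^ 2 * (Real.sqrt (6 * n) / π) := by field_simp
    rw [h1, sqrt_six_mul_div_pi hn, bet, ascVar]
    field_simp
    ring
  rw [h, Real.sqrt_mul (by norm_num), Real.sqrt_sq (by norm_num),
    Real.sqrt_div ascVar_pos.le, Real.sqrt_sq hs.le, mul_div_assoc]

/-- The centring of `Nhook t` in the theorem. -/
noncomputable def hookMean (t n : ℕ) : ℝ :=
  Real.sqrt (6 * n) / π - t / 2 + 3 / π ^ 2 + delta t / 4

lemma abs_hookMean_sub_le (t : ℕ) : ∃ C : ℝ, ∀ n, 1 ≤ n →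
    |hookMean t n - 2 * ascMean t (boltz (bet n)) n| ≤ C := by
  refine ⟨|-(t : ℝ) / 2 + 3 / π ^ 2 + delta t / 4| + 2 * (riemannConst / (2 * kap)) +
    2 * (2 * t * 96 + t), fun n hn => ?_⟩
  have hb := bet_pos hn
  have hs := scale_pos hn
  have hk := kap_pos
  have h1 := abs_ascMean_sub_le hb t n
  set V := ∑ k ∈ Finset.range n, boltz (bet n) k * (1 - boltz (bet n) k) with hV
  have h2 : |V - 1 / (4 * bet n)| ≤ riemannConst / (2 * kap) := by
    have h := (abs_sum_fermi_one_sub_le hb (bet_le_one hn) n).trans (riemannErr_le hn)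
    have e : 2 * bet n * V - 1 / 2 = 2 * bet n * (V - 1 / (4 * bet n)) := by field_simp; ring
    change |2 * bet n * V - 1 / 2| ≤ _ at h
    rw [e, abs_mul, abs_of_nonneg (by positivity), ← le_div_iff₀' (by positivity)] at h
    refine h.trans_eq ?_
    rw [bet]
    field_simp
  have e : hookMean t n - 2 * ascMean t (boltz (bet n)) n =
      (-(t : ℝ) / 2 + 3 / π ^ 2 + delta t / 4) - 2 * (V - 1 / (4 * bet n)) -
        2 * (ascMean t (boltz (bet n)) n - V) := by
    rw [hookMean, sqrt_six_mul_div_pi hn]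
    field_simp
    ring
  rw [e]
  refine (abs_sub _ _).trans ((add_le_add (abs_sub _ _) le_rfl).trans ?_)
  rw [abs_mul 2, abs_mul 2, abs_two]
  linarith

/-- The normalized number of `t`-hooks. -/
noncomputable def hookNormalized (t n : ℕ) (P : n.Partition) : ℝ :=
  (Nhook t P - hookMean t n) / (2 * Real.sqrt ascVar / scale n)

lemma tendsto_charFun_hook {t : ℕ} (ht : 1 ≤ t) (a : ℝ) :
    Tendsto (fun n => (∑ P ∈ SC n, cexp ((a * hookNormalized t n P : ℝ) * I)) / (SC n).card) atTop
      (nhds (Real.exp (-a ^ 2 / 2) : ℂ)) := by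
  have hr : 0 < Real.sqrt ascVar := Real.sqrt_pos.2 ascVar_pos
  have h := tendsto_ascSum_div ht (a / Real.sqrt ascVar)
  have e : ascVar * (a / Real.sqrt ascVar) ^ 2 = a ^ 2 := by
    rw [div_pow, Real.sq_sqrt ascVar_pos.le, mul_div_cancel₀ _ ascVar_pos.ne']
  rw [e] at h
  obtain ⟨C, hC⟩ := abs_hookMean_sub_le t
  refine tendsto_of_tendsto_of_dist h ?_
  refine squeeze_zero' (Eventually.of_forall fun _ => dist_nonneg) ?_
    (tendsto_const_mul_scale (|a| / (2 * Real.sqrt ascVar) * (2 * t + C)))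
  filter_upwards [eventually_ge_atTop 1, eventually_SC_nonempty] with n hn hne
  have hs := scale_pos hn
  have hcard : (0 : ℝ) < (SC n).card := by exact_mod_cast hne.card_pos
  rw [dist_comm, dist_eq_norm, ← sub_div, ascSum, Finset.mul_sum, ← Finset.sum_sub_distrib,
    norm_div, Complex.norm_natCast, div_le_iff₀ hcard]
  refine (norm_sum_le _ _).trans ((Finset.sum_le_card_nsmul _ _
    (|a| / (2 * Real.sqrt ascVar) * (2 * t + C) * scale n) fun P hP => ?_).trans_eq ?_)
  · rw [← Complex.exp_add, ← add_mul, ← Complex.ofReal_add]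
    refine (norm_cexp_I_sub_le _ _).trans ?_
    have hsc : IsSelfConjugate P := by
      simpa [SC] using hP
    obtain ⟨h1, h2⟩ := Nhook_asc ht hsc
    have h3 : |(Nhook t P : ℝ) - 2 * asc t (frob P)| ≤ 2 * t := by
      have h1' : (Nhook t P : ℝ) ≤ 2 * asc t (frob P) + t := by exact_mod_cast h1
      have h2' : 2 * (asc t (frob P) : ℝ) ≤ Nhook t P + 2 * t := by exact_mod_cast h2
      have ht0 : (0 : ℝ) ≤ t := Nat.cast_nonneg t
      rw [abs_le]
      constructor <;> linarith
    have e2 : a * hookNormalized t n P -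
        (-(a / Real.sqrt ascVar * scale n * ascMean t (boltz (bet n)) n) +
          a / Real.sqrt ascVar * scale n * asc t (frob P)) =
        a / (2 * Real.sqrt ascVar) * scale n * (((Nhook t P : ℝ) - 2 * asc t (frob P)) -
          (hookMean t n - 2 * ascMean t (boltz (bet n)) n)) := by
      rw [hookNormalized]
      field_simp
      ring
    rw [e2, abs_mul, abs_mul, abs_div, abs_of_nonneg hs.le,
      abs_of_pos (by positivity : 0 < 2 * Real.sqrt ascVar)]
    have h4 := (abs_sub _ _).trans (add_le_add h3 (hC n hn))
    calc _ ≤ |a| / (2 * Real.sqrt ascVar) * scale n * (2 * t + C) := by gcongr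
      _ = _ := by ring
  · rw [nsmul_eq_mul, mul_comm]

end Hooks

/-- The number of `t`-hooks among self-conjugate partitions of `n` is
asymptotically normally distributed with mean `μ_t(n)` and variance `σ_t(n)²`. -/
theorem stmt0 (t : ℕ) (ht : 1 ≤ t) (x : ℝ) :
    Filter.Tendsto (fun n : ℕ =>
      (((SC n).filter (fun P => (Nhook t P : ℝ) ≤
          (Real.sqrt (6*n)/π - t/2 + 3/π^2 + delta t/4)
            + x * Real.sqrt ((π^2 - 6) * Real.sqrt (6*n) / π^3))).card : ℝ)
        / ((SC n).card : ℝ))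
      Filter.atTop
      (nhds ((1/Real.sqrt (2*π)) * ∫ u in Set.Iic x, Real.exp (-u^2/2))) := by
  refine (tendsto_card_filter_le_div SC (hookNormalized t) eventually_SC_nonempty
    (tendsto_charFun_hook ht) x).congr' ?_
  filter_upwards [eventually_ge_atTop 1] with n hn
  have hs : 0 < 2 * Real.sqrt ascVar / scale n :=
    div_pos (mul_pos two_pos (Real.sqrt_pos.2 ascVar_pos)) (scale_pos hn)
  congr 3
  refine Finset.filter_congr fun P _ => ?_
  rw [hook_sd_eq hn, hookNormalized, div_le_iff₀ hs, hookMean, sub_le_iff_le_add']
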